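/- arXiv:1407.4174 — 4 statements merged into one kernel-verified Lean document; each statement's English description precedes it below -/
import Mathlib

section
/- Let G be a countable abelian group acting on a probability space (X, 𝓑, μ) such that L²(X, 𝓑, μ) is separable, let A ⊆ G be any (not necessarily finite) subset, and let B ∈ 𝓑 have μ(B) > 0. Then for all positive integers j ≤ k one has c(A^k, B)^{1/k} ≤ c(A^j, B)^{1/j} ≤ (μ(A^j B)/μ(B))^{1/j}. -/
open Filter MeasureTheory Pointwise ENNReal

/-- The magnification ratio `c(A, B) = inf { μ(A B') / μ(B') : B' ⊆ B measurable, μ(B') > 0 }`,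
where `A B' = ⋃_{a ∈ A} a • B'`. -/
noncomputable def magRatio {G X : Type*} [SMul G X] [MeasurableSpace X]
    (μ : Measure X) (A : Set G) (B : Set X) : ℝ≥0∞ :=
  sInf {r : ℝ≥0∞ | ∃ B' : Set X, B' ⊆ B ∧ MeasurableSet B' ∧ 0 < μ B' ∧
    r = μ (A • B') / μ B'}


section aux

/-- Layer-cake comparison, with the equality case. -/
theorem layer_compare {X : Type*} [MeasurableSpace X] (μ₁ μ₂ : Measure X)
    [IsFiniteMeasure μ₁] [IsFiniteMeasure μ₂] (f g : X → ℝ≥0∞) (hf : Measurable f)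
    (hg : Measurable g) (K : ℝ≥0∞) (hK : K ≠ ∞) (hfK : ∀ x, f x ≤ K) (hgK : ∀ x, g x ≤ K)
    (h : ∀ s : ℝ≥0∞, μ₁ {x | s < f x} ≤ μ₂ {x | s < g x}) :
    ∫⁻ x, f x ∂μ₁ ≤ ∫⁻ x, g x ∂μ₂ ∧
      (∫⁻ x, g x ∂μ₂ ≤ ∫⁻ x, f x ∂μ₁ → μ₂ {x | 0 < g x} ≤ μ₁ Set.univ) := by
  have key : ∀ (ν : Measure X) (u : X → ℝ≥0∞), Measurable u → (∀ x, u x ≤ K) →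
      ∫⁻ x, u x ∂ν = ∫⁻ t in Set.Ioi (0:ℝ), ν {x | ENNReal.ofReal t < u x} := by
    intro ν u hu huK
    have hne : ∀ x, u x ≠ ∞ := fun x => ne_top_of_le_ne_top hK (huK x)
    have h1 := lintegral_eq_lintegral_meas_lt ν (f := fun x => (u x).toReal)
      (Eventually.of_forall fun x => ENNReal.toReal_nonneg) hu.ennreal_toReal.aemeasurable
    simp only [ENNReal.ofReal_toReal (hne _)] at h1
    rw [h1]
    refine setLIntegral_congr_fun measurableSet_Ioi fun t ht => ?_
    congr 1
    ext x
    simp only [Set.mem_setOf_eq]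
    rw [ENNReal.ofReal_lt_iff_lt_toReal (le_of_lt ht) (hne x)]
  rw [key μ₁ f hf hfK, key μ₂ g hg hgK]
  refine ⟨lintegral_mono fun t => h _, fun hle => ?_⟩
  have hanti : Antitone fun t : ℝ => μ₂ {x | ENNReal.ofReal t < g x} := by
    intro s t hst
    exact measure_mono fun x hx => lt_of_le_of_lt (ENNReal.ofReal_le_ofReal hst) hx
  have hfin : ∫⁻ t in Set.Ioi (0:ℝ), μ₁ {x | ENNReal.ofReal t < f x} ≠ ∞ := by
    rw [← key μ₁ f hf hfK]
    refine ne_top_of_le_ne_top ?_ (lintegral_mono hfK)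
    rw [lintegral_const]
    exact ENNReal.mul_ne_top hK (measure_ne_top _ _)
  have hae := ae_eq_of_ae_le_of_lintegral_le
    (Eventually.of_forall fun t => h (ENNReal.ofReal t)) hfin hanti.measurable.aemeasurable hle
  have hbound : ∀ s : ℝ, 0 < s → μ₂ {x | ENNReal.ofReal s < g x} ≤ μ₁ Set.univ := by
    intro s hs
    have hae2 : ∀ᵐ t ∂(volume.restrict (Set.Ioo (0:ℝ) s)),
        μ₁ {x | ENNReal.ofReal t < f x} = μ₂ {x | ENNReal.ofReal t < g x} :=
      ae_restrict_of_ae_restrict_of_subset Set.Ioo_subset_Ioi_self hae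
    have hne : (volume.restrict (Set.Ioo (0:ℝ) s)) ≠ 0 := by
      intro h0
      have := congrArg (fun m : Measure ℝ => m Set.univ) h0
      simp at this
      linarith
    have : NeBot (ae (volume.restrict (Set.Ioo (0:ℝ) s))) := ae_neBot.2 hne
    obtain ⟨t, ht, hts⟩ := (hae2.and (ae_restrict_mem measurableSet_Ioo)).exists
    calc μ₂ {x | ENNReal.ofReal s < g x} ≤ μ₂ {x | ENNReal.ofReal t < g x} := hanti hts.2.le
      _ = μ₁ {x | ENNReal.ofReal t < f x} := ht.symm
      _ ≤ _ := measure_mono (Set.subset_univ _)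
  have hU : {x | 0 < g x} = ⋃ n : ℕ, {x | ENNReal.ofReal (1 / ((n:ℝ) + 1)) < g x} := by
    ext x
    simp only [Set.mem_setOf_eq, Set.mem_iUnion]
    constructor
    · intro hx
      have hne : g x ≠ ∞ := ne_top_of_le_ne_top hK (hgK x)
      obtain ⟨n, hn⟩ := exists_nat_one_div_lt (ENNReal.toReal_pos hx.ne' hne)
      exact ⟨n, (ENNReal.ofReal_lt_iff_lt_toReal (by positivity) hne).2 hn⟩
    · rintro ⟨n, hn⟩
      exact lt_of_le_of_lt zero_le hn
  rw [hU, Monotone.measure_iUnion]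
  · exact iSup_le fun n => hbound _ (by positivity)
  · intro m n hmn x hx
    simp only [Set.mem_setOf_eq] at hx ⊢
    refine lt_of_le_of_lt (ENNReal.ofReal_le_ofReal ?_) hx
    exact one_div_le_one_div_of_le (by positivity) (by gcongr)

/-- Existence of minimizers of the cut functional. -/
theorem exists_min_cut {Y : Type*} [MeasurableSpace Y] (ν : Measure Y) [IsFiniteMeasure ν]
    (Γ : Set Y → Set Y) (hmono : Monotone Γ) (hmeas : ∀ S, MeasurableSet S → MeasurableSet (Γ S))
    (hU : ∀ S : ℕ → Set Y, Γ (⋃ n, S n) = ⋃ n, Γ (S n)) (K : Set Y) :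
    ∃ T, MeasurableSet T ∧ T ⊆ K ∧ ∀ T', MeasurableSet T' → T' ⊆ K →
      ν (Γ T \ T) ≤ ν (Γ T' \ T') := by
  have hU2 : ∀ S T, Γ (S ∪ T) = Γ S ∪ Γ T := by
    intro S T
    have := hU (fun n => if n = 0 then S else T)
    have e1 : (⋃ n : ℕ, if n = 0 then S else T) = S ∪ T := by
      ext x; simp only [Set.mem_iUnion, Set.mem_union]
      constructor
      · rintro ⟨n, hn⟩; split_ifs at hn <;> simp [hn]
      · rintro (h | h)
        · exact ⟨0, by simpa using h⟩
        · exact ⟨1, by simpa using h⟩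
    have e2 : (⋃ n : ℕ, Γ (if n = 0 then S else T)) = Γ S ∪ Γ T := by
      ext x; simp only [Set.mem_iUnion, Set.mem_union]
      constructor
      · rintro ⟨n, hn⟩; split_ifs at hn <;> simp [hn]
      · rintro (h | h)
        · exact ⟨0, by simpa using h⟩
        · exact ⟨1, by simpa using h⟩
    rw [e1, e2] at this
    exact this
  set m : ℝ≥0∞ := ⨅ T : {T : Set Y // MeasurableSet T ∧ T ⊆ K}, ν (Γ T \ T) with hm
  have hmle : ∀ T, MeasurableSet T → T ⊆ K → m ≤ ν (Γ T \ T) := fun T h1 h2 =>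
    iInf_le (fun T : {T : Set Y // MeasurableSet T ∧ T ⊆ K} => ν (Γ T \ T)) ⟨T, h1, h2⟩
  have hmtop : m ≠ ∞ := ne_top_of_le_ne_top (measure_ne_top ν _)
    (hmle ∅ MeasurableSet.empty (Set.empty_subset _))
  have hsub : ∀ S T, MeasurableSet S → MeasurableSet T →
      ν (Γ (S ∪ T) \ (S ∪ T)) + ν (Γ (S ∩ T) \ (S ∩ T)) ≤ ν (Γ S \ S) + ν (Γ T \ T) := by
    intro S T hS hT
    rw [← measure_union_add_inter (Γ S \ S) ((hmeas T hT).diff hT),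
      ← measure_union_add_inter (Γ (S ∪ T) \ (S ∪ T)) ((hmeas _ (hS.inter hT)).diff (hS.inter hT))]
    have h1 : Γ (S ∩ T) ⊆ Γ S := hmono Set.inter_subset_left
    have h2 : Γ (S ∩ T) ⊆ Γ T := hmono Set.inter_subset_right
    rw [hU2]
    refine add_le_add (measure_mono ?_) (measure_mono ?_)
    · intro x hx
      have a1 := @h1 x
      have a2 := @h2 x
      simp only [Set.mem_union, Set.mem_inter_iff, Set.mem_sdiff] at hx ⊢
      tauto
    · intro x hx
      have a1 := @h1 x
      have a2 := @h2 x
      simp only [Set.mem_union, Set.mem_inter_iff, Set.mem_sdiff] at hx ⊢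
      tauto
  set e : ℕ → ℝ≥0∞ := fun n => (2:ℝ≥0∞)⁻¹ ^ n with he
  have hex : ∀ n : ℕ, ∃ T, (MeasurableSet T ∧ T ⊆ K) ∧ ν (Γ T \ T) ≤ m + e n := by
    intro n
    have : m < m + e n := ENNReal.lt_add_right hmtop (by simp [he])
    obtain ⟨T, hT⟩ := iInf_lt_iff.1 this
    exact ⟨T.1, T.2, hT.le⟩
  choose T hT hTe using hex
  let U : ℕ → ℕ → Set Y := fun n N => ⋃ i ∈ Finset.range (N + 1), T (n + i)
  have hUm : ∀ n N, MeasurableSet (U n N) ∧ U n N ⊆ K := fun n N =>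
    ⟨Finset.measurableSet_biUnion _ fun i _ => (hT _).1,
      Set.iUnion₂_subset fun i _ => (hT _).2⟩
  have hUs : ∀ n N, U n (N + 1) = U n N ∪ T (n + (N + 1)) := by
    intro n N
    simp only [U]
    rw [Finset.range_add_one (n := N + 1), Finset.set_biUnion_insert, Set.union_comm]
  have hUe : ∀ n N, ν (Γ (U n N) \ U n N) ≤ m + ∑ i ∈ Finset.range (N + 1), e (n + i) := by
    intro n N
    induction N with
    | zero => simpa [U] using hTe n
    | succ N ih =>
      rw [hUs]
      have h1 := hsub _ _ (hUm n N).1 (hT (n + (N + 1))).1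
      have h2 := hmle _ ((hUm n N).1.inter (hT (n + (N + 1))).1)
        (Set.inter_subset_left.trans (hUm n N).2)
      have h3 := (add_le_add le_rfl h2).trans (h1.trans (add_le_add ih (hTe _)))
      rw [Finset.sum_range_succ]
      refine (ENNReal.add_le_add_iff_right hmtop).1 (h3.trans (le_of_eq ?_))
      ring
  have hsum : ∀ n N, ∑ i ∈ Finset.range (N + 1), e (n + i) ≤ e n * 2 := by
    intro n N
    simp only [he, pow_add, ← Finset.mul_sum]
    gcongr
    refine (ENNReal.sum_le_tsum _).trans (le_of_eq ?_)
    rw [ENNReal.tsum_geometric]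
    simp
  let V : ℕ → Set Y := fun n => ⋃ N, U n N
  have hVm : ∀ n, MeasurableSet (V n) ∧ V n ⊆ K := fun n =>
    ⟨MeasurableSet.iUnion fun N => (hUm n N).1, Set.iUnion_subset fun N => (hUm n N).2⟩
  have hUmono : ∀ n, Monotone (U n) := fun n => monotone_nat_of_le_succ fun N => by
    rw [hUs]; exact Set.subset_union_left
  have hVe : ∀ n, ν (Γ (V n) \ V n) ≤ m + e n * 2 := by
    intro n
    have : Γ (V n) \ V n = ⋃ N, (Γ (U n N) \ V n) := by
      simp only [V]; rw [hU, Set.iUnion_diff]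
    rw [this, Monotone.measure_iUnion]
    · refine iSup_le fun N => ?_
      refine (measure_mono (Set.diff_subset_diff_right (Set.subset_iUnion _ N))).trans ?_
      exact (hUe n N).trans (by gcongr; exact hsum n N)
    · intro a b hab
      exact Set.diff_subset_diff_left (hmono (hUmono n hab))
  have hVV : ∀ n, V (n + 1) ⊆ V n := by
    intro n x hx
    simp only [V, U, Set.mem_iUnion, Finset.mem_range] at hx ⊢
    obtain ⟨N, i, hi, hx⟩ := hx
    exact ⟨N + 1, i + 1, by omega, by rwa [show n + (i + 1) = n + 1 + i by ring]⟩
  have hVanti : Antitone V := antitone_nat_of_succ_le hVV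
  have hem : Antitone e := fun a b hab => by
    simp only [he]
    exact pow_le_pow_of_le_one zero_le (by simp) hab
  refine ⟨⋂ n, V n, MeasurableSet.iInter fun n => (hVm n).1,
    (Set.iInter_subset _ 0).trans (hVm 0).2, fun T' h1 h2 => ?_⟩
  refine le_trans ?_ (hmle T' h1 h2)
  have hlim : ∀ q, ν (Γ (⋂ n, V n) \ ⋂ n, V n) ≤ m + e q * 2 := by
    intro q
    have : Γ (⋂ n, V n) \ ⋂ n, V n = ⋃ p, (Γ (⋂ n, V n) \ V p) := by
      rw [Set.diff_iInter]
    rw [this, Monotone.measure_iUnion]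
    · refine iSup_le fun p => ?_
      calc ν (Γ (⋂ n, V n) \ V p) ≤ ν (Γ (V (max p q)) \ V (max p q)) := by
            refine measure_mono (Set.diff_subset_diff (hmono (Set.iInter_subset _ _)) ?_)
            exact hVanti (le_max_left _ _)
        _ ≤ m + e (max p q) * 2 := hVe _
        _ ≤ m + e q * 2 := by gcongr; exact hem (le_max_right _ _)
    · intro a b hab
      exact Set.diff_subset_diff_right (hVanti hab)
  have ht : Tendsto (fun q => m + e q * 2) atTop (nhds (m + 0 * 2)) := by
    refine Tendsto.const_add m (ENNReal.Tendsto.mul_const ?_ (by simp))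
    exact ENNReal.tendsto_pow_atTop_nhds_zero_of_lt_one (by simp)
  have := ge_of_tendsto' ht hlim
  simpa using this

end aux

section aux2

variable {G X : Type*} [CommGroup G] [Countable G] [MulAction G X] [MeasurableSpace X]

theorem smul_measurable_aux (hmeas : ∀ g : G, Measurable (fun x : X => g • x))
    (A : Set G) (S : Set X) (hS : MeasurableSet S) : MeasurableSet (A • S) := by
  rw [← Set.iUnion_smul_set]
  refine MeasurableSet.biUnion A.to_countable fun a _ => ?_
  rw [← Set.preimage_smul_inv]
  exact hmeas _ hS

/-- The local exchange lemma. -/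
theorem local_exchange (μ : Measure X) [IsProbabilityMeasure μ]
    (hmeas : ∀ g : G, Measurable (fun x : X => g • x))
    (hinv : ∀ (g : G) (S : Set X), MeasurableSet S → μ (g • S) = μ S)
    (A : Set G) (v : ℝ≥0∞) (hv : v ≠ ∞) (P Q W S : Set X) (hP : MeasurableSet P)
    (hQ : MeasurableSet Q) (hW : MeasurableSet W) (hSdef : S = A • P \ Q)
    (h1 : ∀ Z, MeasurableSet Z → Z ⊆ S → v * μ Z ≤ μ (P ∩ A⁻¹ • Z))
    (h2 : ∀ Z, MeasurableSet Z → Z ⊆ S → μ Z ≤ v * μ (A • Z \ (A • Q ∪ W))) :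
    μ (P ∩ A⁻¹ • S) ≤ v * μ S := by
  have hsm := smul_measurable_aux hmeas
  have hS : MeasurableSet S := hSdef ▸ (hsm A P hP).diff hQ
  set O : Set X := A • S \ (A • Q ∪ W) with hO
  have hOm : MeasurableSet O := (hsm A S hS).diff ((hsm A Q hQ).union hW)
  obtain ⟨w, hw0, hw1⟩ := ENNReal.exists_pos_sum_of_countable (ε := 1) one_ne_zero A
  -- weighted degrees
  let D : Set X → X → ℝ≥0∞ := fun E x => ∑' a : A, (w a : ℝ≥0∞) * E.indicator 1 ((a : G) • x)
  let D' : Set X → X → ℝ≥0∞ := fun E x => ∑' a : A, (w a : ℝ≥0∞) * E.indicator 1 ((a : G)⁻¹ • x)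
  have hterm : ∀ (E : Set X), MeasurableSet E → ∀ (c : ℝ≥0∞) (g : G),
      Measurable fun x => c * E.indicator (1 : X → ℝ≥0∞) (g • x) := by
    intro E hE c g
    exact Measurable.const_mul ((measurable_one.indicator hE).comp (hmeas g)) c
  have hDm : ∀ E, MeasurableSet E → Measurable (D E) := fun E hE =>
    Measurable.ennreal_tsum fun a => hterm E hE _ _
  have hD'm : ∀ E, MeasurableSet E → Measurable (D' E) := fun E hE =>
    Measurable.ennreal_tsum fun a => hterm E hE _ _
  have hind : ∀ (E : Set X) (c : ℝ≥0∞) x, c * E.indicator (1 : X → ℝ≥0∞) x ≤ c := by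
    intro E c x
    refine (mul_le_mul_right (Set.indicator_le_self' (by simp) x) c).trans (by simp)
  have hD1 : ∀ E x, D E x ≤ 1 := fun E x =>
    (ENNReal.tsum_le_tsum fun a => hind E _ _).trans hw1.le
  have hD'1 : ∀ E x, D' E x ≤ 1 := fun E x =>
    (ENNReal.tsum_le_tsum fun a => hind E _ _).trans hw1.le
  -- double counting
  have hdc : ∀ E F : Set X, MeasurableSet E → MeasurableSet F →
      ∫⁻ x in E, D F x ∂μ = ∫⁻ x in F, D' E x ∂μ := by
    intro E F hE hF
    simp only [D, D']
    rw [lintegral_tsum fun a => (hterm F hF _ _).aemeasurable,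
      lintegral_tsum fun a => (hterm E hE _ _).aemeasurable]
    refine tsum_congr fun a => ?_
    rw [lintegral_const_mul' _ _ ENNReal.coe_ne_top, lintegral_const_mul' _ _ ENNReal.coe_ne_top]
    congr 1
    have e1 : ∀ (g : G) (E F : Set X), MeasurableSet F →
        ∫⁻ x in E, F.indicator (1 : X → ℝ≥0∞) (g • x) ∂μ = μ ((fun x => g • x) ⁻¹' F ∩ E) := by
      intro g E F hF
      have : (fun x : X => F.indicator (1 : X → ℝ≥0∞) (g • x))
          = ((fun x : X => g • x) ⁻¹' F).indicator 1 := by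
        ext x; rfl
      rw [this, lintegral_indicator_one (hmeas g hF), Measure.restrict_apply (hmeas g hF)]
    rw [e1 _ _ _ hF, e1 _ _ _ hE, ← hinv (a : G) _ ((hmeas _ hF).inter hE)]
    congr 1
    ext x
    rw [Set.mem_smul_set_iff_inv_smul_mem]
    simp [and_comm]
  -- commutativity
  have hcomm : ∀ u ∈ P, ∀ a ∈ A, ∀ b ∈ A, b • a • u ∈ O → b • u ∈ S := by
    intro u hu a ha b hb ht
    rw [hSdef]
    refine ⟨Set.smul_mem_smul hb hu, fun hq => ht.2 (Or.inl ?_)⟩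
    rw [smul_comm b a u]
    exact Set.smul_mem_smul ha hq
  have hdeg1 : ∀ u ∈ P, ∀ a ∈ A, D O (a • u) ≤ D S u := by
    intro u hu a ha
    refine ENNReal.tsum_le_tsum fun b => ?_
    gcongr
    by_cases hb : (b : G) • a • u ∈ O
    · simp [Set.indicator_of_mem hb, Set.indicator_of_mem (hcomm u hu a ha b b.2 hb)]
    · simp [Set.indicator_of_notMem hb]
  have hdeg2 : ∀ z, ∀ b ∈ A, b • z ∈ O → D' P z ≤ D' S (b • z) := by
    intro z b hb ht
    refine ENNReal.tsum_le_tsum fun a => ?_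
    gcongr
    by_cases hz : (a : G)⁻¹ • z ∈ P
    · have : b • (a : G)⁻¹ • z ∈ S := hcomm _ hz a a.2 b hb (by simpa using ht)
      rw [smul_comm] at this
      simp [Set.indicator_of_mem hz, Set.indicator_of_mem this]
    · simp [Set.indicator_of_notMem hz]
  have : IsFiniteMeasure (v • μ.restrict S) := Measure.smul_finite _ hv
  have : IsFiniteMeasure (v • μ.restrict O) := Measure.smul_finite _ hv
  have hlt : ∀ (f : X → ℝ≥0∞) (s : ℝ≥0∞), Measurable f → MeasurableSet {x | s < f x} :=
    fun f s hf => measurableSet_lt measurable_const hf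
  obtain ⟨-, c1⟩ := layer_compare (v • μ.restrict S) (μ.restrict P) (D O) (D S) (hDm O hOm)
    (hDm S hS) 1 (by simp) (hD1 O) (hD1 S) (by
      intro s
      rw [Measure.smul_apply, smul_eq_mul, Measure.restrict_apply (hlt _ s (hDm O hOm)),
        Measure.restrict_apply (hlt _ s (hDm S hS))]
      refine (h1 _ ((hlt _ s (hDm O hOm)).inter hS) Set.inter_subset_right).trans
        (measure_mono ?_)
      rintro u ⟨hu, hu2⟩
      refine ⟨?_, hu⟩
      obtain ⟨a, ha, z, hz, rfl⟩ := Set.mem_smul.1 hu2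
      have := hdeg1 _ hu a⁻¹ ha
      rw [inv_smul_smul] at this
      exact lt_of_lt_of_le hz.1 this)
  obtain ⟨c2, -⟩ := layer_compare (μ.restrict S) (v • μ.restrict O) (D' P) (D' S) (hD'm P hP)
    (hD'm S hS) 1 (by simp) (hD'1 P) (hD'1 S) (by
      intro s
      rw [Measure.smul_apply, smul_eq_mul, Measure.restrict_apply (hlt _ s (hD'm P hP)),
        Measure.restrict_apply (hlt _ s (hD'm S hS))]
      refine (h2 _ ((hlt _ s (hD'm P hP)).inter hS) Set.inter_subset_right).trans ?_
      gcongr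
      rintro t ⟨ht, ht2⟩
      obtain ⟨b, hb, z, hz, rfl⟩ := Set.mem_smul.1 ht
      have htO : b • z ∈ O := ⟨Set.smul_mem_smul hb hz.2, ht2⟩
      exact ⟨lt_of_lt_of_le hz.1 (hdeg2 z b hb htO), htO⟩)
  have c3 : μ.restrict P {x | 0 < D S x} ≤ (v • μ.restrict S) Set.univ := by
    apply c1
    rw [lintegral_smul_measure, hdc P S hP hS, hdc S O hS hOm]
    rwa [lintegral_smul_measure] at c2
  rw [Measure.smul_apply, smul_eq_mul, Measure.restrict_apply_univ,
    Measure.restrict_apply (hlt _ 0 (hDm S hS))] at c3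
  refine (measure_mono ?_).trans c3
  rintro u ⟨hu, hu2⟩
  refine ⟨?_, hu⟩
  obtain ⟨a, ha, z, hz, rfl⟩ := Set.mem_smul.1 hu2
  have hpos : (0:ℝ≥0∞) < (w ⟨a⁻¹, ha⟩ : ℝ≥0∞) * S.indicator 1 (a⁻¹ • a • z) := by
    rw [inv_smul_smul, Set.indicator_of_mem hz]
    simpa using hw0 ⟨a⁻¹, ha⟩
  exact lt_of_lt_of_le hpos (ENNReal.le_tsum (f := fun b : A =>
    (w b : ℝ≥0∞) * S.indicator 1 ((b : G) • a • z)) ⟨a⁻¹, ha⟩)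

end aux2

section aux3

variable {G X : Type*} [CommGroup G] [Countable G] [MulAction G X] [MeasurableSpace X]

/-- Level `i` neighbours of the previous level. -/
def cutBase (A : Set G) (B : Set X) (T : ℕ → Set X) : ℕ → Set X
  | 0 => B
  | n + 1 => A • T n

/-- Total weight of the cut described by `T`. -/
noncomputable def cutF (μ : Measure X) (A : Set G) (B : Set X) (v : ℝ≥0∞) (k : ℕ)
    (T : ℕ → Set X) : ℝ≥0∞ :=
  ∑ i ∈ Finset.range (k + 1), v ^ i * μ (cutBase A B T i \ T i)

theorem cutBase_measurable (hmeas : ∀ g : G, Measurable (fun x : X => g • x))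
    (A : Set G) (B : Set X) (hB : MeasurableSet B) (T : ℕ → Set X) (hT : ∀ i, MeasurableSet (T i)) :
    ∀ i, MeasurableSet (cutBase A B T i)
  | 0 => hB
  | n + 1 => smul_measurable_aux hmeas A _ (hT n)

theorem prod_nat_measurable (E : Set (ℕ × X)) (h : ∀ i, MeasurableSet (Prod.mk i ⁻¹' E)) :
    MeasurableSet E := by
  have : E = ⋃ i : ℕ, ({i} : Set ℕ) ×ˢ (Prod.mk i ⁻¹' E) := by
    ext ⟨i, x⟩; simp
  rw [this]
  exact MeasurableSet.iUnion fun i => (measurableSet_singleton i).prod (h i)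

theorem exists_min_cutF (μ : Measure X) [IsProbabilityMeasure μ]
    (hmeas : ∀ g : G, Measurable (fun x : X => g • x))
    (A : Set G) (B : Set X) (hB : MeasurableSet B) (v : ℝ≥0∞) (hv : v ≠ ∞) (k : ℕ) :
    ∃ T : ℕ → Set X, (∀ i, MeasurableSet (T i)) ∧ T k = ∅ ∧
      ∀ T' : ℕ → Set X, (∀ i, MeasurableSet (T' i)) → T' k = ∅ →
        cutF μ A B v k T ≤ cutF μ A B v k T' := by
  let ν : Measure (ℕ × X) := ∑ i ∈ Finset.range (k + 1), v ^ i • μ.map (Prod.mk i)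
  have hν : ∀ E, MeasurableSet E →
      ν E = ∑ i ∈ Finset.range (k + 1), v ^ i * μ (Prod.mk i ⁻¹' E) := by
    intro E hE
    simp only [ν, Measure.finsetSum_apply, Measure.smul_apply, smul_eq_mul]
    refine Finset.sum_congr rfl fun i _ => ?_
    rw [Measure.map_apply measurable_prodMk_left hE]
  have hfin : IsFiniteMeasure ν := by
    refine ⟨?_⟩
    rw [hν _ MeasurableSet.univ]
    refine ENNReal.sum_lt_top.2 fun i _ => ?_
    exact ENNReal.mul_lt_top (ENNReal.pow_lt_top hv.lt_top) (measure_lt_top _ _)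
  let Γ : Set (ℕ × X) → Set (ℕ × X) := fun E => {p | p.2 ∈ cutBase A B (fun i => Prod.mk i ⁻¹' E) p.1}
  have hΓs : ∀ E i, Prod.mk i ⁻¹' (Γ E) = cutBase A B (fun i => Prod.mk i ⁻¹' E) i := fun E i => rfl
  have hslice : ∀ E : Set (ℕ × X), MeasurableSet E → ∀ i, MeasurableSet (Prod.mk i ⁻¹' E) :=
    fun E hE i => measurable_prodMk_left hE
  have hΓm : ∀ S, MeasurableSet S → MeasurableSet (Γ S) := fun S hS =>
    prod_nat_measurable _ fun i => cutBase_measurable hmeas A B hB _ (hslice S hS) i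
  obtain ⟨T, hTm, hTK, hTmin⟩ := exists_min_cut ν Γ (by
      rintro S T hST ⟨i, x⟩ hx
      cases i with
      | zero => exact hx
      | succ n =>
        exact Set.smul_subset_smul_left (s := A) (Set.preimage_mono hST) hx) hΓm (by
      intro S
      ext ⟨i, x⟩
      cases i with
      | zero =>
        simp only [Set.mem_iUnion]
        exact ⟨fun h => ⟨0, h⟩, fun ⟨_, h⟩ => h⟩
      | succ n =>
        simp only [Set.mem_iUnion]
        change x ∈ A • (Prod.mk n ⁻¹' ⋃ m, S m) ↔ ∃ m, x ∈ A • (Prod.mk n ⁻¹' S m)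
        rw [Set.preimage_iUnion, Set.smul_iUnion, Set.mem_iUnion]) {p | p.1 ≠ k}
  refine ⟨fun i => Prod.mk i ⁻¹' T, hslice T hTm, ?_, fun T' hT' hT'k => ?_⟩
  · ext x
    simp only [Set.mem_preimage, Set.mem_empty_iff_false, iff_false]
    intro hx
    exact hTK hx rfl
  · let E : Set (ℕ × X) := {p | p.2 ∈ T' p.1}
    have hE : MeasurableSet E := prod_nat_measurable _ hT'
    have := hTmin E hE (by
      rintro ⟨i, x⟩ hx
      simp only [E] at hx
      rintro rfl
      have hx' : x ∈ T' i := hx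
      simp [hT'k] at hx')
    rw [hν _ ((hΓm _ hTm).diff hTm), hν _ ((hΓm _ hE).diff hE)] at this
    exact this

theorem cutBase_update (A : Set G) (B : Set X) (T : ℕ → Set X) (p : ℕ) (R : Set X) (i : ℕ)
    (hi : i ≠ p + 1) : cutBase A B (Function.update T p R) i = cutBase A B T i := by
  cases i with
  | zero => rfl
  | succ n =>
    simp only [cutBase]
    rw [Function.update_of_ne (by omega)]

theorem cutBase_update_succ (A : Set G) (B : Set X) (T : ℕ → Set X) (p : ℕ) (R : Set X) :
    cutBase A B (Function.update T p R) (p + 1) = A • R := by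
  simp [cutBase]

/-- Splitting off the two terms affected by an update at `p`. -/
theorem cutF_split (μ : Measure X) [IsProbabilityMeasure μ] (A : Set G) (B : Set X) (v : ℝ≥0∞)
    (hv : v ≠ ∞) (k : ℕ) (T : ℕ → Set X) (p : ℕ) (hp : p + 1 ≤ k) :
    ∃ r : ℝ≥0∞, r ≠ ∞ ∧
      cutF μ A B v k T = r + (v ^ p * μ (cutBase A B T p \ T p)
        + v ^ (p + 1) * μ (A • T p \ T (p + 1))) ∧
      ∀ R, cutF μ A B v k (Function.update T p R) = r + (v ^ p * μ (cutBase A B T p \ R)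
        + v ^ (p + 1) * μ (A • R \ T (p + 1))) := by
  refine ⟨∑ i ∈ ((Finset.range (k + 1)).erase p).erase (p + 1),
    v ^ i * μ (cutBase A B T i \ T i), ?_, ?_, ?_⟩
  · refine (ENNReal.sum_lt_top.2 fun i _ => ?_).ne
    exact ENNReal.mul_lt_top (ENNReal.pow_lt_top hv.lt_top) (measure_lt_top _ _)
  · rw [cutF, ← Finset.sum_erase_add _ _ (show p ∈ Finset.range (k + 1) by simp; omega),
      ← Finset.sum_erase_add _ _ (show p + 1 ∈ (Finset.range (k + 1)).erase p by simp; omega)]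
    simp only [cutBase]
    ring
  · intro R
    rw [cutF, ← Finset.sum_erase_add _ _ (show p ∈ Finset.range (k + 1) by simp; omega),
      ← Finset.sum_erase_add _ _ (show p + 1 ∈ (Finset.range (k + 1)).erase p by simp; omega),
      cutBase_update_succ, cutBase_update _ _ _ _ _ p (by omega), Function.update_self,
      Function.update_of_ne (by omega)]
    have : ∑ i ∈ ((Finset.range (k + 1)).erase p).erase (p + 1),
        v ^ i * μ (cutBase A B (Function.update T p R) i \ Function.update T p R i)
        = ∑ i ∈ ((Finset.range (k + 1)).erase p).erase (p + 1),
          v ^ i * μ (cutBase A B T i \ T i) := by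
      refine Finset.sum_congr rfl fun i hi => ?_
      simp only [Finset.mem_erase] at hi
      rw [cutBase_update _ _ _ _ _ _ hi.1, Function.update_of_ne hi.2.1]
    rw [this]
    ring

/-- The move: a minimizer may be assumed to have empty cut at level `p + 1`. -/
theorem min_cut_move (μ : Measure X) [IsProbabilityMeasure μ]
    (hmeas : ∀ g : G, Measurable (fun x : X => g • x))
    (hinv : ∀ (g : G) (S : Set X), MeasurableSet S → μ (g • S) = μ S)
    (A : Set G) (B : Set X) (v : ℝ≥0∞) (hv0 : v ≠ 0) (hv : v ≠ ∞) (k : ℕ)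
    (T : ℕ → Set X) (hT : ∀ i, MeasurableSet (T i)) (hTk : T k = ∅)
    (hmin : ∀ T' : ℕ → Set X, (∀ i, MeasurableSet (T' i)) → T' k = ∅ →
        cutF μ A B v k T ≤ cutF μ A B v k T') (p : ℕ) (hp : p + 2 ≤ k) :
    ∃ R, MeasurableSet R ∧ A • R ⊆ T (p + 1) ∧
      cutF μ A B v k (Function.update T p R) ≤ cutF μ A B v k T := by
  have hsm := smul_measurable_aux hmeas
  have hpow : ∀ n, v ^ n ≠ 0 := fun n => pow_ne_zero n hv0
  have hpowt : ∀ n, v ^ n ≠ ∞ := fun n => ENNReal.pow_ne_top hv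
  have hmt : ∀ S : Set X, μ S ≠ ∞ := fun S => measure_ne_top μ S
  have hup : ∀ q R, q < k → MeasurableSet R →
      cutF μ A B v k T ≤ cutF μ A B v k (Function.update T q R) := by
    intro q R hq hR
    refine hmin _ (fun i => ?_) ?_
    · by_cases h : i = q
      · subst h; simpa using hR
      · rw [Function.update_of_ne h]; exact hT i
    · rw [Function.update_of_ne (by omega)]; exact hTk
  set S : Set X := A • T p \ T (p + 1) with hS
  have hSm : MeasurableSet S := (hsm A _ (hT p)).diff (hT _)
  -- shrinking `T p`
  have hsh1 : ∀ Z, μ (cutBase A B T p \ (T p \ A⁻¹ • Z)) ≤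
      μ (cutBase A B T p \ T p) + μ (T p ∩ A⁻¹ • Z) := by
    intro Z
    refine (measure_mono ?_).trans (measure_union_le _ _)
    intro x hx
    simp only [Set.mem_union, Set.mem_inter_iff, Set.mem_sdiff] at hx ⊢
    tauto
  have hsh2 : ∀ Z, A • (T p \ A⁻¹ • Z) \ T (p + 1) ⊆ S \ Z := by
    rintro Z _ ⟨⟨a, ha, u, hu, rfl⟩, hx2⟩
    refine ⟨⟨Set.smul_mem_smul ha hu.1, hx2⟩, fun hz => hu.2 ?_⟩
    refine Set.mem_smul.2 ⟨a⁻¹, by simpa using ha, _, hz, ?_⟩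
    simp
  have hSZ : ∀ Z, MeasurableSet Z → Z ⊆ S → μ S = μ (S \ Z) + μ Z := by
    intro Z hZ hZS
    rw [add_comm, ← measure_inter_add_diff S hZ, Set.inter_eq_self_of_subset_right hZS]
  have hmain := local_exchange μ hmeas hinv A v hv (T p) (T (p + 1)) (T (p + 2)) S (hT _) (hT _)
    (hT _) hS (by
      intro Z hZ hZS
      obtain ⟨r, hr, e1, e2⟩ := cutF_split μ A B v hv k T p (by omega)
      have h := hup p (T p \ A⁻¹ • Z) (by omega) ((hT p).diff (hsm _ _ hZ))
      rw [e1, e2, ENNReal.add_le_add_iff_left hr] at h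
      have h' := h.trans (add_le_add (mul_le_mul_right (hsh1 Z) _)
        (mul_le_mul_right (measure_mono (hsh2 Z)) _))
      rw [← hS, hSZ Z hZ hZS] at h'
      have h3 : (v ^ p * μ (cutBase A B T p \ T p) + v ^ (p + 1) * μ (S \ Z)) + v ^ p * (v * μ Z) ≤
          (v ^ p * μ (cutBase A B T p \ T p) + v ^ (p + 1) * μ (S \ Z))
            + v ^ p * μ (T p ∩ A⁻¹ • Z) := by
        calc _ = v ^ p * μ (cutBase A B T p \ T p) + v ^ (p + 1) * (μ (S \ Z) + μ Z) := by ring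
          _ ≤ _ := h'
          _ = _ := by ring
      rw [ENNReal.add_le_add_iff_left (ENNReal.add_ne_top.2
        ⟨ENNReal.mul_ne_top (hpowt _) (hmt _), ENNReal.mul_ne_top (hpowt _) (hmt _)⟩)] at h3
      exact (ENNReal.mul_le_mul_iff_right (hpow p) (hpowt p)).1 h3)
    (by
      intro Z hZ hZS
      obtain ⟨r, hr, e1, e2⟩ := cutF_split μ A B v hv k T (p + 1) (by omega)
      have h := hup (p + 1) (T (p + 1) ∪ Z) (by omega) ((hT _).union hZ)
      rw [e1, e2, ENNReal.add_le_add_iff_left hr] at h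
      have k1 : cutBase A B T (p + 1) \ (T (p + 1) ∪ Z) = S \ Z := by
        rw [hS]; ext x; simp [cutBase, not_or, and_assoc]
      have k2 : μ (A • (T (p + 1) ∪ Z) \ T (p + 1 + 1)) ≤
          μ (A • T (p + 1) \ T (p + 1 + 1)) + μ (A • Z \ (A • T (p + 1) ∪ T (p + 2))) := by
        refine (measure_mono ?_).trans (measure_union_le _ _)
        rw [Set.smul_union]
        intro x hx
        simp only [Set.mem_union, Set.mem_sdiff] at hx ⊢
        tauto
      have k3 : cutBase A B T (p + 1) \ T (p + 1) = S := rfl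
      rw [k1, k3] at h
      have h' := h.trans (add_le_add le_rfl (mul_le_mul_right k2 _))
      rw [hSZ Z hZ hZS] at h'
      set w := μ (A • T (p + 1) \ T (p + 1 + 1))
      have h3 : (v ^ (p + 1) * μ (S \ Z) + v ^ (p + 1 + 1) * w) + v ^ (p + 1) * μ Z ≤
          (v ^ (p + 1) * μ (S \ Z) + v ^ (p + 1 + 1) * w)
            + v ^ (p + 1) * (v * μ (A • Z \ (A • T (p + 1) ∪ T (p + 2)))) := by
        calc _ = v ^ (p + 1) * (μ (S \ Z) + μ Z) + v ^ (p + 1 + 1) * w := by ring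
          _ ≤ _ := h'
          _ = _ := by ring
      rw [ENNReal.add_le_add_iff_left (ENNReal.add_ne_top.2
        ⟨ENNReal.mul_ne_top (hpowt _) (hmt _), ENNReal.mul_ne_top (hpowt _) (hmt _)⟩)] at h3
      exact (ENNReal.mul_le_mul_iff_right (hpow _) (hpowt _)).1 h3)
  have hempty : A • (T p \ A⁻¹ • S) \ T (p + 1) = ∅ := by
    have := hsh2 S
    rwa [Set.sdiff_self, Set.subset_empty_iff] at this
  refine ⟨T p \ A⁻¹ • S, (hT p).diff (hsm _ _ hSm), Set.sdiff_eq_empty.1 hempty, ?_⟩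
  obtain ⟨r, hr, e1, e2⟩ := cutF_split μ A B v hv k T p (by omega)
  rw [e1, e2, hempty, measure_empty, mul_zero, add_zero, ← hS]
  gcongr
  calc v ^ p * μ (cutBase A B T p \ (T p \ A⁻¹ • S))
      ≤ v ^ p * (μ (cutBase A B T p \ T p) + v * μ S) := by
        gcongr
        exact (hsh1 S).trans (add_le_add le_rfl hmain)
    _ = _ := by ring

/-- Every cut has weight at least `μ B`. -/
theorem cutF_ge (μ : Measure X) [IsProbabilityMeasure μ]
    (hmeas : ∀ g : G, Measurable (fun x : X => g • x))
    (hinv : ∀ (g : G) (S : Set X), MeasurableSet S → μ (g • S) = μ S)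
    (A : Set G) (B : Set X) (hB : MeasurableSet B) (v : ℝ≥0∞) (hv0 : v ≠ 0) (hv : v ≠ ∞)
    (k : ℕ) (hk : 0 < k)
    (hAk : ∀ B', B' ⊆ B → MeasurableSet B' → μ B' ≤ v ^ k * μ (A ^ k • B'))
    (T' : ℕ → Set X) (hT' : ∀ i, MeasurableSet (T' i)) (hT'k : T' k = ∅) :
    μ B ≤ cutF μ A B v k T' := by
  have hstep : ∀ n, n + 1 ≤ k → ∃ T : ℕ → Set X, (∀ i, MeasurableSet (T i)) ∧ T k = ∅ ∧
      (∀ T' : ℕ → Set X, (∀ i, MeasurableSet (T' i)) → T' k = ∅ →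
        cutF μ A B v k T ≤ cutF μ A B v k T') ∧
      ∀ i, k ≤ i + 1 + n → i + 2 ≤ k → A • T i ⊆ T (i + 1) := by
    intro n
    induction n with
    | zero =>
      intro _
      obtain ⟨T, h1, h2, h3⟩ := exists_min_cutF μ hmeas A B hB v hv k
      exact ⟨T, h1, h2, h3, fun i _ _ => by omega⟩
    | succ n ih =>
      intro hn
      obtain ⟨T, h1, h2, h3, h4⟩ := ih (by omega)
      obtain ⟨p, hp⟩ : ∃ p, k = p + 2 + n := ⟨k - 2 - n, by omega⟩
      obtain ⟨R, hR, hRs, hRF⟩ := min_cut_move μ hmeas hinv A B v hv0 hv k T h1 h2 h3 p (by omega)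
      refine ⟨Function.update T p R, fun i => ?_, ?_, fun T' a b => hRF.trans (h3 T' a b), ?_⟩
      · by_cases h : i = p
        · subst h; simpa using hR
        · rw [Function.update_of_ne h]; exact h1 i
      · rw [Function.update_of_ne (by omega)]; exact h2
      · intro i hi hi2
        rw [Function.update_of_ne (show i + 1 ≠ p by omega)]
        by_cases h : i = p
        · subst h; simpa using hRs
        · rw [Function.update_of_ne h]; exact h4 i (by omega) hi2
  obtain ⟨T, h1, h2, h3, h4⟩ := hstep (k - 1) (by omega)
  refine le_trans ?_ (h3 T' hT' hT'k)
  have hchain : ∀ i, i + 1 ≤ k → A ^ i • T 0 ⊆ T i := by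
    intro i
    induction i with
    | zero => intro _; simp
    | succ n ih =>
      intro hn
      rw [pow_succ', mul_smul]
      exact (Set.smul_subset_smul_left (ih (by omega))).trans (h4 n (by omega) (by omega))
  obtain ⟨n, rfl⟩ : ∃ n, k = n + 1 := ⟨k - 1, by omega⟩
  rw [cutF, Finset.sum_range_succ, Finset.sum_range_succ']
  have hlast : A ^ (n + 1) • (B ∩ T 0) ⊆ cutBase A B T (n + 1) \ T (n + 1) := by
    rw [h2, Set.sdiff_empty, pow_succ', mul_smul]
    refine Set.smul_subset_smul_left ?_
    exact (Set.smul_subset_smul_left Set.inter_subset_right).trans (hchain n le_rfl)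
  calc μ B ≤ μ (B \ T 0) + μ (B ∩ T 0) := by
        rw [add_comm, measure_inter_add_diff B (h1 0)]
    _ ≤ μ (B \ T 0) + v ^ (n + 1) * μ (A ^ (n + 1) • (B ∩ T 0)) := by
        gcongr
        exact hAk _ Set.inter_subset_left (hB.inter (h1 0))
    _ ≤ v ^ 0 * μ (cutBase A B T 0 \ T 0) + v ^ (n + 1) * μ (cutBase A B T (n + 1) \ T (n + 1)) := by
        gcongr
        simp [cutBase]
    _ ≤ _ := by
        gcongr
        exact le_add_self

theorem plunnecke_core (μ : Measure X) [IsProbabilityMeasure μ]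
    (hmeas : ∀ g : G, Measurable (fun x : X => g • x))
    (hinv : ∀ (g : G) (S : Set X), MeasurableSet S → μ (g • S) = μ S)
    (A : Set G) (B : Set X) (hB : MeasurableSet B) (v : ℝ≥0∞) (hv0 : v ≠ 0) (hv : v ≠ ∞)
    (j k : ℕ) (hj : 0 < j) (hjk : j ≤ k)
    (hAk : ∀ B', B' ⊆ B → MeasurableSet B' → μ B' ≤ v ^ k * μ (A ^ k • B'))
    (B' : Set X) (hB'B : B' ⊆ B) (hB' : MeasurableSet B') :
    μ B' ≤ v ^ j * μ (A ^ j • B') := by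
  have hsm := smul_measurable_aux hmeas
  have h := cutF_ge μ hmeas hinv A B hB v hv0 hv k (by omega) hAk
    (fun i => if i < j then A ^ i • B' else ∅) (by
      intro i
      split_ifs
      · exact hsm _ _ hB'
      · exact MeasurableSet.empty) (by simp [hjk])
  have hF : cutF μ A B v k (fun i => if i < j then A ^ i • B' else ∅) ≤
      μ (B \ B') + v ^ j * μ (A ^ j • B') := by
    rw [cutF]
    have hz : ∀ i ∈ Finset.range (k + 1), i ∉ ({0, j} : Finset ℕ) →
        v ^ i * μ (cutBase A B (fun i => if i < j then A ^ i • B' else ∅) i \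
          (if i < j then A ^ i • B' else ∅)) = 0 := by
      intro i _ hi
      simp only [Finset.mem_insert, Finset.mem_singleton, not_or] at hi
      obtain ⟨n, rfl⟩ : ∃ n, i = n + 1 := ⟨i - 1, by omega⟩
      have : (cutBase A B (fun i => if i < j then A ^ i • B' else ∅) (n + 1) \
          (if n + 1 < j then A ^ (n + 1) • B' else ∅)) = ∅ := by
        simp only [cutBase]
        by_cases h : n + 1 < j
        · rw [if_pos h, if_pos (by omega), pow_succ', mul_smul, Set.sdiff_self]
        · rw [if_neg h, if_neg (by omega)]; simp
      rw [this]; simp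
    rw [← Finset.sum_subset (s₁ := ({0, j} : Finset ℕ)) (by
      intro i; simp only [Finset.mem_insert, Finset.mem_singleton, Finset.mem_range]; omega) hz,
      Finset.sum_pair (by omega)]
    obtain ⟨n, rfl⟩ : ∃ n, j = n + 1 := ⟨j - 1, by omega⟩
    simp [cutBase, pow_succ' A n, mul_smul]
  have h2 : μ (B \ B') + μ B' ≤ μ (B \ B') + v ^ j * μ (A ^ j • B') := by
    refine le_trans (le_of_eq ?_) (h.trans hF)
    rw [add_comm, ← measure_inter_add_diff B hB', Set.inter_eq_self_of_subset_right hB'B]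
  exact (ENNReal.add_le_add_iff_left (measure_ne_top _ _)).1 h2

end aux3

/-- Plünnecke inequalities for an infinite set of translates: if a countable abelian group
`G` acts on a probability space `(X, 𝓑, μ)` with `L²(X, 𝓑, μ)` separable, `A ⊆ G` is any
subset and `B` is measurable with `μ(B) > 0`, then for positive integers `j ≤ k` one has
`c(A^k, B)^(1/k) ≤ c(A^j, B)^(1/j) ≤ (μ(A^j B)/μ(B))^(1/j)`. -/
theorem magRatio_plunnecke_infinite_translates {G X : Type*} [CommGroup G] [Countable G]
    [MulAction G X] [MeasurableSpace X] (μ : Measure X) [IsProbabilityMeasure μ]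
    (hsep : TopologicalSpace.SeparableSpace (MeasureTheory.Lp ℝ 2 μ))
    (hmeas : ∀ g : G, Measurable (fun x : X => g • x))
    (hinv : ∀ (g : G) (S : Set X), MeasurableSet S → μ (g • S) = μ S)
    (A : Set G) (B : Set X) (hB : MeasurableSet B) (hB0 : 0 < μ B)
    (j k : ℕ) (hj : 0 < j) (hjk : j ≤ k) :
    magRatio μ (A ^ k) B ^ (1 / (k : ℝ)) ≤ magRatio μ (A ^ j) B ^ (1 / (j : ℝ)) ∧
      magRatio μ (A ^ j) B ^ (1 / (j : ℝ)) ≤ (μ ((A ^ j) • B) / μ B) ^ (1 / (j : ℝ)) := by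
  have hle : ∀ i : ℕ, magRatio μ (A ^ i) B ≤ μ ((A ^ i) • B) / μ B := fun i =>
    sInf_le ⟨B, subset_rfl, hB, hB0, rfl⟩
  refine ⟨?_, ENNReal.rpow_le_rpow (hle j) (by positivity)⟩
  have hk : 0 < k := by omega
  have hkR : (0:ℝ) < k := by exact_mod_cast hk
  have hjR : (0:ℝ) < j := by exact_mod_cast hj
  by_cases h0 : magRatio μ (A ^ k) B = 0
  · rw [h0, ENNReal.zero_rpow_of_pos (by positivity)]
    exact zero_le
  have htop : magRatio μ (A ^ k) B ≠ ∞ :=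
    ne_top_of_le_ne_top (ENNReal.div_ne_top (measure_ne_top _ _) hB0.ne') (hle k)
  set C : ℝ≥0∞ := magRatio μ (A ^ k) B ^ (1 / (k : ℝ)) with hC
  have hC0 : C ≠ 0 := by
    rw [hC]
    simp [ENNReal.rpow_eq_zero_iff, h0, htop]
  have hCt : C ≠ ∞ := ENNReal.rpow_ne_top_of_nonneg (by positivity) htop
  have hCk : C ^ k = magRatio μ (A ^ k) B := by
    rw [hC, ← ENNReal.rpow_natCast, ← ENNReal.rpow_mul, one_div_mul_cancel hkR.ne',
      ENNReal.rpow_one]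
  have hpt : ∀ n : ℕ, C ^ n ≠ ∞ := fun n => ENNReal.pow_ne_top hCt
  have hp0 : ∀ n : ℕ, C ^ n ≠ 0 := fun n => pow_ne_zero n hC0
  have hconv : ∀ (n : ℕ) (a b : ℝ≥0∞), a ≤ C⁻¹ ^ n * b ↔ C ^ n * a ≤ b := by
    intro n a b
    rw [← ENNReal.inv_pow]
    constructor
    · intro h
      calc C ^ n * a ≤ C ^ n * ((C ^ n)⁻¹ * b) := by gcongr
        _ = b := by rw [← mul_assoc, ENNReal.mul_inv_cancel (hp0 n) (hpt n), one_mul]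
    · intro h
      calc a = (C ^ n)⁻¹ * (C ^ n * a) := by
            rw [← mul_assoc, ENNReal.inv_mul_cancel (hp0 n) (hpt n), one_mul]
        _ ≤ _ := by gcongr
  have hcore : C ^ j ≤ magRatio μ (A ^ j) B := by
    refine le_sInf ?_
    rintro r ⟨B', hB'B, hB', hB'0, rfl⟩
    rw [ENNReal.le_div_iff_mul_le (Or.inl hB'0.ne') (Or.inl (measure_ne_top _ _)), ← hconv]
    refine plunnecke_core μ hmeas hinv A B hB C⁻¹ (by simpa using hCt) (by simpa using hC0) j k hj
      hjk ?_ B' hB'B hB'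
    intro B'' h1 h2
    rw [hconv]
    rcases eq_or_ne (μ B'') 0 with h3 | h3
    · rw [h3, mul_zero]; exact zero_le
    rw [← ENNReal.le_div_iff_mul_le (Or.inl h3) (Or.inl (measure_ne_top _ _)), hCk]
    exact sInf_le ⟨B'', h1, h2, pos_iff_ne_zero.2 h3, rfl⟩
  calc C = (C ^ j) ^ (1 / (j : ℝ)) := by
        rw [← ENNReal.rpow_natCast, ← ENNReal.rpow_mul, mul_one_div_cancel hjR.ne',
          ENNReal.rpow_one]
    _ ≤ _ := ENNReal.rpow_le_rpow hcore (by positivity)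
end

section
/- Let G be a countable abelian group and A, B ⊆ G. Then there exists a compact metrizable space X on which G acts by homeomorphisms, G-invariant ergodic Borel probability measures μ and ν on X, and a clopen set B̃ ⊆ X, such that d*(B) = μ(B̃), d*(AB) ≥ μ(AB̃), d_*(B) ≤ ν(B̃), and d_*(AB) ≥ ν(AB̃), where AB̃ = ⋃_{a ∈ A} a·B̃. -/
open Filter MeasureTheory Pointwise

variable {G : Type*}

/-- A Følner sequence: a sequence of nonempty finite subsets `F n` of `G` such that
`|F n ∩ g • F n| / |F n| → 1` for every `g ∈ G`. -/
def IsFolner [Group G] (F : ℕ → Finset G) : Prop :=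
  (∀ n, (F n).Nonempty) ∧
    ∀ g : G, Filter.Tendsto
      (fun n => ((((F n : Set G)) ∩ (g • (F n : Set G))).ncard : ℝ) / (F n).card)
      Filter.atTop (nhds 1)

/-- The upper Banach density of `A ⊆ G`: the supremum over Følner sequences of the
limsup of `|F n ∩ A| / |F n|`. -/
noncomputable def upperBanachDensity [Group G] (A : Set G) : ℝ :=
  sSup {d : ℝ | ∃ F : ℕ → Finset G, IsFolner F ∧
    d = Filter.limsup (fun n => (((F n : Set G) ∩ A).ncard : ℝ) / (F n).card) Filter.atTop}

/-- The lower Banach density of `A ⊆ G`: the infimum over Følner sequences of the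
liminf of `|F n ∩ A| / |F n|`. -/
noncomputable def lowerBanachDensity [Group G] (A : Set G) : ℝ :=
  sInf {d : ℝ | ∃ F : ℕ → Finset G, IsFolner F ∧
    d = Filter.liminf (fun n => (((F n : Set G) ∩ A).ncard : ℝ) / (F n).card) Filter.atTop}


section Folner

/-- Relative density of `R` in the finite set `F`. -/
noncomputable def fdens (F : Finset G) (R : Set G) : ℝ := (((F : Set G) ∩ R).ncard : ℝ) / F.card

lemma fdens_nonneg (F : Finset G) (R : Set G) : 0 ≤ fdens F R := by
  unfold fdens; positivity

lemma fdens_le_one (F : Finset G) (R : Set G) : fdens F R ≤ 1 := by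
  unfold fdens
  apply div_le_one_of_le₀ _ (by positivity)
  have := Set.ncard_le_ncard (Set.inter_subset_left : (F : Set G) ∩ R ⊆ F) F.finite_toSet
  rw [Set.ncard_coe_finset] at this
  exact_mod_cast this

lemma fdens_compl (F : Finset G) (hF : F.Nonempty) (R : Set G) :
    fdens F Rᶜ = 1 - fdens F R := by
  have h := Set.ncard_inter_add_ncard_sdiff_eq_ncard (F : Set G) R F.finite_toSet
  rw [Set.ncard_coe_finset] at h
  have hc : (0 : ℝ) < F.card := by exact_mod_cast hF.card_pos
  unfold fdens
  rw [← Set.sdiff_eq]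
  rw [eq_sub_iff_add_eq, ← add_div, div_eq_one_iff_eq hc.ne', ← h]
  push_cast; ring

lemma pow_growth [CommGroup G] [DecidableEq G] (S : Finset G) (n : ℕ) :
    (S ^ n).card ≤ (n + 1) ^ S.card := by
  have key : ∀ n : ℕ, ∀ x ∈ S ^ n, ∃ a : S → ℕ, (∀ s, a s ≤ n) ∧ x = ∏ s : S, (s : G) ^ a s := by
    intro n
    induction n with
    | zero => intro x hx; exact ⟨0, by simp, by simpa using hx⟩
    | succ n ih =>
      intro x hx
      rw [pow_succ, Finset.mem_mul] at hx
      obtain ⟨y, hy, z, hz, rfl⟩ := hx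
      obtain ⟨a, ha, rfl⟩ := ih y hy
      refine ⟨a + Pi.single ⟨z, hz⟩ 1, ?_, ?_⟩
      · intro s
        have := ha s
        by_cases h : s = ⟨z, hz⟩
        · subst h; simp; omega
        · simp [h]; omega
      · simp only [Pi.add_apply, pow_add, Finset.prod_mul_distrib]
        congr 1
        rw [Finset.prod_eq_single (⟨z, hz⟩ : S)]
        · simp
        · intro b _ hb; simp [hb]
        · simp
  have : S ^ n ⊆ (Fintype.piFinset (fun _ : S => Finset.range (n + 1))).image
      (fun a => ∏ s : S, (s : G) ^ a s) := by
    intro x hx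
    obtain ⟨a, ha, rfl⟩ := key n x hx
    refine Finset.mem_image_of_mem _ ?_
    simp only [Fintype.mem_piFinset, Finset.mem_range]
    intro s; have := ha s; omega
  refine (Finset.card_le_card this).trans (Finset.card_image_le.trans ?_)
  simp

lemma exists_almost_inv [CommGroup G] [DecidableEq G] (K : Finset G) (ε : ℝ) (hε : 0 < ε) :
    ∃ F : Finset G, F.Nonempty ∧
      ∀ g ∈ K, (1 - ε) * F.card ≤ (((F : Set G) ∩ (g • (F : Set G))).ncard : ℝ) := by
  set S : Finset G := insert 1 K with hS
  have h1 : (1 : G) ∈ S := by simp [hS]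
  have hne : ∀ n, (S ^ n).Nonempty := fun n => Finset.Nonempty.pow ⟨1, h1⟩
  obtain ⟨n, hn⟩ : ∃ n : ℕ, ((S ^ (n + 1)).card : ℝ) ≤ (1 + ε) * (S ^ n).card := by
    by_contra! hcon
    have hlow : ∀ n : ℕ, (1 + ε) ^ n ≤ ((S ^ n).card : ℝ) := by
      intro n
      induction n with
      | zero => simp
      | succ n ih =>
        rw [pow_succ']
        exact (mul_le_mul_of_nonneg_left ih (by positivity)).trans (hcon n).le
    have ht := tendsto_pow_const_div_const_pow_of_one_lt S.card (show 1 < 1 + ε by linarith)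
    have ht2 := (tendsto_add_atTop_iff_nat 1).2 ht
    have hev := ht2.eventually (gt_mem_nhds (show (0 : ℝ) < 1 / (1 + ε) by positivity))
    obtain ⟨n, hn⟩ := hev.exists
    have h2 : (1 + ε) ^ n ≤ ((n + 1 : ℕ) : ℝ) ^ S.card :=
      (hlow n).trans (by exact_mod_cast pow_growth S n)
    rw [div_lt_div_iff₀ (by positivity) (by positivity), one_mul, pow_succ] at hn
    have : (0 : ℝ) < 1 + ε := by positivity
    nlinarith
  refine ⟨S ^ n, hne n, ?_⟩
  intro g hg
  have hgS : g ∈ S := by simp [hS, hg]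
  set F := S ^ n
  have hco : ((F : Set G) ∩ (g • (F : Set G))) = ((F ∩ (g • F) : Finset G) : Set G) := by
    simp
  rw [hco, Set.ncard_coe_finset]
  have hU : F ∪ g • F ⊆ S ^ (n + 1) := by
    apply Finset.union_subset
    · intro x hx
      rw [pow_succ]
      simpa using Finset.mul_mem_mul hx h1
    · intro x hx
      obtain ⟨y, hy, rfl⟩ := Finset.mem_smul_finset.1 hx
      rw [pow_succ']
      exact Finset.mul_mem_mul hgS hy
  have hcard := Finset.card_union_add_card_inter F (g • F)
  rw [Finset.card_smul_finset] at hcard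
  have hle := Finset.card_le_card hU
  have hle' : ((F ∪ g • F).card : ℝ) ≤ (S ^ (n + 1)).card := by exact_mod_cast hle
  have hcard' : ((F ∪ g • F).card : ℝ) + (F ∩ g • F).card = F.card + F.card := by
    exact_mod_cast hcard
  linarith

lemma exists_folner [CommGroup G] [Countable G] : ∃ F : ℕ → Finset G, IsFolner F := by
  classical
  obtain ⟨e, he⟩ := exists_surjective_nat G
  have := fun n : ℕ => exists_almost_inv ((Finset.range n).image e) (1 / ((n : ℝ) + 1))
    (by positivity)
  choose F hF hF' using this
  refine ⟨F, hF, fun g => ?_⟩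
  obtain ⟨k, rfl⟩ := he g
  have ht : Tendsto (fun n : ℕ => 1 - 1 / ((n : ℝ) + 1)) atTop (nhds 1) := by
    simpa using (tendsto_one_div_add_atTop_nhds_zero_nat (𝕜 := ℝ)).const_sub 1
  refine tendsto_of_tendsto_of_tendsto_of_le_of_le' ht tendsto_const_nhds ?_ ?_
  · filter_upwards [eventually_gt_atTop k] with n hn
    have hc : (0 : ℝ) < (F n).card := by exact_mod_cast (hF n).card_pos
    rw [le_div_iff₀ hc]
    exact hF' n (e k) (Finset.mem_image_of_mem _ (by simpa using hn))
  · exact Eventually.of_forall fun n => fdens_le_one (F n) _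

lemma folner_translate [CommGroup G] [DecidableEq G] {F : ℕ → Finset G} (hF : IsFolner F)
    (c : ℕ → G) : IsFolner (fun n => c n • F n) := by
  refine ⟨fun n => (hF.1 n).smul_finset, fun g => ?_⟩
  convert hF.2 g using 2 with n
  rw [Finset.card_smul_finset, Finset.coe_smul_finset, smul_comm g (c n), ← Set.smul_set_inter,
    Set.ncard_smul_set]

lemma fdens_translate [CommGroup G] [DecidableEq G] (F : Finset G) (c : G) (R : Set G) :
    fdens (c • F) R = fdens F (c⁻¹ • R) := by
  unfold fdens
  rw [Finset.card_smul_finset, Finset.coe_smul_finset,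
    ← Set.ncard_smul_set c⁻¹ ((c • (F : Set G)) ∩ R), Set.smul_set_inter, inv_smul_smul]

lemma folner_subseq [Group G] {F : ℕ → Finset G} (hF : IsFolner F) {ψ : ℕ → ℕ}
    (hψ : StrictMono ψ) : IsFolner (fun n => F (ψ n)) :=
  ⟨fun n => hF.1 _, fun g => (hF.2 g).comp hψ.tendsto_atTop⟩

lemma bdd_le (F : ℕ → Finset G) (R : Set G) :
    IsBoundedUnder (· ≤ ·) atTop (fun n => fdens (F n) R) :=
  isBoundedUnder_of ⟨1, fun n => fdens_le_one _ _⟩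

lemma bdd_ge (F : ℕ → Finset G) (R : Set G) :
    IsBoundedUnder (· ≥ ·) atTop (fun n => fdens (F n) R) :=
  isBoundedUnder_of ⟨0, fun n => fdens_nonneg _ _⟩

lemma limsup_le_upper [Group G] {F : ℕ → Finset G} (hF : IsFolner F) (R : Set G) :
    limsup (fun n => fdens (F n) R) atTop ≤ upperBanachDensity R := by
  apply le_csSup
  · refine ⟨1, ?_⟩
    rintro d ⟨F, hF, rfl⟩
    exact limsup_le_of_le (bdd_ge F R).isCoboundedUnder_le
      (Eventually.of_forall fun n => fdens_le_one (F n) R)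
  · exact ⟨F, hF, rfl⟩

lemma lower_le_liminf [Group G] {F : ℕ → Finset G} (hF : IsFolner F) (R : Set G) :
    lowerBanachDensity R ≤ liminf (fun n => fdens (F n) R) atTop := by
  apply csInf_le
  · refine ⟨0, ?_⟩
    rintro d ⟨F, hF, rfl⟩
    exact le_liminf_of_le (bdd_le F R).isCoboundedUnder_ge
      (Eventually.of_forall fun n => fdens_nonneg (F n) R)
  · exact ⟨F, hF, rfl⟩

lemma upper_le [CommGroup G] [Countable G] {R : Set G} {c : ℝ}
    (h : ∀ F : ℕ → Finset G, IsFolner F → limsup (fun n => fdens (F n) R) atTop ≤ c) :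
    upperBanachDensity R ≤ c := by
  obtain ⟨F, hF⟩ := exists_folner (G := G)
  refine csSup_le (Set.nonempty_of_mem ⟨F, hF, rfl⟩) ?_
  rintro d ⟨F, hF, rfl⟩
  exact h F hF

lemma le_lower [CommGroup G] [Countable G] {R : Set G} {c : ℝ}
    (h : ∀ F : ℕ → Finset G, IsFolner F → c ≤ liminf (fun n => fdens (F n) R) atTop) :
    c ≤ lowerBanachDensity R := by
  obtain ⟨F, hF⟩ := exists_folner (G := G)
  refine le_csInf (Set.nonempty_of_mem ⟨F, hF, rfl⟩) ?_
  rintro d ⟨F, hF, rfl⟩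
  exact h F hF

lemma liminf_compl [Group G] {F : ℕ → Finset G} (hF : IsFolner F) (R : Set G) :
    liminf (fun n => fdens (F n) Rᶜ) atTop = 1 - limsup (fun n => fdens (F n) R) atTop := by
  have : (fun n => fdens (F n) Rᶜ) = fun n => 1 - fdens (F n) R := by
    ext n; exact fdens_compl _ (hF.1 n) R
  rw [this]
  exact liminf_const_sub atTop (fun n => fdens (F n) R) 1 (bdd_le F R) (bdd_ge F R).isCoboundedUnder_le

lemma upper_compl_le [CommGroup G] [Countable G] (R : Set G) :
    upperBanachDensity Rᶜ ≤ 1 - lowerBanachDensity R := by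
  apply upper_le
  intro F hF
  have h1 := lower_le_liminf hF R
  have h2 := liminf_compl hF Rᶜ
  rw [compl_compl] at h2
  linarith

lemma upper_mono [CommGroup G] [Countable G] {R S : Set G} (h : R ⊆ S) :
    upperBanachDensity R ≤ upperBanachDensity S := by
  apply upper_le
  intro F hF
  refine le_trans ?_ (limsup_le_upper hF S)
  refine limsup_le_limsup (Eventually.of_forall fun n => ?_) (bdd_ge F R).isCoboundedUnder_le
    (bdd_le F S)
  unfold fdens
  have := Set.ncard_le_ncard (Set.inter_subset_inter_right (F n : Set G) h)
    ((F n).finite_toSet.inter_of_left _)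
  exact div_le_div_of_nonneg_right (by exact_mod_cast this) (by positivity)

end Folner

section Measures

set_option linter.unusedSectionVars false

variable {X : Type*} [TopologicalSpace X] [MeasurableSpace X] [BorelSpace X] [CompactSpace X]
  [TopologicalSpace.MetrizableSpace X] [SecondCountableTopology X] [TotallyDisconnectedSpace X]

lemma clopen_ext {μ ν : Measure X} [IsProbabilityMeasure μ] [IsProbabilityMeasure ν]
    (h : ∀ C, IsClopen C → μ.real C = ν.real C) : μ = ν := by
  refine ext_of_generate_finite {s : Set X | IsClopen s} ?_ ?_ ?_ (by simp)
  · rw [‹BorelSpace X›.measurable_eq]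
    exact isTopologicalBasis_isClopen.borel_eq_generateFrom
  · intro s hs t ht _
    exact hs.inter ht
  · intro s hs
    have := h s hs
    exact (ENNReal.toReal_eq_toReal_iff' (measure_ne_top _ _) (measure_ne_top _ _)).1 this

lemma clopen_continuous {C : Set X} (hC : IsClopen C) :
    Continuous (fun μ : ProbabilityMeasure X => (μ : Measure X).real C) := by
  rw [continuous_iff_continuousAt]
  intro μ
  have := ProbabilityMeasure.tendsto_measure_of_isClopen_of_tendsto
    (tendsto_id (x := nhds μ)) hC
  exact (NNReal.tendsto_coe.2 this)

lemma open_lsc {U : Set X} (hU : IsOpen U) :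
    LowerSemicontinuous (fun μ : ProbabilityMeasure X => (μ : Measure X) U) := by
  rw [lowerSemicontinuous_iff_isClosed_preimage]
  intro c
  apply IsSeqClosed.isClosed
  intro μs μ hμs hlim
  have h1 := ProbabilityMeasure.le_liminf_measure_open_of_tendsto hlim hU
  refine h1.trans ?_
  refine (liminf_le_limsup).trans ?_
  exact limsup_le_of_le (by isBoundedDefault) (Eventually.of_forall hμs)

variable [CommGroup G] [MulAction G X]

variable (G) in
/-- Invariant probability measures carried by the orbit closure of `x0`, tested on clopen sets. -/
def invMeas (x0 : X) : Set (ProbabilityMeasure X) :=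
  {μ | ∀ C : Set X, IsClopen C → (∀ g : G, (μ : Measure X).real (g • C) = (μ : Measure X).real C) ∧
    ((∀ g : G, g • x0 ∉ C) → (μ : Measure X).real C = 0)}

lemma isClopen_smul (hc : ∀ g : G, Continuous fun x : X => g • x) (g : G) {C : Set X}
    (hC : IsClopen C) : IsClopen (g • C) := by
  rw [← Set.preimage_smul_inv]
  exact hC.preimage (hc g⁻¹)

lemma isClosed_invMeas (hc : ∀ g : G, Continuous fun x : X => g • x) (x0 : X) :
    IsClosed (invMeas G x0) := by
  have : invMeas G x0 = ⋂ (C : Set X) (_ : IsClopen C),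
      ((⋂ g : G, {μ : ProbabilityMeasure X | (μ : Measure X).real (g • C) = (μ : Measure X).real C}) ∩
      (⋂ (_ : ∀ g : G, g • x0 ∉ C), {μ : ProbabilityMeasure X | (μ : Measure X).real C = 0})) := by
    ext μ; simp [invMeas]
  rw [this]
  refine isClosed_iInter fun C => isClosed_iInter fun hC => IsClosed.inter ?_ ?_
  · exact isClosed_iInter fun g =>
      isClosed_eq (clopen_continuous (isClopen_smul hc g hC)) (clopen_continuous hC)
  · exact isClosed_iInter fun _ => isClosed_eq (clopen_continuous hC) continuous_const

lemma invMeas_inv (hc : ∀ g : G, Continuous fun x : X => g • x) {x0 : X}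
    {μ : ProbabilityMeasure X} (hμ : μ ∈ invMeas G x0) (g : G) (S : Set X) (hS : MeasurableSet S) :
    (μ : Measure X) (g • S) = (μ : Measure X) S := by
  have hm : Measurable fun x : X => g⁻¹ • x := (hc g⁻¹).measurable
  have : IsProbabilityMeasure ((μ : Measure X).map fun x : X => g⁻¹ • x) :=
    Measure.isProbabilityMeasure_map hm.aemeasurable
  have h : (μ : Measure X).map (fun x : X => g⁻¹ • x) = μ := by
    apply clopen_ext
    intro C hC
    rw [measureReal_def, Measure.map_apply hm hC.isOpen.measurableSet, Set.preimage_smul_inv]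
    exact (hμ C hC).1 g
  conv_rhs => rw [← h]
  rw [Measure.map_apply hm hS, Set.preimage_smul_inv]

/-- Measures in `invMeas` give a clopen set at most the upper Banach density of its visit set. -/
lemma invMeas_le_upper [Countable G] (hc : ∀ g : G, Continuous fun x : X => g • x) {x0 : X}
    {μ : ProbabilityMeasure X} (hμ : μ ∈ invMeas G x0) {C : Set X} (hC : IsClopen C) :
    (μ : Measure X).real C ≤ upperBanachDensity {g : G | g • x0 ∈ C} := by
  classical
  obtain ⟨F, hF⟩ := exists_folner (G := G)
  have key : ∀ K : Finset G, K.Nonempty → ∃ c : G,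
      (μ : Measure X).real C ≤ fdens (c • K) {g : G | g • x0 ∈ C} := by
    intro K hK
    let φ : X → ℕ := fun x => (K.filter fun f => f • x ∈ C).card
    have hφs : φ = fun x => ∑ f ∈ K, Set.indicator ((fun x : X => f • x) ⁻¹' C) (fun _ => 1) x := by
      ext x
      simp only [φ, Finset.card_filter, Set.indicator_apply, Set.mem_preimage]
    have hφ : Continuous φ := by
      rw [hφs]
      refine continuous_finsetSum _ fun f _ => ?_
      exact continuous_const.indicator (fun a ha => by
        rw [(hC.preimage (hc f)).frontier_eq] at ha; exact ha.elim)
    have hint : ∫ x, (φ x : ℝ) ∂(μ : Measure X) = K.card * (μ : Measure X).real C := by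
      have : (fun x => (φ x : ℝ)) =
          fun x => ∑ f ∈ K, Set.indicator ((fun x : X => f • x) ⁻¹' C) (fun _ => (1 : ℝ)) x := by
        ext x
        simp only [φ, Finset.card_filter, Set.indicator_apply, Set.mem_preimage]
        push_cast; rfl
      rw [this, integral_finsetSum]
      · have : ∀ f ∈ K, ∫ x, Set.indicator ((fun x : X => f • x) ⁻¹' C) (fun _ => (1 : ℝ)) x
            ∂(μ : Measure X) = (μ : Measure X).real C := by
          intro f _
          rw [integral_indicator_const _ (hC.preimage (hc f)).isOpen.measurableSet, smul_eq_mul, mul_one,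
            Set.preimage_smul]
          exact (hμ C hC).1 f⁻¹
        rw [Finset.sum_congr rfl this]; simp
      · intro f _
        exact (integrable_const (1 : ℝ)).indicator (hC.preimage (hc f)).isOpen.measurableSet
    have hcont : Continuous fun x => (φ x : ℝ) := continuous_of_discreteTopology.comp hφ
    have hi : Integrable (fun x => (φ x : ℝ)) (μ : Measure X) :=
      hcont.integrable_of_hasCompactSupport (HasCompactSupport.of_compactSpace _)
    have hpos := measure_integral_le_pos hi
    rw [hint] at hpos
    set D : Set X := {x | K.card * (μ : Measure X).real C ≤ (φ x : ℝ)} with hD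
    have hDc : IsClopen D :=
      (isClopen_discrete {n : ℕ | K.card * (μ : Measure X).real C ≤ (n : ℝ)}).preimage hφ
    have hex : ∃ c : G, c • x0 ∈ D := by
      by_contra! hcon
      have h0 := (hμ D hDc).2 hcon
      rw [measureReal_eq_zero_iff] at h0
      exact hpos.ne' h0
    obtain ⟨c, hcD⟩ := hex
    refine ⟨c, ?_⟩
    rw [fdens_translate]
    unfold fdens
    have hc0 : (0 : ℝ) < K.card := by exact_mod_cast hK.card_pos
    rw [le_div_iff₀ hc0, mul_comm]
    refine le_of_le_of_eq hcD ?_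
    congr 1
    simp only [φ]
    rw [← Set.ncard_coe_finset]
    congr 1
    ext f
    simp [Set.mem_smul_set_iff_inv_smul_mem, smul_smul, mul_comm]
  choose c hcc using fun n => key (F n) (hF.1 n)
  have hF' := folner_translate hF c
  refine le_trans ?_ (limsup_le_upper hF' _)
  exact le_limsup_of_frequently_le (Frequently.of_forall hcc) (bdd_le _ _)

/-- Empirical measure of `F` along the orbit of `x0`. -/
noncomputable def empMeas (F : Finset G) (x0 : X) : Measure X :=
  (F.card : ENNReal)⁻¹ • ∑ g ∈ F, Measure.dirac (g • x0)

lemma empMeas_apply (F : Finset G) (x0 : X) {S : Set X} (hS : MeasurableSet S) :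
    empMeas F x0 S = (F.card : ENNReal)⁻¹ * ((F : Set G) ∩ {g : G | g • x0 ∈ S}).ncard := by
  classical
  unfold empMeas
  rw [Measure.smul_apply, Measure.finsetSum_apply, smul_eq_mul]
  congr 1
  have : ((F : Set G) ∩ {g : G | g • x0 ∈ S}) = ((F.filter fun g => g • x0 ∈ S : Finset G) : Set G) := by
    ext; simp
  rw [this, Set.ncard_coe_finset, Finset.card_filter]
  push_cast
  refine Finset.sum_congr rfl fun g _ => ?_
  rw [Measure.dirac_apply' _ hS, Set.indicator_apply]
  rfl

lemma empMeas_prob (F : Finset G) (hF : F.Nonempty) (x0 : X) :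
    IsProbabilityMeasure (empMeas F x0) := by
  constructor
  rw [empMeas_apply F x0 MeasurableSet.univ]
  simp only [Set.mem_univ, Set.ofPred_true, Set.inter_univ, Set.ncard_coe_finset]
  apply ENNReal.inv_mul_cancel
  · simpa using hF.ne_empty
  · simp

lemma empMeas_real (F : Finset G) (x0 : X) {S : Set X} (hS : MeasurableSet S) :
    (empMeas F x0).real S = fdens F {g : G | g • x0 ∈ S} := by
  rw [measureReal_def, empMeas_apply F x0 hS, fdens]
  simp [div_eq_inv_mul]

lemma fdens_shift (F : Finset G) (hF : F.Nonempty) (g : G) (R : Set G) :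
    fdens F R ≤ fdens F (g • R) + (1 - fdens F (g⁻¹ • (F : Set G))) := by
  classical
  rw [← fdens_compl F hF]
  have h1 : fdens F (g • R) = fdens (g⁻¹ • F) R := by
    rw [fdens_translate, inv_inv]
  rw [h1]
  unfold fdens
  rw [Finset.card_smul_finset, ← add_div]
  refine div_le_div_of_nonneg_right ?_ (by positivity)
  have hsub : (F : Set G) ∩ R ⊆
      (((g⁻¹ • F : Finset G) : Set G) ∩ R) ∪ ((F : Set G) ∩ (g⁻¹ • (F : Set G))ᶜ) := by
    rintro x ⟨hx, hxR⟩
    by_cases h : x ∈ g⁻¹ • (F : Set G)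
    · left; exact ⟨by rwa [Finset.coe_smul_finset], hxR⟩
    · right; exact ⟨hx, h⟩
  have h2 := Set.ncard_le_ncard hsub
    (((g⁻¹ • F).finite_toSet.inter_of_left _).union (F.finite_toSet.inter_of_left _))
  have h3 := h2.trans (Set.ncard_union_le _ _)
  exact_mod_cast h3

/-- Limits of empirical measures along Folner sequences. -/
lemma exists_limit_meas (hc : ∀ g : G, Continuous fun x : X => g • x) (x0 : X)
    {F : ℕ → Finset G} (hF : IsFolner F) {U : Set X} (hU : IsOpen U) {r : ℝ}
    (hr : liminf (fun n => fdens (F n) {g : G | g • x0 ∈ U}) atTop < r) :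
    ∃ μ ∈ invMeas G x0, (μ : Measure X).real U ≤ r := by
  have hfr := frequently_lt_of_liminf_lt (bdd_le F _).isCoboundedUnder_ge hr
  obtain ⟨ψ, hψ, hψ'⟩ := extraction_of_frequently_atTop hfr
  let m : ℕ → ProbabilityMeasure X := fun n => ⟨empMeas (F (ψ n)) x0, empMeas_prob _ (hF.1 _) x0⟩
  have hm : ∀ n, ∀ S : Set X, MeasurableSet S →
      (m n : Measure X).real S = fdens (F (ψ n)) {g : G | g • x0 ∈ S} :=
    fun n S hS => empMeas_real _ _ hS
  obtain ⟨μ, -, θ, hθ, hlim⟩ := isCompact_univ.isSeqCompact (x := m) (fun n => Set.mem_univ _)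
  have hlimC : ∀ C : Set X, IsClopen C →
      Tendsto (fun n => fdens (F (ψ (θ n))) {g : G | g • x0 ∈ C}) atTop
        (nhds ((μ : Measure X).real C)) := by
    intro C hC
    have := ((clopen_continuous hC).tendsto μ).comp hlim
    refine this.congr fun n => ?_
    exact hm _ C hC.isOpen.measurableSet
  have hF' : IsFolner (fun n => F (ψ (θ n))) := folner_subseq hF (hψ.comp hθ)
  have hle : ∀ (C : Set X) (g : G), IsClopen C →
      (μ : Measure X).real C ≤ (μ : Measure X).real (g • C) := by
    intro C g hC
    have h2 := ((hlimC _ (isClopen_smul hc g hC)).add ((hF'.2 g⁻¹).const_sub 1))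
    rw [sub_self, add_zero] at h2
    refine le_of_tendsto_of_tendsto' (hlimC C hC) h2 fun n => ?_
    have h3 := fdens_shift _ (hF'.1 n) g {h : G | h • x0 ∈ C}
    have h4 : {h : G | h • x0 ∈ g • C} = g • {h : G | h • x0 ∈ C} := by
      ext h
      simp [Set.mem_smul_set_iff_inv_smul_mem, smul_smul]
    rw [h4]
    exact h3
  refine ⟨μ, ?_, ?_⟩
  · intro C hC
    refine ⟨fun g => le_antisymm ?_ (hle C g hC), fun h => ?_⟩
    · simpa using hle (g • C) g⁻¹ (isClopen_smul hc g hC)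
    · refine tendsto_nhds_unique (hlimC C hC) ?_
      have : {g : G | g • x0 ∈ C} = ∅ := by ext g; simpa using h g
      simp [this, fdens]
  · have hcl := (lowerSemicontinuous_iff_isClosed_preimage.1 (open_lsc hU)) (ENNReal.ofReal r)
    have hmem : ∀ n, m (θ n) ∈ (fun μ : ProbabilityMeasure X => (μ : Measure X) U) ⁻¹'
        Set.Iic (ENNReal.ofReal r) := by
      intro n
      have h1 := hm (θ n) U hU.measurableSet
      have h2 := (hψ' (θ n)).le
      rw [← h1] at h2
      simp only [Set.mem_preimage, Set.mem_Iic]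
      rw [← ofReal_measureReal]
      exact ENNReal.ofReal_le_ofReal h2
    have h5 := hcl.mem_of_tendsto hlim (Eventually.of_forall hmem)
    have hr0 : 0 ≤ r := le_trans (fdens_nonneg _ _) (hψ' 0).le
    exact ENNReal.toReal_le_of_le_ofReal hr0 h5


lemma cond_real {ν : Measure X} {S : Set X} (hS : MeasurableSet S) (T : Set X) :
    (ProbabilityTheory.cond ν S).real T = (ν.real S)⁻¹ * ν.real (S ∩ T) := by
  rw [measureReal_def, ProbabilityTheory.cond_apply hS, ENNReal.toReal_mul, ENNReal.toReal_inv]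
  rfl

lemma cond_mem (hc : ∀ g : G, Continuous fun x : X => g • x) {x0 : X}
    {ν : ProbabilityMeasure X} (hν : ν ∈ invMeas G x0) {S : Set X} (hS : MeasurableSet S)
    (hinv : ∀ g : G, g • S = S) (h0 : (ν : Measure X) S ≠ 0) :
    (⟨ProbabilityTheory.cond (ν : Measure X) S, ProbabilityTheory.cond_isProbabilityMeasure h0⟩ :
      ProbabilityMeasure X) ∈ invMeas G x0 := by
  intro C hC
  constructor
  · intro g
    simp only [ProbabilityMeasure.coe_mk]
    rw [cond_real hS, cond_real hS]
    congr 1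
    have : S ∩ g • C = g • (S ∩ C) := by rw [Set.smul_set_inter, hinv]
    rw [this, measureReal_def, measureReal_def,
      invMeas_inv hc hν g _ (hS.inter hC.isOpen.measurableSet)]
  · intro h
    simp only [ProbabilityMeasure.coe_mk]
    rw [cond_real hS]
    have h1 := (hν C hC).2 h
    have h2 : (ν : Measure X).real (S ∩ C) ≤ (ν : Measure X).real C :=
      measureReal_mono Set.inter_subset_right
    have h3 : (ν : Measure X).real (S ∩ C) = 0 := le_antisymm (h2.trans h1.le) measureReal_nonneg
    rw [h3, mul_zero]

/-- Among the measures in `invMeas`, the measure of an open set is minimised by an ergodic one. -/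
lemma exists_ergodic_min (hc : ∀ g : G, Continuous fun x : X => g • x) (x0 : X)
    (hne : (invMeas G x0).Nonempty) {U : Set X} (hU : IsOpen U) :
    ∃ ν ∈ invMeas G x0, (∀ μ ∈ invMeas G x0, (ν : Measure X).real U ≤ (μ : Measure X).real U) ∧
      ∀ S : Set X, MeasurableSet S → (∀ g : G, g • S = S) →
        (ν : Measure X) S = 0 ∨ (ν : Measure X) S = 1 := by
  have hcomp : IsCompact (invMeas G x0) := (isClosed_invMeas hc x0).isCompact
  obtain ⟨μ0, hμ0, hmin⟩ := ((open_lsc hU).lowerSemicontinuousOn _).exists_isMinOn hne hcomp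
  rw [isMinOn_iff] at hmin
  have hmin' : ∀ μ ∈ invMeas G x0, (μ0 : Measure X).real U ≤ (μ : Measure X).real U :=
    fun μ hμ => ENNReal.toReal_mono (measure_ne_top _ _) (hmin μ hμ)
  let N : Set (ProbabilityMeasure X) := invMeas G x0 ∩
    (fun μ : ProbabilityMeasure X => (μ : Measure X) U) ⁻¹' Set.Iic ((μ0 : Measure X) U)
  have hN : IsCompact N :=
    hcomp.inter_right (lowerSemicontinuous_iff_isClosed_preimage.1 (open_lsc hU) _)
  let Φ : ProbabilityMeasure X → ({C : Set X // IsClopen C} → ℝ) :=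
    fun μ C => (μ : Measure X).real C.1
  have hΦ : Continuous Φ := continuous_pi fun C => clopen_continuous C.2
  obtain ⟨y, hy⟩ := (hN.image hΦ).extremePoints_nonempty ⟨_, μ0, ⟨hμ0, Set.mem_preimage.2 (Set.mem_Iic.2 le_rfl)⟩, rfl⟩
  obtain ⟨⟨ν, hνN, rfl⟩, hext⟩ := mem_extremePoints.1 hy
  have hνU : (ν : Measure X).real U ≤ (μ0 : Measure X).real U :=
    ENNReal.toReal_mono (measure_ne_top _ _) hνN.2
  refine ⟨ν, hνN.1, fun μ hμ => hνU.trans (hmin' μ hμ), fun S hS hinv => ?_⟩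
  by_contra! hcon
  obtain ⟨h0, h1⟩ := hcon
  have h0' : (ν : Measure X) Sᶜ ≠ 0 := by
    intro h
    exact h1 ((prob_compl_eq_zero_iff hS).1 h)
  have hinv' : ∀ g : G, g • Sᶜ = Sᶜ := fun g => by rw [Set.smul_set_compl, hinv]
  let ν1 : ProbabilityMeasure X :=
    ⟨ProbabilityTheory.cond (ν : Measure X) S, ProbabilityTheory.cond_isProbabilityMeasure h0⟩
  let ν2 : ProbabilityMeasure X :=
    ⟨ProbabilityTheory.cond (ν : Measure X) Sᶜ, ProbabilityTheory.cond_isProbabilityMeasure h0'⟩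
  have hν1 : ν1 ∈ invMeas G x0 := cond_mem hc hνN.1 hS hinv h0
  have hν2 : ν2 ∈ invMeas G x0 := cond_mem hc hνN.1 hS.compl hinv' h0'
  set a := (ν : Measure X).real S with ha
  set b := (ν : Measure X).real Sᶜ with hb
  have hab : a + b = 1 := probReal_add_probReal_compl hS
  have hapos : 0 < a := ENNReal.toReal_pos h0 (measure_ne_top _ _)
  have hbpos : 0 < b := ENNReal.toReal_pos h0' (measure_ne_top _ _)
  have hsplit : ∀ T : Set X, a * (ν1 : Measure X).real T + b * (ν2 : Measure X).real T =
      (ν : Measure X).real T := by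
    intro T
    simp only [ν1, ν2, ProbabilityMeasure.coe_mk]
    rw [cond_real hS, cond_real hS.compl, ← ha, ← hb, mul_inv_cancel_left₀ hapos.ne',
      mul_inv_cancel_left₀ hbpos.ne', Set.inter_comm, Set.inter_comm Sᶜ, ← Set.sdiff_eq]
    exact measureReal_inter_add_sdiff hS
  have hm1 := hmin' ν1 hν1
  have hm2 := hmin' ν2 hν2
  have hsU := hsplit U
  have hm0 : a * (μ0 : Measure X).real U + b * (μ0 : Measure X).real U = (μ0 : Measure X).real U := by
    rw [← add_mul, hab, one_mul]
  have hU1 : (ν1 : Measure X).real U ≤ (μ0 : Measure X).real U := by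
    by_contra! hlt
    linarith [mul_lt_mul_of_pos_left hlt hapos, mul_le_mul_of_nonneg_left hm2 hbpos.le]
  have hU2 : (ν2 : Measure X).real U ≤ (μ0 : Measure X).real U := by
    by_contra! hlt
    linarith [mul_lt_mul_of_pos_left hlt hbpos, mul_le_mul_of_nonneg_left hm1 hapos.le]
  have hN1 : ν1 ∈ N := ⟨hν1, (ENNReal.toReal_le_toReal (measure_ne_top _ _) (measure_ne_top _ _)).1 hU1⟩
  have hN2 : ν2 ∈ N := ⟨hν2, (ENNReal.toReal_le_toReal (measure_ne_top _ _) (measure_ne_top _ _)).1 hU2⟩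
  have hseg : Φ ν ∈ openSegment ℝ (Φ ν1) (Φ ν2) :=
    ⟨a, b, hapos, hbpos, hab, by ext C; exact hsplit C.1⟩
  have heq := hext _ (Set.mem_image_of_mem _ hN1) _ (Set.mem_image_of_mem _ hN2) hseg
  have heq1 : Φ ν1 = Φ ν := by first | exact heq | exact heq.1
  have hmeas : (ν1 : Measure X) = ν := clopen_ext fun C hC => congrFun heq1 ⟨C, hC⟩
  apply h1
  rw [← hmeas]
  simp only [ν1, ProbabilityMeasure.coe_mk]
  rw [ProbabilityTheory.cond_apply hS, Set.inter_self]
  exact ENNReal.inv_mul_cancel h0 (measure_ne_top _ _)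

lemma exists_ergodic_folner [Countable G] (hc : ∀ g : G, Continuous fun x : X => g • x) (x0 : X)
    {U : Set X} (hU : IsOpen U) :
    ∃ ν ∈ invMeas G x0, (∀ F : ℕ → Finset G, IsFolner F →
        (ν : Measure X).real U ≤ liminf (fun n => fdens (F n) {g : G | g • x0 ∈ U}) atTop) ∧
      ∀ S : Set X, MeasurableSet S → (∀ g : G, g • S = S) →
        (ν : Measure X) S = 0 ∨ (ν : Measure X) S = 1 := by
  obtain ⟨F0, hF0⟩ := exists_folner (G := G)
  obtain ⟨μ0, hμ0, -⟩ := exists_limit_meas hc x0 hF0 hU (lt_add_one _)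
  obtain ⟨ν, hν, hmin, herg⟩ := exists_ergodic_min hc x0 ⟨μ0, hμ0⟩ hU
  refine ⟨ν, hν, fun F hF => ?_, herg⟩
  refine le_of_forall_gt_imp_ge_of_dense fun r hr => ?_
  obtain ⟨μ, hμ, hle⟩ := exists_limit_meas hc x0 hF hU hr
  exact (hmin μ hμ).trans hle

/-- The correspondence principle relative to a given point of a zero-dimensional system. -/
lemma correspondence_core [Countable G] (hc : ∀ g : G, Continuous fun x : X => g • x) (x0 : X)
    (A B : Set G) {Bt : Set X} (hBt : IsClopen Bt) (hB : ∀ g : G, g • x0 ∈ Bt ↔ g ∈ B) :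
      ∃ μ ν : MeasureTheory.Measure X,
        MeasureTheory.IsProbabilityMeasure μ ∧ MeasureTheory.IsProbabilityMeasure ν ∧
        (∀ (g : G) (S : Set X), MeasurableSet S → μ (g • S) = μ S) ∧
        (∀ (g : G) (S : Set X), MeasurableSet S → ν (g • S) = ν S) ∧
        (∀ S : Set X, MeasurableSet S → (∀ g : G, g • S = S) → μ S = 0 ∨ μ S = 1) ∧
        (∀ S : Set X, MeasurableSet S → (∀ g : G, g • S = S) → ν S = 0 ∨ ν S = 1) ∧
        ∃ Bt : Set X, IsClopen Bt ∧
          upperBanachDensity B = (μ Bt).toReal ∧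
          upperBanachDensity (A * B) ≥ (μ (A • Bt)).toReal ∧
          lowerBanachDensity B ≤ (ν Bt).toReal ∧
          lowerBanachDensity (A * B) ≥ (ν (A • Bt)).toReal := by
  have hRB : {g : G | g • x0 ∈ Bt} = B := by ext g; exact hB g
  have hRBc : {g : G | g • x0 ∈ Btᶜ} = Bᶜ := by ext g; simp [hB g]
  have hRA : ∀ A' : Set G, {g : G | g • x0 ∈ A' • Bt} = A' * B := by
    intro A'
    ext g
    simp only [Set.mem_ofPred_eq, Set.mem_smul, Set.mem_mul]
    constructor
    · rintro ⟨a, ha, x, hx, hax⟩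
      refine ⟨a, ha, a⁻¹ * g, ?_, by simp⟩
      rw [← hB, mul_smul, ← hax, inv_smul_smul]
      exact hx
    · rintro ⟨a, ha, b, hb, rfl⟩
      exact ⟨a, ha, b • x0, (hB b).2 hb, by rw [smul_smul]⟩
  have hopen : IsOpen (A • Bt) := by
    rw [← Set.iUnion_smul_set]
    exact isOpen_biUnion fun a _ => (isClopen_smul hc a hBt).isOpen
  obtain ⟨μ, hμ, hμF, hμe⟩ := exists_ergodic_folner hc x0 (hBt.compl.isOpen)
  obtain ⟨ν, hν, hνF, hνe⟩ := exists_ergodic_folner hc x0 hopen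
  refine ⟨μ, ν, inferInstance, inferInstance, invMeas_inv hc hμ, invMeas_inv hc hν, hμe, hνe,
    Bt, hBt, ?_, ?_, ?_, ?_⟩
  · apply le_antisymm
    · apply upper_le
      intro F hF
      have h1 := hμF F hF
      rw [hRBc, liminf_compl hF, probReal_compl_eq_one_sub hBt.isOpen.measurableSet] at h1
      change _ ≤ (μ : Measure X).real Bt
      linarith
    · have := invMeas_le_upper hc hμ hBt
      rwa [hRB] at this
  · have hfin : ∀ A' : Finset G, (A' : Set G) ⊆ A →
        (μ : Measure X).real ((A' : Set G) • Bt) ≤ upperBanachDensity (A * B) := by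
      intro A' hA'
      have hcl : IsClopen ((A' : Set G) • Bt) := by
        rw [← Set.iUnion_smul_set]
        exact A'.finite_toSet.isClopen_biUnion fun a _ => isClopen_smul hc a hBt
      have := invMeas_le_upper hc hμ hcl
      rw [hRA] at this
      exact this.trans (upper_mono (Set.mul_subset_mul_right hA'))
    have hpos : 0 ≤ upperBanachDensity (A * B) := by
      have := hfin ∅ (by simp)
      exact le_trans measureReal_nonneg this
    refine ENNReal.toReal_le_of_le_ofReal hpos ?_
    have hun : A • Bt = ⋃ A' : {A' : Finset G // (A' : Set G) ⊆ A}, ((A'.1 : Set G) • Bt) := by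
      ext x
      simp only [Set.mem_smul, Set.mem_iUnion]
      constructor
      · rintro ⟨a, ha, y, hy, rfl⟩
        exact ⟨⟨{a}, by simpa using ha⟩, a, by simp, y, hy, rfl⟩
      · rintro ⟨A', a, ha, y, hy, rfl⟩
        exact ⟨a, A'.2 ha, y, hy, rfl⟩
    have hdir : Directed (· ⊆ ·)
        fun A' : {A' : Finset G // (A' : Set G) ⊆ A} => ((A'.1 : Set G) • Bt) := by
      classical
      intro A1 A2
      refine ⟨⟨A1.1 ∪ A2.1, by simpa using ⟨A1.2, A2.2⟩⟩, ?_, ?_⟩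
      · exact Set.smul_subset_smul_right (by simp)
      · exact Set.smul_subset_smul_right (by simp)
    rw [hun, hdir.measure_iUnion]
    refine iSup_le fun A' => ?_
    rw [← ofReal_measureReal]
    exact ENNReal.ofReal_le_ofReal (hfin A'.1 A'.2)
  · have := invMeas_le_upper hc hν hBt.compl
    rw [hRBc, probReal_compl_eq_one_sub hBt.isOpen.measurableSet] at this
    have h2 := upper_compl_le B
    change _ ≤ (ν : Measure X).real Bt
    linarith
  · apply le_lower
    intro F hF
    have := hνF F hF
    rwa [hRA] at this

end Measures

/-- Furstenberg correspondence principle for product sets: given a countable abelian group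
`G` and `A, B ⊆ G`, there is a compact metrizable space `X` on which `G` acts by
homeomorphisms (a continuous action of a group is by homeomorphisms), `G`-invariant ergodic
Borel probability measures `μ, ν` on `X` and a clopen set `B̃ ⊆ X` with `d*(B) = μ(B̃)`,
`d*(AB) ≥ μ(A B̃)`, `d_*(B) ≤ ν(B̃)` and `d_*(AB) ≥ ν(A B̃)`,
where `A B̃ = ⋃_{a ∈ A} a • B̃`. -/
theorem furstenberg_correspondence_product_sets [CommGroup G] [Countable G] (A B : Set G) :
    ∃ (X : Type) (_ : TopologicalSpace X) (_ : MeasurableSpace X), BorelSpace X ∧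
      CompactSpace X ∧ TopologicalSpace.MetrizableSpace X ∧
      ∃ _ : MulAction G X, (∀ g : G, Continuous fun x : X => g • x) ∧
      ∃ μ ν : MeasureTheory.Measure X,
        MeasureTheory.IsProbabilityMeasure μ ∧ MeasureTheory.IsProbabilityMeasure ν ∧
        (∀ (g : G) (S : Set X), MeasurableSet S → μ (g • S) = μ S) ∧
        (∀ (g : G) (S : Set X), MeasurableSet S → ν (g • S) = ν S) ∧
        (∀ S : Set X, MeasurableSet S → (∀ g : G, g • S = S) → μ S = 0 ∨ μ S = 1) ∧
        (∀ S : Set X, MeasurableSet S → (∀ g : G, g • S = S) → ν S = 0 ∨ ν S = 1) ∧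
        ∃ Bt : Set X, IsClopen Bt ∧
          upperBanachDensity B = (μ Bt).toReal ∧
          upperBanachDensity (A * B) ≥ (μ (A • Bt)).toReal ∧
          lowerBanachDensity B ≤ (ν Bt).toReal ∧
          lowerBanachDensity (A * B) ≥ (ν (A • Bt)).toReal := by
  classical
  let e : G ≃ Shrink.{0} G := equivShrink.{0} G
  let act : MulAction G (Shrink.{0} G → Bool) :=
    { smul := fun g x h => x (e (e.symm h * g))
      one_smul := fun x => by
        funext h
        change x (e (e.symm h * 1)) = x h
        rw [mul_one, e.apply_symm_apply]
      mul_smul := fun g k x => by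
        funext h
        change x (e (e.symm h * (g * k))) = x (e (e.symm (e (e.symm h * g)) * k))
        rw [e.symm_apply_apply, mul_assoc] }
  have hact : ∀ (g : G) (x : Shrink.{0} G → Bool) h,
      (g • x) h = x (e (e.symm h * g)) := fun _ _ _ => rfl
  have hc : ∀ g : G, Continuous fun x : Shrink.{0} G → Bool => g • x := by
    intro g
    exact continuous_pi fun h => continuous_apply (e (e.symm h * g))
  have hcountable : Countable (Shrink.{0} G) := e.symm.injective.countable
  refine ⟨Shrink.{0} G → Bool, inferInstance, inferInstance, inferInstance, inferInstance,
    inferInstance, act, hc, ?_⟩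
  refine correspondence_core hc (fun h => decide (e.symm h ∈ B)) A B
    (Bt := (fun x : Shrink.{0} G → Bool => x (e 1)) ⁻¹' {true}) ?_ ?_
  · exact (isClopen_discrete _).preimage (continuous_apply _)
  · intro g
    simp [hact]
end

section
/- Let Γ = (V, 𝓑, μ, A, E) be an h-layered commutative measure graph with layers V_0 ⊔ ⋯ ⊔ V_h. Then for every j ∈ {1, …, h} one has D_j^h ≥ D_h^j. -/
open MeasureTheory ENNReal

variable {V A : Type*}

/-- `Im_a^+(W)`: the set of heads of `a`-labelled edges whose tail lies in `W`. -/
def ImaPos (E : Set (V × V × A)) (a : A) (W : Set V) : Set V :=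
  {v | ∃ w ∈ W, (w, v, a) ∈ E}

/-- `Im_a^-(W)`: the set of tails of `a`-labelled edges whose head lies in `W`. -/
def ImaNeg (E : Set (V × V × A)) (a : A) (W : Set V) : Set V :=
  {v | ∃ w ∈ W, (v, w, a) ∈ E}

/-- `Im^+(W) = ⋃_{a ∈ A} Im_a^+(W)`. -/
def ImPos (E : Set (V × V × A)) (W : Set V) : Set V := ⋃ a : A, ImaPos E a W

/-- The `n`-fold image `Im^n(W)`. -/
def ImIter (E : Set (V × V × A)) (n : ℕ) (W : Set V) : Set V := (ImPos E)^[n] W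

/-- `L_a^+`: vertices with an outgoing `a`-labelled edge. -/
def LaPos (E : Set (V × V × A)) (a : A) : Set V := {x | ∃ y, (x, y, a) ∈ E}

/-- `L_a^-`: vertices with an incoming `a`-labelled edge. -/
def LaNeg (E : Set (V × V × A)) (a : A) : Set V := {x | ∃ y, (y, x, a) ∈ E}

/-- A measure graph structure: `(V, 𝓑, μ)` is a finite measure space, `A` is a finite
label set, and `E ⊆ V × V × A` is an edge set such that the sets `L_a^±` are measurable,
the maps `Im_a^±` preserve measurability and measure, and each vertex has at most one
outgoing and at most one incoming `a`-labelled edge for each label `a`. -/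
structure IsMeasureGraph [MeasurableSpace V] (μ : Measure V) [Fintype A]
    (E : Set (V × V × A)) : Prop where
  finiteMeasure : μ Set.univ ≠ ⊤
  measLaPos : ∀ a : A, MeasurableSet (LaPos E a)
  measLaNeg : ∀ a : A, MeasurableSet (LaNeg E a)
  measImaPos : ∀ (a : A) (W : Set V), MeasurableSet W → W ⊆ LaPos E a →
    MeasurableSet (ImaPos E a W) ∧ μ (ImaPos E a W) = μ W
  measImaNeg : ∀ (a : A) (W : Set V), MeasurableSet W → W ⊆ LaNeg E a →
    MeasurableSet (ImaNeg E a W) ∧ μ (ImaNeg E a W) = μ W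
  uniqueOut : ∀ (a : A) (x y y' : V), (x, y, a) ∈ E → (x, y', a) ∈ E → y = y'
  uniqueIn : ∀ (a : A) (x x' y : V), (x, y, a) ∈ E → (x', y, a) ∈ E → x = x'

/-- `E^+(v)`: the set of edges with tail `v`. -/
def EdgesFrom (E : Set (V × V × A)) (v : V) : Set (V × V × A) := {e ∈ E | e.1 = v}

/-- A labelled directed graph is semi-commutative if for every edge `(x, y, a)` there is
an injection `φ : E^+(y) → E^+(x)` such that `(head (φ e), head e, a)` is an edge for
every `e ∈ E^+(y)`. -/
def IsSemiCommutative (E : Set (V × V × A)) : Prop :=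
  ∀ x y a, (x, y, a) ∈ E →
    ∃ φ : EdgesFrom E y → EdgesFrom E x, Function.Injective φ ∧
      ∀ e : EdgesFrom E y, ((φ e : V × V × A).2.1, (e : V × V × A).2.1, a) ∈ E

/-- The dual (edge-reversed) edge set. -/
def dualEdges (E : Set (V × V × A)) : Set (V × V × A) := {e | (e.2.1, e.1, e.2.2) ∈ E}

/-- A graph is commutative (Plünnecke) if both it and its dual are semi-commutative. -/
def IsCommutativeGraph (E : Set (V × V × A)) : Prop :=
  IsSemiCommutative E ∧ IsSemiCommutative (dualEdges E)

/-- `L` is an `h`-layering of the graph: the layers `L 0, …, L h` are measurable, pairwise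
disjoint and partition `V`, and every edge goes from some layer `L i` to `L (i+1)` with
`i < h`. -/
def IsLayering [MeasurableSpace V] (E : Set (V × V × A)) (h : ℕ) (L : ℕ → Set V) : Prop :=
  (∀ i, MeasurableSet (L i)) ∧
  (Set.univ : Set V) = (⋃ i ∈ Finset.range (h + 1), L i) ∧
  (∀ i j, i ≠ j → Disjoint (L i) (L j)) ∧
  (∀ x y a, (x, y, a) ∈ E → ∃ i < h, x ∈ L i ∧ y ∈ L (i + 1))

/-- The magnification ratio of order `j`:
`D_j = inf { μ(Im^j Y) / μ(Y) : Y ⊆ V_0 measurable, μ(Y) > 0 }`. -/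
noncomputable def magD [MeasurableSpace V] (μ : Measure V) (E : Set (V × V × A))
    (L : ℕ → Set V) (j : ℕ) : ℝ≥0∞ :=
  sInf {r : ℝ≥0∞ | ∃ Y : Set V, Y ⊆ L 0 ∧ MeasurableSet Y ∧ 0 < μ Y ∧
    r = μ (ImIter E j Y) / μ Y}

/-- The weight corresponding to `C`: `w(S) = ∑_{j=0}^h C^{-j} μ(S ∩ V_j)`. -/
noncomputable def graphWeight [MeasurableSpace V] (μ : Measure V) (L : ℕ → Set V)
    (h : ℕ) (C : ℝ≥0∞) (S : Set V) : ℝ≥0∞ :=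
  ∑ j ∈ Finset.range (h + 1), C⁻¹ ^ j * μ (S ∩ L j)

/-- `S` is a cutset: every directed path from `V_0` to `V_h` meets `S`. -/
def IsCutset (E : Set (V × V × A)) (h : ℕ) (L : ℕ → Set V) (S : Set V) : Prop :=
  ∀ p : ℕ → V, p 0 ∈ L 0 → p h ∈ L h →
    (∀ i < h, ∃ a, (p i, p (i + 1), a) ∈ E) → ∃ i ≤ h, p i ∈ S

/-- `S` is an `ε`-minimal cutset (with respect to the weight corresponding to `C`):
`S` is a measurable cutset with `w(S) ≤ inf { w(Y) : Y a measurable cutset } + ε`. -/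
def IsEpsMinCutset [MeasurableSpace V] (μ : Measure V) (E : Set (V × V × A)) (h : ℕ)
    (L : ℕ → Set V) (C ε : ℝ≥0∞) (S : Set V) : Prop :=
  MeasurableSet S ∧ IsCutset E h L S ∧
    graphWeight μ L h C S ≤
      sInf {w : ℝ≥0∞ | ∃ Y : Set V, MeasurableSet Y ∧ IsCutset E h L Y ∧
        w = graphWeight μ L h C Y} + ε

/-! ### Auxiliary lemmas -/

namespace PlunAux

lemma imaPos_inter (E : Set (V × V × A)) (a : A) (W : Set V) :
    ImaPos E a W = ImaPos E a (W ∩ LaPos E a) := by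
  ext v
  constructor
  · rintro ⟨w, hw, he⟩
    exact ⟨w, ⟨hw, v, he⟩, he⟩
  · rintro ⟨w, hw, he⟩
    exact ⟨w, hw.1, he⟩

lemma imaNeg_inter (E : Set (V × V × A)) (a : A) (W : Set V) :
    ImaNeg E a W = ImaNeg E a (W ∩ LaNeg E a) := by
  ext v
  constructor
  · rintro ⟨w, hw, he⟩
    exact ⟨w, ⟨hw, v, he⟩, he⟩
  · rintro ⟨w, hw, he⟩
    exact ⟨w, hw.1, he⟩

lemma meas_imaPos [MeasurableSpace V] [Fintype A] {μ : Measure V} {E : Set (V × V × A)}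
    (hG : IsMeasureGraph μ E) (a : A) {W : Set V} (hW : MeasurableSet W) :
    MeasurableSet (ImaPos E a W) := by
  rw [imaPos_inter]
  exact (hG.measImaPos a _ (hW.inter (hG.measLaPos a)) Set.inter_subset_right).1

lemma meas_imaNeg [MeasurableSpace V] [Fintype A] {μ : Measure V} {E : Set (V × V × A)}
    (hG : IsMeasureGraph μ E) (a : A) {W : Set V} (hW : MeasurableSet W) :
    MeasurableSet (ImaNeg E a W) := by
  rw [imaNeg_inter]
  exact (hG.measImaNeg a _ (hW.inter (hG.measLaNeg a)) Set.inter_subset_right).1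

lemma meas_imPos [MeasurableSpace V] [Fintype A] {μ : Measure V} {E : Set (V × V × A)}
    (hG : IsMeasureGraph μ E) {W : Set V} (hW : MeasurableSet W) :
    MeasurableSet (ImPos E W) :=
  MeasurableSet.iUnion fun a => meas_imaPos hG a hW

lemma meas_imIter [MeasurableSpace V] [Fintype A] {μ : Measure V} {E : Set (V × V × A)}
    (hG : IsMeasureGraph μ E) (n : ℕ) {W : Set V} (hW : MeasurableSet W) :
    MeasurableSet (ImIter E n W) := by
  induction n with
  | zero => exact hW
  | succ n ih =>
    have : ImIter E (n + 1) W = ImPos E (ImIter E n W) := by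
      simp only [ImIter, Function.iterate_succ_apply']
    rw [this]
    exact meas_imPos hG ih

lemma imIter_succ (E : Set (V × V × A)) (n : ℕ) (W : Set V) :
    ImIter E (n + 1) W = ImPos E (ImIter E n W) := by
  simp only [ImIter, Function.iterate_succ_apply']

lemma measure_edges [MeasurableSpace V] [Fintype A] {μ : Measure V} {E : Set (V × V × A)}
    (hG : IsMeasureGraph μ E) (a : A) {P Q : Set V} (hP : MeasurableSet P)
    (hQ : MeasurableSet Q) :
    μ.real (P ∩ ImaNeg E a Q) = μ.real (Q ∩ ImaPos E a P) := by
  have h1 : P ∩ ImaNeg E a Q ⊆ LaPos E a := by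
    rintro x ⟨-, y, -, he⟩
    exact ⟨y, he⟩
  have h2 := (hG.measImaPos a _ (hP.inter (meas_imaNeg hG a hQ)) h1).2
  have h3 : ImaPos E a (P ∩ ImaNeg E a Q) = Q ∩ ImaPos E a P := by
    ext y
    constructor
    · rintro ⟨x, ⟨hx, y', hy', he'⟩, he⟩
      have := hG.uniqueOut a x y y' he he'
      subst this
      exact ⟨hy', x, hx, he⟩
    · rintro ⟨hy, x, hx, he⟩
      exact ⟨x, ⟨hx, y, hy, he⟩, he⟩
  rw [h3] at h2
  simp only [Measure.real, h2]

open Classical in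
/-- number of labels `a` with `v ∈ B a`. -/
noncomputable def cnt [Fintype A] (B : A → Set V) (v : V) : ℕ :=
  (Finset.univ.filter (fun a => v ∈ B a)).card

open Classical in
lemma cnt_eq_sum [Fintype A] (B : A → Set V) (v : V) :
    (cnt B v : ℝ) = ∑ a : A, (B a).indicator (fun _ => (1 : ℝ)) v := by
  simp [cnt, Set.indicator_apply, Finset.sum_boole]

lemma cnt_le [Fintype A] (B : A → Set V) (v : V) : cnt B v ≤ Fintype.card A :=
  Finset.card_le_univ _

lemma one_le_cnt [Fintype A] (B : A → Set V) (v : V) : 1 ≤ cnt B v ↔ ∃ a, v ∈ B a := by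
  classical
  rw [cnt, Nat.one_le_iff_ne_zero, Finset.card_ne_zero]
  simp [Finset.Nonempty]

lemma meas_cnt [MeasurableSpace V] [Fintype A] {B : A → Set V}
    (hB : ∀ a, MeasurableSet (B a)) (k : ℕ) : MeasurableSet {v | k ≤ cnt B v} := by
  have h1 : Measurable fun v => (cnt B v : ℝ) := by
    simp only [cnt_eq_sum]
    exact Finset.measurable_sum _ fun a _ => measurable_const.indicator (hB a)
  have h2 : {v | k ≤ cnt B v} = {v | (k : ℝ) ≤ (cnt B v : ℝ)} := by
    ext v; simp
  rw [h2]
  exact measurableSet_le measurable_const h1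

lemma layer_cake [MeasurableSpace V] [Fintype A] (μ : Measure V) [IsFiniteMeasure μ]
    {B : A → Set V} (hB : ∀ a, MeasurableSet (B a)) :
    ∑ k ∈ Finset.range (Fintype.card A + 1), μ.real {v | k + 1 ≤ cnt B v} =
      ∑ a : A, μ.real (B a) := by
  have hind : ∀ {T : Set V}, MeasurableSet T →
      Integrable (T.indicator (fun _ => (1 : ℝ))) μ := fun hT =>
    (integrable_const _).indicator hT
  have hint : ∀ {T : Set V}, MeasurableSet T →
      μ.real T = ∫ v, T.indicator (fun _ => (1 : ℝ)) v ∂μ := by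
    intro T hT
    rw [integral_indicator hT]
    simp
  have e1 : ∑ k ∈ Finset.range (Fintype.card A + 1), μ.real {v | k + 1 ≤ cnt B v} =
      ∫ v, ∑ k ∈ Finset.range (Fintype.card A + 1),
        ({v | k + 1 ≤ cnt B v} : Set V).indicator (fun _ => (1 : ℝ)) v ∂μ := by
    rw [integral_finsetSum _ fun k _ => hind (meas_cnt hB (k + 1))]
    exact Finset.sum_congr rfl fun k _ => hint (meas_cnt hB (k + 1))
  have e2 : ∑ a : A, μ.real (B a) =
      ∫ v, ∑ a : A, (B a).indicator (fun _ => (1 : ℝ)) v ∂μ := by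
    rw [integral_finsetSum _ fun a _ => hind (hB a)]
    exact Finset.sum_congr rfl fun a _ => hint (hB a)
  rw [e1, e2]
  congr 1
  ext v
  rw [← cnt_eq_sum]
  simp only [Set.indicator_apply, Set.mem_ofPred_eq]
  rw [Finset.sum_boole]
  congr 1
  have : (Finset.range (Fintype.card A + 1)).filter (fun k => k + 1 ≤ cnt B v) =
      Finset.range (cnt B v) := by
    ext k
    have := cnt_le B v
    simp only [Finset.mem_filter, Finset.mem_range]
    omega
  rw [this, Finset.card_range]

/-- degree comparison from semi-commutativity -/
lemma degree_le [Fintype A] {E : Set (V × V × A)} (hS : IsSemiCommutative E)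
    (hu : ∀ (a : A) (x y y' : V), (x, y, a) ∈ E → (x, y', a) ∈ E → y = y')
    {x y : V} {a : A} (he : (x, y, a) ∈ E) {P Q Y : Set V} (hxP : x ∈ P)
    (hQ : ∀ y' z a' a'', (x, y', a') ∈ E → z ∈ Y → (y', z, a'') ∈ E → y' ∈ Q)
    {B3 B1 : A → Set V}
    (h3 : ∀ a v, v ∈ B3 a → ∃ z ∈ Y, (v, z, a) ∈ E)
    (h1 : ∀ a v, v ∈ P → (∃ z ∈ Q, (v, z, a) ∈ E) → v ∈ B1 a) :
    cnt B3 y ≤ cnt B1 x := by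
  classical
  obtain ⟨φ, hφ, hφE⟩ := hS x y a he
  have hz : ∀ a', y ∈ B3 a' → ∃ z ∈ Y, (y, z, a') ∈ E := fun a' h => h3 a' y h
  choose z hzY hzE using hz
  let e : (a' : A) → y ∈ B3 a' → EdgesFrom E y := fun a' h => ⟨(y, z a' h, a'), hzE a' h, rfl⟩
  let f : A → A := fun a' => if h : y ∈ B3 a' then (φ (e a' h) : V × V × A).2.2 else a'
  have key : ∀ a' (h : y ∈ B3 a'), (x, (φ (e a' h) : V × V × A).2.1,
      (φ (e a' h) : V × V × A).2.2) ∈ E := by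
    intro a' h
    have h4 := (φ (e a' h)).2
    have h5 : ((φ (e a' h) : V × V × A)).1 = x := h4.2
    have gen : ∀ p : V × V × A, p ∈ E → p.1 = x → (x, p.2.1, p.2.2) ∈ E := by
      rintro p hp rfl
      exact hp
    exact gen _ h4.1 h5
  unfold cnt
  refine Finset.card_le_card_of_injOn f ?_ ?_
  · intro a' ha'
    have ha : y ∈ B3 a' := by simpa using ha'
    have hf : f a' = (φ (e a' ha) : V × V × A).2.2 := by simp only [f, dif_pos ha]
    simp only [Finset.coe_filter, Finset.mem_univ, true_and, Set.mem_ofPred_eq]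
    apply h1 _ _ hxP
    rw [hf]
    refine ⟨_, ?_, key a' ha⟩
    exact hQ _ (z a' ha) _ a (key a' ha) (hzY a' ha) (hφE (e a' ha))
  · intro a₁ ha₁ a₂ ha₂ hf
    have h₁ : y ∈ B3 a₁ := by simpa using ha₁
    have h₂ : y ∈ B3 a₂ := by simpa using ha₂
    have hf' : (φ (e a₁ h₁) : V × V × A).2.2 = (φ (e a₂ h₂) : V × V × A).2.2 := by
      simpa only [f, dif_pos h₁, dif_pos h₂] using hf
    have k1 := key a₁ h₁
    have k2 := key a₂ h₂
    rw [hf'] at k1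
    have hh := hu _ _ _ _ k1 k2
    have hx1 : ((φ (e a₁ h₁) : V × V × A)).1 = x := (φ (e a₁ h₁)).2.2
    have hx2 : ((φ (e a₂ h₂) : V × V × A)).1 = x := (φ (e a₂ h₂)).2.2
    have hee : e a₁ h₁ = e a₂ h₂ := by
      apply hφ
      apply Subtype.ext
      exact Prod.ext (hx1.trans hx2.symm) (Prod.ext hh hf')
    have := congrArg (fun t : EdgesFrom E y => (t : V × V × A).2.2) hee
    exact this

/-- A cut: `X` is the source side, `Y` the sink side, the separating set is `(X ∪ Y)ᶜ`. -/
structure Cut [MeasurableSpace V] (E : Set (V × V × A)) (h : ℕ) (L : ℕ → Set V)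
    (X Y : Set V) : Prop where
  mX : MeasurableSet X
  mY : MeasurableSet Y
  disj : ∀ v, v ∈ X → v ∈ Y → False
  noEdge : ∀ x y a, (x, y, a) ∈ E → x ∈ X → y ∈ Y → False
  src : ∀ v, v ∈ L 0 → v ∈ Y → False
  snk : ∀ v, v ∈ L h → v ∈ X → False

section Step

variable [MeasurableSpace V] [Fintype A] {μ : Measure V} {E : Set (V × V × A)}
  {h : ℕ} {L : ℕ → Set V}

lemma layer_unique (hLay : IsLayering E h L) {v : V} {i j : ℕ} (hi : v ∈ L i) (hj : v ∈ L j) :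
    i = j := by
  by_contra hne
  exact Set.disjoint_left.1 (hLay.2.2.1 i j hne) hi hj

lemma layer_head (hLay : IsLayering E h L) {x y : V} {a : A} (he : (x, y, a) ∈ E) {i : ℕ}
    (hx : x ∈ L i) : y ∈ L (i + 1) := by
  obtain ⟨k, -, h1, h2⟩ := hLay.2.2.2 x y a he
  rwa [layer_unique hLay hx h1]

lemma layer_tail (hLay : IsLayering E h L) {x y : V} {a : A} (he : (x, y, a) ∈ E) {i : ℕ}
    (hy : y ∈ L (i + 1)) : x ∈ L i := by
  obtain ⟨k, -, h1, h2⟩ := hLay.2.2.2 x y a he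
  have := layer_unique hLay hy h2
  have : i = k := by omega
  rwa [this]

/-- move `T` to the sink side -/
lemma Cut.moveDown (hG : IsMeasureGraph μ E) (hLay : IsLayering E h L) {X Y : Set V}
    (hc : Cut E h L X Y) {i : ℕ} {T : Set V} (mT : MeasurableSet T) (hT : T ⊆ L (i + 1))
    (hTX : ∀ v ∈ T, v ∉ X) : Cut E h L (X \ ⋃ a, ImaNeg E a T) (Y ∪ T) where
  mX := hc.mX.diff (MeasurableSet.iUnion fun a => meas_imaNeg hG a mT)
  mY := hc.mY.union mT
  disj := by
    rintro v ⟨hv, -⟩ (hy | hy)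
    · exact hc.disj v hv hy
    · exact hTX v hy hv
  noEdge := by
    rintro x y a he ⟨hx, hx'⟩ (hy | hy)
    · exact hc.noEdge x y a he hx hy
    · exact hx' (Set.mem_iUnion.2 ⟨a, y, hy, he⟩)
  src := by
    rintro v hv (hy | hy)
    · exact hc.src v hv hy
    · have := layer_unique hLay hv (hT hy)
      omega
  snk := fun v hv hx => hc.snk v hv hx.1

/-- move `T` to the source side -/
lemma Cut.moveUp (hG : IsMeasureGraph μ E) (hLay : IsLayering E h L) {X Y : Set V}
    (hc : Cut E h L X Y) {i : ℕ} {T : Set V} (mT : MeasurableSet T) (hT : T ⊆ L i)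
    (hi : i < h) (hTY : ∀ v ∈ T, v ∉ Y) : Cut E h L (X ∪ T) (Y \ ⋃ a, ImaPos E a T) where
  mX := hc.mX.union mT
  mY := hc.mY.diff (MeasurableSet.iUnion fun a => meas_imaPos hG a mT)
  disj := by
    rintro v (hx | hx) ⟨hy, -⟩
    · exact hc.disj v hx hy
    · exact hTY v hx hy
  noEdge := by
    rintro x y a he (hx | hx) ⟨hy, hy'⟩
    · exact hc.noEdge x y a he hx hy
    · exact hy' (Set.mem_iUnion.2 ⟨a, x, hx, he⟩)
  src := fun v hv hy => hc.src v hv hy.1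
  snk := by
    rintro v hv (hx | hx)
    · exact hc.snk v hv hx
    · have := layer_unique hLay hv (hT hx)
      omega

lemma real_move_eq (ν : Measure V) [IsFiniteMeasure ν] {S S' T N : Set V}
    (mT : MeasurableSet T) (mN : MeasurableSet N)
    (hTS : T ⊆ S) (hNS : ∀ v ∈ N, v ∉ S)
    (hS' : S' = (S \ T) ∪ N) : ν.real S' = ν.real S - ν.real T + ν.real N := by
  rw [hS', measureReal_union _ mN, measureReal_sdiff hTS mT]
  rw [Set.disjoint_left]
  intro v hv hn
  exact hNS v hn hv.1

/-- The main step. -/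
lemma step (hG : IsMeasureGraph μ E) (hLay : IsLayering E h L) (hComm : IsCommutativeGraph E)
    [IsFiniteMeasure μ] (ν : Measure V) [IsFiniteMeasure ν] {c : ℝ} (hc : 0 < c)
    (hν : ∀ k ≤ h, ∀ S ⊆ L k, ν.real S = c ^ k * μ.real S)
    {X Y : Set V} (hcut : Cut E h L X Y) {n : ℕ} (hn : n + 1 < h) {ε : ℝ} (hε : 0 ≤ ε)
    (hmin : ∀ X' Y', Cut E h L X' Y' → ν.real (X ∪ Y)ᶜ ≤ ν.real (X' ∪ Y')ᶜ + ε) :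
    ∃ X' Y', Cut E h L X' Y' ∧
      ν.real (X' ∪ Y')ᶜ ≤ ν.real (X ∪ Y)ᶜ + (Fintype.card A + 1) * ε * (1 + c⁻¹) ∧
      (∀ v ∈ L (n + 1), v ∈ X' ∪ Y') ∧
      (∀ k, n + 1 < k → ∀ v ∈ L k, v ∈ X ∪ Y → v ∈ X' ∪ Y') := by
  classical
  set Si : Set V := (X ∪ Y)ᶜ ∩ L (n + 1) with hSi
  have mSi : MeasurableSet Si := (hcut.mX.union hcut.mY).compl.inter (hLay.1 _)
  have SiX : ∀ v ∈ Si, v ∉ X := fun v hv hx => hv.1 (Or.inl hx)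
  have SiY : ∀ v ∈ Si, v ∉ Y := fun v hv hy => hv.1 (Or.inr hy)
  have SiL : Si ⊆ L (n + 1) := fun v hv => hv.2
  have mNeg : ∀ {T : Set V}, MeasurableSet T → MeasurableSet (⋃ a, ImaNeg E a T) :=
    fun mT => MeasurableSet.iUnion fun a => meas_imaNeg hG a mT
  have mPos : ∀ {T : Set V}, MeasurableSet T → MeasurableSet (⋃ a, ImaPos E a T) :=
    fun mT => MeasurableSet.iUnion fun a => meas_imaPos hG a mT
  -- weights of the moved cuts
  have down_w : ∀ T ⊆ Si, MeasurableSet T →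
      ν.real ((X \ ⋃ a, ImaNeg E a T) ∪ (Y ∪ T))ᶜ =
        ν.real (X ∪ Y)ᶜ - ν.real T + ν.real (X ∩ ⋃ a, ImaNeg E a T) := by
    intro T hT mT
    refine real_move_eq ν mT (hcut.mX.inter (mNeg mT)) (fun v hv => (hT hv).1)
      (fun v hv hv' => hv' (Or.inl hv.1)) ?_
    ext v
    have h1 := fun hv : v ∈ T => SiX v (hT hv)
    have h2 := hcut.disj v
    simp only [Set.mem_compl_iff, Set.mem_union, Set.mem_sdiff, Set.mem_inter_iff]
    tauto
  have up_w : ∀ T ⊆ Si, MeasurableSet T →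
      ν.real ((X ∪ T) ∪ (Y \ ⋃ a, ImaPos E a T))ᶜ =
        ν.real (X ∪ Y)ᶜ - ν.real T + ν.real (Y ∩ ⋃ a, ImaPos E a T) := by
    intro T hT mT
    refine real_move_eq ν mT (hcut.mY.inter (mPos mT)) (fun v hv => (hT hv).1)
      (fun v hv hv' => hv' (Or.inr hv.1)) ?_
    ext v
    have h1 := fun hv : v ∈ T => SiY v (hT hv)
    have h2 := hcut.disj v
    simp only [Set.mem_compl_iff, Set.mem_union, Set.mem_sdiff, Set.mem_inter_iff]
    tauto
  have hall_down : ∀ T ⊆ Si, MeasurableSet T →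
      ν.real T ≤ ν.real (X ∩ ⋃ a, ImaNeg E a T) + ε := by
    intro T hT mT
    have h1 := hmin _ _ (hcut.moveDown hG hLay mT (hT.trans SiL) fun v hv => SiX v (hT hv))
    rw [down_w T hT mT] at h1
    linarith
  have hall_up : ∀ T ⊆ Si, MeasurableSet T →
      ν.real T ≤ ν.real (Y ∩ ⋃ a, ImaPos E a T) + ε := by
    intro T hT mT
    have h1 := hmin _ _ (hcut.moveUp hG hLay mT (hT.trans SiL) hn fun v hv => SiY v (hT hv))
    rw [up_w T hT mT] at h1
    linarith
  let B1 : A → Set V := fun a => X ∩ ImaNeg E a Si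
  let B2 : A → Set V := fun a => Si ∩ ImaPos E a X
  let B3 : A → Set V := fun a => Si ∩ ImaNeg E a Y
  let B4 : A → Set V := fun a => Y ∩ ImaPos E a Si
  have m1 : ∀ a, MeasurableSet (B1 a) := fun a => hcut.mX.inter (meas_imaNeg hG a mSi)
  have m2 : ∀ a, MeasurableSet (B2 a) := fun a => mSi.inter (meas_imaPos hG a hcut.mX)
  have m3 : ∀ a, MeasurableSet (B3 a) := fun a => mSi.inter (meas_imaNeg hG a hcut.mY)
  have m4 : ∀ a, MeasurableSet (B4 a) := fun a => hcut.mY.inter (meas_imaPos hG a mSi)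
  have sub : ∀ (B : A → Set V) (T : Set V), (∀ a, B a ⊆ T) → ∀ k : ℕ,
      {v | k + 1 ≤ cnt B v} ⊆ T := by
    intro B T hB k v hv
    have : 1 ≤ cnt B v := le_trans (by omega) hv
    obtain ⟨a, ha⟩ := (one_le_cnt B v).1 this
    exact hB a ha
  have s1 : ∀ k : ℕ, {v | k + 1 ≤ cnt B1 v} ⊆ L n :=
    sub B1 _ (by rintro a v ⟨hv, y, hy, he⟩; exact layer_tail hLay he hy.2)
  have s2 : ∀ k : ℕ, {v | k + 1 ≤ cnt B2 v} ⊆ Si := sub B2 _ fun a v hv => hv.1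
  have s3 : ∀ k : ℕ, {v | k + 1 ≤ cnt B3 v} ⊆ Si := sub B3 _ fun a v hv => hv.1
  have s4 : ∀ k : ℕ, {v | k + 1 ≤ cnt B4 v} ⊆ L (n + 2) :=
    sub B4 _ (by rintro a v ⟨hv, y, hy, he⟩; exact layer_head hLay he hy.2)
  have d1 : ∀ x y a, (x, y, a) ∈ E → x ∈ X → y ∈ Si → cnt B3 y ≤ cnt B1 x := by
    intro x y a he hx hy
    refine degree_le hComm.1 hG.uniqueOut he (P := X) (Q := Si) (Y := Y) hx ?_ ?_ ?_
    · intro y' z a' a'' he' hz he''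
      have hxL := layer_tail hLay he hy.2
      refine ⟨?_, layer_head hLay he' hxL⟩
      rintro (h1 | h1)
      · exact hcut.noEdge _ _ _ he'' h1 hz
      · exact hcut.noEdge _ _ _ he' hx h1
    · rintro a v ⟨-, z, hz, he⟩
      exact ⟨z, hz, he⟩
    · rintro a v hv ⟨z, hz, he⟩
      exact ⟨hv, z, hz, he⟩
  have d2 : ∀ y z a, (y, z, a) ∈ E → y ∈ Si → z ∈ Y → cnt B2 y ≤ cnt B4 z := by
    intro y z a he hy hz
    refine degree_le (E := dualEdges E) (x := z) (y := y) (a := a) hComm.2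
      (fun a x y y' h1 h2 => hG.uniqueIn a y y' x h1 h2) he (P := Y) (Q := Si) (Y := X)
      hz ?_ ?_ ?_
    · intro y' x a' a'' he' hx he''
      have he1 : (y', z, a') ∈ E := he'
      have he2 : (x, y', a'') ∈ E := he''
      have hzL := layer_head hLay he hy.2
      refine ⟨?_, layer_tail hLay he1 hzL⟩
      rintro (h1 | h1)
      · exact hcut.noEdge _ _ _ he1 h1 hz
      · exact hcut.noEdge _ _ _ he2 hx h1
    · rintro a v ⟨-, z, hz, he⟩
      exact ⟨z, hz, he⟩
    · rintro a v hv ⟨z, hz, he⟩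
      exact ⟨hv, z, hz, he⟩
  have i1 : ∀ k : ℕ, ν.real {v | k + 1 ≤ cnt B3 v} ≤ ν.real {v | k + 1 ≤ cnt B1 v} + ε := by
    intro k
    refine (hall_down _ (s3 k) (meas_cnt m3 _)).trans ?_
    have : X ∩ ⋃ a, ImaNeg E a {v | k + 1 ≤ cnt B3 v} ⊆ {v | k + 1 ≤ cnt B1 v} := by
      rintro x ⟨hx, hx'⟩
      obtain ⟨a, y, hy, he⟩ := Set.mem_iUnion.1 hx'
      exact le_trans hy (d1 x y a he hx (s3 k hy))
    have := measureReal_mono (μ := ν) this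
    linarith
  have i2 : ∀ k : ℕ, ν.real {v | k + 1 ≤ cnt B2 v} ≤ ν.real {v | k + 1 ≤ cnt B4 v} + ε := by
    intro k
    refine (hall_up _ (s2 k) (meas_cnt m2 _)).trans ?_
    have : Y ∩ ⋃ a, ImaPos E a {v | k + 1 ≤ cnt B2 v} ⊆ {v | k + 1 ≤ cnt B4 v} := by
      rintro x ⟨hx, hx'⟩
      obtain ⟨a, y, hy, he⟩ := Set.mem_iUnion.1 hx'
      exact le_trans hy (d2 y x a he (s2 k hy) hx)
    have := measureReal_mono (μ := ν) this
    linarith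
  -- sums
  set K := Fintype.card A + 1 with hK
  have lc : ∀ (B : A → Set V), (∀ a, MeasurableSet (B a)) → ∀ i ≤ h,
      (∀ k : ℕ, {v | k + 1 ≤ cnt B v} ⊆ L i) →
      ∑ k ∈ Finset.range K, ν.real {v | k + 1 ≤ cnt B v} = c ^ i * ∑ a, μ.real (B a) := by
    intro B mB i hi hs
    rw [← layer_cake μ mB, Finset.mul_sum]
    exact Finset.sum_congr rfl fun k _ => hν i hi _ (hs k)
  have l1 := lc B1 m1 n (by omega) s1
  have l2 := lc B2 m2 (n + 1) (by omega) fun k => (s2 k).trans SiL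
  have l3 := lc B3 m3 (n + 1) (by omega) fun k => (s3 k).trans SiL
  have l4 := lc B4 m4 (n + 2) (by omega) s4
  have e12 : ∑ a, μ.real (B1 a) = ∑ a, μ.real (B2 a) :=
    Finset.sum_congr rfl fun a _ => measure_edges hG a hcut.mX mSi
  have e34 : ∑ a, μ.real (B3 a) = ∑ a, μ.real (B4 a) :=
    Finset.sum_congr rfl fun a _ => measure_edges hG a mSi hcut.mY
  have j1 : ∑ k ∈ Finset.range K, ν.real {v | k + 1 ≤ cnt B2 v} ≤
      ∑ k ∈ Finset.range K, ν.real {v | k + 1 ≤ cnt B4 v} + K * ε := by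
    calc _ ≤ ∑ k ∈ Finset.range K, (ν.real {v | k + 1 ≤ cnt B4 v} + ε) :=
          Finset.sum_le_sum fun k _ => i2 k
      _ = _ := by simp [Finset.sum_add_distrib]
  have j2 : ∑ k ∈ Finset.range K, ν.real {v | k + 1 ≤ cnt B1 v} ≤
      ∑ k ∈ Finset.range K, ν.real {v | k + 1 ≤ cnt B3 v} + c⁻¹ * (K * ε) := by
    rw [l2, l4, ← e34] at j1
    rw [l1, l3, e12]
    have : c ^ n * ∑ a, μ.real (B2 a) = c⁻¹ * (c ^ (n + 1) * ∑ a, μ.real (B2 a)) := by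
      rw [pow_succ]
      field_simp
    rw [this]
    have h2 : c ^ (n + 1) * ∑ a, μ.real (B3 a) + c⁻¹ * (K * ε) =
        c⁻¹ * (c ^ (n + 2) * ∑ a, μ.real (B3 a) + K * ε) := by
      field_simp
      ring
    rw [h2]
    exact mul_le_mul_of_nonneg_left j1 (inv_nonneg.2 hc.le)
  have j3 : ν.real {v | 0 + 1 ≤ cnt B1 v} ≤ ν.real {v | 0 + 1 ≤ cnt B3 v} + K * ε * (1 + c⁻¹) := by
    have hs : ∑ k ∈ Finset.range (Fintype.card A), ν.real {v | (k + 1) + 1 ≤ cnt B3 v} ≤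
        ∑ k ∈ Finset.range (Fintype.card A), ν.real {v | (k + 1) + 1 ≤ cnt B1 v}
          + Fintype.card A * ε := by
      calc _ ≤ ∑ k ∈ Finset.range (Fintype.card A),
            (ν.real {v | (k + 1) + 1 ≤ cnt B1 v} + ε) :=
            Finset.sum_le_sum fun k _ => i1 (k + 1)
        _ = _ := by simp [Finset.sum_add_distrib]
    rw [hK, Finset.sum_range_succ', Finset.sum_range_succ', ← hK] at j2
    have hKc : (K : ℝ) = Fintype.card A + 1 := by rw [hK]; push_cast; ring
    have : K * ε * (1 + c⁻¹) = Fintype.card A * ε + ε + c⁻¹ * (K * ε) := by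
      rw [hKc]; ring
    rw [this]
    linarith
  refine ⟨_, _, hcut.moveDown hG hLay mSi SiL SiX, ?_, ?_, ?_⟩
  · rw [down_w Si le_rfl mSi]
    have t1 : X ∩ ⋃ a, ImaNeg E a Si ⊆ {v | 0 + 1 ≤ cnt B1 v} := by
      rintro x ⟨hx, hx'⟩
      obtain ⟨a, ha⟩ := Set.mem_iUnion.1 hx'
      exact (one_le_cnt B1 x).2 ⟨a, hx, ha⟩
    have t2 := measureReal_mono (μ := ν) t1
    have t3 := measureReal_mono (μ := ν) (s3 0)
    have hKc : (K : ℝ) = Fintype.card A + 1 := by rw [hK]; push_cast; ring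
    rw [hKc] at j3
    linarith
  · intro v hv
    by_cases hv' : v ∈ X ∪ Y
    · rcases hv' with hx | hy
      · refine Or.inl ⟨hx, fun hx' => ?_⟩
        obtain ⟨a, y, hy, he⟩ := Set.mem_iUnion.1 hx'
        have := layer_unique hLay hv (layer_tail hLay he hy.2)
        omega
      · exact Or.inr (Or.inl hy)
    · exact Or.inr (Or.inr ⟨hv', hv⟩)
  · rintro k hk v hv (hx | hy)
    · refine Or.inl ⟨hx, fun hx' => ?_⟩
      obtain ⟨a, y, hy, he⟩ := Set.mem_iUnion.1 hx'
      have := layer_unique hLay hv (layer_tail hLay he hy.2)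
      omega
    · exact Or.inr (Or.inl hy)

/-- Nearly minimal cuts can be pushed to the extreme layers. -/
lemma push (hG : IsMeasureGraph μ E) (hLay : IsLayering E h L) (hComm : IsCommutativeGraph E)
    [IsFiniteMeasure μ] (ν : Measure V) [IsFiniteMeasure ν] {c : ℝ} (hc : 0 < c)
    (hν : ∀ k ≤ h, ∀ S ⊆ L k, ν.real S = c ^ k * μ.real S) {m : ℝ}
    (hm : ∀ X' Y', Cut E h L X' Y' → m ≤ ν.real (X' ∪ Y')ᶜ)
    (hm' : ∀ ε > 0, ∃ X' Y', Cut E h L X' Y' ∧ ν.real (X' ∪ Y')ᶜ ≤ m + ε)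
    (t : ℕ) : ∀ i, i + 1 + t = h → ∀ ε > 0, ∃ X' Y', Cut E h L X' Y' ∧
      ν.real (X' ∪ Y')ᶜ ≤ m + ε ∧
      ∀ k, i < k → k < h → ∀ v ∈ L k, v ∈ X' ∪ Y' := by
  induction t with
  | zero =>
    intro i hi ε hε
    obtain ⟨X, Y, h1, h2⟩ := hm' ε hε
    exact ⟨X, Y, h1, h2, fun k hk hk' => by omega⟩
  | succ t ih =>
    intro i hi ε hε
    set M : ℝ := 1 + (Fintype.card A + 1) * (1 + c⁻¹) with hM
    have hMpos : 0 < M := by positivity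
    obtain ⟨X, Y, h1, h2, h3⟩ := ih (i + 1) (by omega) (ε / M) (by positivity)
    obtain ⟨X', Y', c1, c2, c3, c4⟩ := step hG hLay hComm ν hc hν h1 (n := i) (by omega)
      (ε := ε / M) (by positivity) (fun X' Y' hX' => by
        have := hm X' Y' hX'
        linarith)
    refine ⟨X', Y', c1, ?_, ?_⟩
    · have : ε = ε / M * M := by field_simp
      have h5 : ε / M * M = ε / M + (Fintype.card A + 1) * (ε / M) * (1 + c⁻¹) := by
        rw [hM]; ring
      linarith
    · intro k hk hkh v hv
      rcases Nat.lt_or_ge (i + 1) k with h6 | h6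
      · exact c4 k h6 v hv (h3 k h6 hkh v hv)
      · have : k = i + 1 := by omega
        subst this
        exact c3 v hv

lemma imIter_layer (hLay : IsLayering E h L) {Z : Set V} (hZ : Z ⊆ L 0) (k : ℕ) :
    ImIter E k Z ⊆ L k := by
  induction k with
  | zero => exact hZ
  | succ k ih =>
    rw [imIter_succ]
    intro v hv
    obtain ⟨a, w, hw, he⟩ := Set.mem_iUnion.1 hv
    exact layer_head hLay he (ih hw)

/-- Core inequality with real numbers. -/
lemma core (hG : IsMeasureGraph μ E) (hLay : IsLayering E h L) (hComm : IsCommutativeGraph E)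
    [IsFiniteMeasure μ] {c : ℝ} (hc : 0 < c)
    (hD : ∀ Z ⊆ L 0, MeasurableSet Z → μ.real Z ≤ c ^ h * μ.real (ImIter E h Z))
    {j : ℕ} (hj : 1 ≤ j) (hjh : j ≤ h) {Z : Set V} (hZ : Z ⊆ L 0) (mZ : MeasurableSet Z) :
    μ.real Z ≤ c ^ j * μ.real (ImIter E j Z) := by
  classical
  let ν : Measure V := ∑ k ∈ Finset.range (h + 1), (c ^ k).toNNReal • μ.restrict (L k)
  have hνf : IsFiniteMeasure ν := by
    refine ⟨?_⟩
    simp only [ν, Measure.finsetSum_apply]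
    refine ENNReal.sum_lt_top.2 fun k _ => ?_
    exact measure_lt_top _ _
  have hν : ∀ k ≤ h, ∀ S ⊆ L k, ν.real S = c ^ k * μ.real S := by
    intro k hk S hS
    have : ν S = (c ^ k).toNNReal • μ S := by
      simp only [ν, Measure.finsetSum_apply]
      rw [Finset.sum_eq_single k]
      · rw [Measure.smul_apply, Measure.restrict_eq_self _ hS]
      · intro b _ hb
        rw [Measure.smul_apply, Measure.restrict_apply' (hLay.1 b)]
        have : S ∩ L b = ∅ := by
          ext v
          simp only [Set.mem_inter_iff, Set.mem_empty_iff_false, iff_false, not_and]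
          intro h1 h2
          exact hb (layer_unique hLay h2 (hS h1))
        simp [this]
      · intro hk'
        exact absurd (Finset.mem_range.2 (by omega)) hk'
    rw [Measure.real, this, Measure.real, ENNReal.smul_def, smul_eq_mul, ENNReal.toReal_mul]
    simp [(pow_pos hc k).le]
  have cut0 : Cut E h L ∅ ∅ :=
    ⟨MeasurableSet.empty, MeasurableSet.empty, fun _ h _ => h, fun _ _ _ _ h _ => h,
      fun _ _ h => h, fun _ _ h => h⟩
  set W : Set ℝ := {r | ∃ X Y, Cut E h L X Y ∧ r = ν.real (X ∪ Y)ᶜ} with hW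
  have Wne : W.Nonempty := ⟨_, ∅, ∅, cut0, rfl⟩
  have Wbdd : BddBelow W := ⟨0, by rintro r ⟨X, Y, -, rfl⟩; exact measureReal_nonneg⟩
  have hm : ∀ X' Y', Cut E h L X' Y' → sInf W ≤ ν.real (X' ∪ Y')ᶜ :=
    fun X' Y' hc => csInf_le Wbdd ⟨X', Y', hc, rfl⟩
  have hm' : ∀ ε > 0, ∃ X' Y', Cut E h L X' Y' ∧ ν.real (X' ∪ Y')ᶜ ≤ sInf W + ε := by
    intro ε hε
    obtain ⟨r, ⟨X, Y, h1, rfl⟩, h2⟩ := exists_lt_of_csInf_lt Wne (lt_add_of_pos_right (sInf W) hε)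
    exact ⟨X, Y, h1, h2.le⟩
  -- lower bound for the infimum
  have hlow : μ.real (L 0) ≤ sInf W := by
    refine le_of_forall_pos_le_add fun ε hε => ?_
    obtain ⟨X, Y, hcut, h1, h2⟩ := push hG hLay hComm ν hc hν hm hm' (h - 1) 0 (by omega) ε hε
    refine le_trans ?_ h1
    set X0 := L 0 ∩ X with hX0
    have mX0 : MeasurableSet X0 := (hLay.1 0).inter hcut.mX
    have hX0L : X0 ⊆ L 0 := Set.inter_subset_left
    have hk : ∀ k, k < h → ImIter E k X0 ⊆ X := by
      intro k
      induction k with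
      | zero => exact fun _ => Set.inter_subset_right
      | succ k ih =>
        intro hkh v hv
        have hvL := imIter_layer hLay hX0L _ hv
        rw [imIter_succ] at hv
        obtain ⟨a, w, hw, he⟩ := Set.mem_iUnion.1 hv
        rcases h2 (k + 1) (by omega) hkh v hvL with h3 | h3
        · exact h3
        · exact (hcut.noEdge _ _ _ he (ih (by omega) hw) h3).elim
    have hH : ImIter E h X0 ⊆ (X ∪ Y)ᶜ := by
      intro v hv
      have hvL := imIter_layer hLay hX0L _ hv
      obtain ⟨g, rfl⟩ : ∃ g, h = g + 1 := ⟨h - 1, by omega⟩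
      rw [imIter_succ] at hv
      obtain ⟨a, w, hw, he⟩ := Set.mem_iUnion.1 hv
      rintro (h3 | h3)
      · exact hcut.snk v hvL h3
      · exact hcut.noEdge _ _ _ he (hk g (by omega) hw) h3
    have hsub : (L 0 \ X) ∪ ImIter E h X0 ⊆ (X ∪ Y)ᶜ := by
      refine Set.union_subset ?_ hH
      rintro v ⟨hv, hv'⟩ (h3 | h3)
      · exact hv' h3
      · exact hcut.src v hv h3
    have hmono := measureReal_mono (μ := ν) hsub
    have hdis : Disjoint (L 0 \ X) (ImIter E h X0) := by
      rw [Set.disjoint_left]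
      intro v hv hv'
      have := layer_unique hLay hv.1 (imIter_layer hLay hX0L _ hv')
      omega
    rw [measureReal_union hdis (meas_imIter hG h mX0), hν 0 (by omega) _ Set.sdiff_subset,
      hν h le_rfl _ (imIter_layer hLay hX0L h)] at hmono
    have h5 := hD X0 hX0L mX0
    have h6 : μ.real (L 0) = μ.real (L 0 ∩ X) + μ.real (L 0 \ X) :=
      (measureReal_inter_add_sdiff (hcut.mX)).symm
    rw [pow_zero, one_mul] at hmono
    linarith
  -- the test cut
  set Xt : Set V := ⋃ k ∈ Finset.range j, ImIter E k Z with hXt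
  set St : Set V := (L 0 \ Z) ∪ ImIter E j Z with hSt
  have mXt : MeasurableSet Xt := Finset.measurableSet_biUnion _ fun k _ => meas_imIter hG k mZ
  have mI : MeasurableSet (ImIter E j Z) := meas_imIter hG j mZ
  have mSt : MeasurableSet St := ((hLay.1 0).diff mZ).union mI
  have memXt : ∀ v, v ∈ Xt ↔ ∃ k < j, v ∈ ImIter E k Z := by
    intro v; simp [hXt]
  have cutT : Cut E h L Xt (Xt ∪ St)ᶜ := by
    refine ⟨mXt, (mXt.union mSt).compl, fun v h1 h2 => h2 (Or.inl h1), ?_, ?_, ?_⟩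
    · intro x y a he hx hy
      obtain ⟨k, hk, hxk⟩ := (memXt x).1 hx
      have hyk : y ∈ ImIter E (k + 1) Z := by
        rw [imIter_succ]
        exact Set.mem_iUnion.2 ⟨a, x, hxk, he⟩
      apply hy
      rcases Nat.lt_or_ge (k + 1) j with h1 | h1
      · exact Or.inl ((memXt y).2 ⟨k + 1, h1, hyk⟩)
      · have : k + 1 = j := by omega
        rw [this] at hyk
        exact Or.inr (Or.inr hyk)
    · intro v hv hv'
      apply hv'
      by_cases hvZ : v ∈ Z
      · exact Or.inl ((memXt v).2 ⟨0, by omega, hvZ⟩)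
      · exact Or.inr (Or.inl ⟨hv, hvZ⟩)
    · intro v hv hx
      obtain ⟨k, hk, hxk⟩ := (memXt v).1 hx
      have := layer_unique hLay hv (imIter_layer hLay hZ _ hxk)
      omega
  have h1 := hm _ _ cutT
  have h2 : (Xt ∪ (Xt ∪ St)ᶜ)ᶜ ⊆ St := by
    intro v hv
    simp only [Set.mem_compl_iff, Set.mem_union] at hv
    by_contra hS
    exact hv (by by_cases hX : v ∈ Xt <;> simp [hX, hS])
  have h3 := measureReal_mono (μ := ν) h2
  have hdis : Disjoint (L 0 \ Z) (ImIter E j Z) := by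
    rw [Set.disjoint_left]
    intro v hv hv'
    have := layer_unique hLay hv.1 (imIter_layer hLay hZ _ hv')
    omega
  rw [hSt, measureReal_union hdis mI, hν 0 (by omega) _ Set.sdiff_subset,
    hν j hjh _ (imIter_layer hLay hZ j), measureReal_sdiff hZ mZ, pow_zero, one_mul] at h3
  linarith

end Step

end PlunAux

/-- Plünnecke's inequality for measure graphs: if `Γ = (V, 𝓑, μ, A, E)` is an `h`-layered
commutative measure graph with layers `V_0 ⊔ ⋯ ⊔ V_h`, then for every `j ∈ {1, …, h}`
one has `D_j^h ≥ D_h^j`. -/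
theorem magD_plunnecke_measure_graph [MeasurableSpace V] [Fintype A]
    (μ : Measure V) (E : Set (V × V × A)) (hGraph : IsMeasureGraph μ E)
    (h : ℕ) (L : ℕ → Set V) (hLay : IsLayering E h L) (hComm : IsCommutativeGraph E)
    (j : ℕ) (hj : 1 ≤ j) (hjh : j ≤ h) :
    magD μ E L j ^ h ≥ magD μ E L h ^ j := by
  have hfin : IsFiniteMeasure μ := ⟨lt_top_iff_ne_top.2 hGraph.finiteMeasure⟩
  by_cases h0 : μ (L 0) = 0
  · have : magD μ E L j = ⊤ := by
      unfold magD
      rw [sInf_eq_top]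
      rintro r ⟨Y, hY, -, hpos, -⟩
      exact absurd (measure_mono_null hY h0) hpos.ne'
    rw [this, ENNReal.top_pow (by omega)]
    exact le_top
  set D := magD μ E L h with hDdef
  have hDle : ∀ Y ⊆ L 0, MeasurableSet Y → 0 < μ Y → D ≤ μ (ImIter E h Y) / μ Y :=
    fun Y h1 h2 h3 => sInf_le ⟨Y, h1, h2, h3, rfl⟩
  have hDtop : D ≠ ⊤ := by
    refine ne_top_of_le_ne_top ?_ (hDle (L 0) le_rfl (hLay.1 0) (pos_iff_ne_zero.2 h0))
    exact ENNReal.div_ne_top (measure_ne_top _ _) h0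
  by_cases hD0 : D = 0
  · rw [hD0, zero_pow (by omega)]
    exact zero_le
  have hh : h ≠ 0 := by omega
  set d := D.toReal with hd
  have hdpos : 0 < d := ENNReal.toReal_pos hD0 hDtop
  set C : ℝ := d ^ ((h : ℝ)⁻¹) with hC
  have hCpos : 0 < C := Real.rpow_pos_of_pos hdpos _
  have hCh : C ^ h = d := Real.rpow_inv_natCast_pow hdpos.le hh
  have hreal : ∀ Z ⊆ L 0, MeasurableSet Z →
      μ.real Z ≤ C⁻¹ ^ h * μ.real (ImIter E h Z) := by
    intro Z hZ mZ
    by_cases hz : μ Z = 0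
    · rw [Measure.real, hz, ENNReal.toReal_zero]
      positivity
    · have h1 := hDle Z hZ mZ (pos_iff_ne_zero.2 hz)
      rw [ENNReal.le_div_iff_mul_le (Or.inl hz) (Or.inl (measure_ne_top _ _))] at h1
      have h2 := ENNReal.toReal_mono (measure_ne_top _ _) h1
      rw [ENNReal.toReal_mul] at h2
      rw [inv_pow, hCh, inv_mul_eq_div, le_div_iff₀ hdpos, mul_comm]
      exact h2
  have hDj : ENNReal.ofReal (C ^ j) ≤ magD μ E L j := by
    refine le_sInf ?_
    rintro r ⟨Z, hZ, mZ, hpos, rfl⟩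
    rw [ENNReal.le_div_iff_mul_le (Or.inl hpos.ne') (Or.inl (measure_ne_top _ _))]
    have h1 := PlunAux.core hGraph hLay hComm (inv_pos.2 hCpos) hreal hj hjh hZ mZ
    rw [inv_pow, inv_mul_eq_div, le_div_iff₀ (pow_pos hCpos j), mul_comm] at h1
    rw [← ENNReal.ofReal_toReal (measure_ne_top μ Z),
      ← ENNReal.ofReal_mul (pow_pos hCpos j).le]
    exact ENNReal.ofReal_le_of_le_toReal h1
  have hDd : D = ENNReal.ofReal d := (ENNReal.ofReal_toReal hDtop).symm
  calc D ^ j = ENNReal.ofReal (C ^ j) ^ h := by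
        rw [hDd, ← ENNReal.ofReal_pow hdpos.le, ← ENNReal.ofReal_pow (pow_pos hCpos j).le,
          ← hCh, ← pow_mul, ← pow_mul, mul_comm]
    _ ≤ magD μ E L j ^ h := pow_le_pow_left' hDj h
end

section
/- Let Γ = (V, 𝓑, μ, A, E) be an h-layered commutative measure graph with layers V_0 ⊔ ⋯ ⊔ V_h, suppose D_h^{1/h} > 0, and let w be the weight corresponding to C = D_h^{1/h}. Then the bottom layer V_0 is a cutset of minimal weight, i.e. w(V_0) ≤ w(S) for every measurable cutset S. -/
open MeasureTheory ENNReal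

variable {V A : Type*}

section Helpers

variable {V A : Type*}

theorem mem_ImPos {E : Set (V × V × A)} {W : Set V} {v : V} :
    v ∈ ImPos E W ↔ ∃ a, ∃ w ∈ W, (w, v, a) ∈ E := by
  simp [ImPos, ImaPos]

theorem mem_ImPos_dual {E : Set (V × V × A)} {W : Set V} {v : V} :
    v ∈ ImPos (dualEdges E) W ↔ ∃ a, ∃ w ∈ W, (v, w, a) ∈ E := by
  simp [ImPos, ImaPos, dualEdges]

theorem dual_dual (E : Set (V × V × A)) : dualEdges (dualEdges E) = E := rfl

theorem IsMeasureGraph.dual [MeasurableSpace V] {μ : Measure V} [Fintype A]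
    {E : Set (V × V × A)} (hG : IsMeasureGraph μ E) : IsMeasureGraph μ (dualEdges E) where
  finiteMeasure := hG.finiteMeasure
  measLaPos := hG.measLaNeg
  measLaNeg := hG.measLaPos
  measImaPos := hG.measImaNeg
  measImaNeg := hG.measImaPos
  uniqueOut := fun a x y y' h1 h2 => hG.uniqueIn a y y' x h1 h2
  uniqueIn := fun a x x' y h1 h2 => hG.uniqueOut a y x x' h1 h2

theorem meas_ImaPos [MeasurableSpace V] {μ : Measure V} [Fintype A]
    {E : Set (V × V × A)} (hG : IsMeasureGraph μ E) (a : A) {W : Set V}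
    (hW : MeasurableSet W) : MeasurableSet (ImaPos E a W) := by
  have h := (hG.measImaPos a (W ∩ LaPos E a) (hW.inter (hG.measLaPos a))
    Set.inter_subset_right).1
  convert h using 1
  ext v
  constructor
  · rintro ⟨w, hw, he⟩
    exact ⟨w, ⟨hw, v, he⟩, he⟩
  · rintro ⟨w, hw, he⟩
    exact ⟨w, hw.1, he⟩

theorem meas_ImaNeg [MeasurableSpace V] {μ : Measure V} [Fintype A]
    {E : Set (V × V × A)} (hG : IsMeasureGraph μ E) (a : A) {W : Set V}
    (hW : MeasurableSet W) : MeasurableSet (ImaNeg E a W) :=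
  meas_ImaPos hG.dual a hW

theorem meas_ImPos [MeasurableSpace V] {μ : Measure V} [Fintype A]
    {E : Set (V × V × A)} (hG : IsMeasureGraph μ E) {W : Set V}
    (hW : MeasurableSet W) : MeasurableSet (ImPos E W) :=
  MeasurableSet.iUnion fun a => meas_ImaPos hG a hW

theorem edge_count [MeasurableSpace V] {μ : Measure V} [Fintype A]
    {E : Set (V × V × A)} (hG : IsMeasureGraph μ E) (a : A) {X Y : Set V}
    (hX : MeasurableSet X) (hY : MeasurableSet Y) :
    μ.real (Y ∩ ImaPos E a X) = μ.real (X ∩ ImaNeg E a Y) := by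
  have h := (hG.measImaPos a (X ∩ ImaNeg E a Y) (hX.inter (meas_ImaNeg hG a hY))
    (by rintro x ⟨_, y, _, he⟩; exact ⟨y, he⟩)).2
  have h2 : ImaPos E a (X ∩ ImaNeg E a Y) = Y ∩ ImaPos E a X := by
    ext v
    constructor
    · rintro ⟨x, ⟨hx, y, hy, he⟩, he'⟩
      have := hG.uniqueOut a x y v he he'
      subst this
      exact ⟨hy, x, hx, he⟩
    · rintro ⟨hv, x, hx, he⟩
      exact ⟨x, ⟨hx, v, hv, he⟩, he⟩
  rw [h2] at h
  simp only [Measure.real, h]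

open Classical in
/-- number of sets `M a` containing `x` -/
noncomputable def cnt [Fintype A] (M : A → Set V) (x : V) : ℕ :=
  (Finset.univ.filter fun a => x ∈ M a).card

theorem meas_cnt [MeasurableSpace V] [Fintype A] {M : A → Set V}
    (hM : ∀ a, MeasurableSet (M a)) (t : ℕ) : MeasurableSet {x | t < cnt M x} := by
  classical
  have h1 : cnt M = fun x => ∑ a, (M a).indicator (fun _ => (1 : ℕ)) x := by
    ext x
    simp [cnt, Set.indicator_apply]
  have h2 : Measurable (cnt M) := by
    rw [h1]
    exact Finset.measurable_sum _ fun a _ => measurable_const.indicator (hM a)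
  exact measurableSet_lt measurable_const h2

theorem layer_cake [MeasurableSpace V] {μ : Measure V} [IsFiniteMeasure μ] [Fintype A]
    {M : A → Set V} (hM : ∀ a, MeasurableSet (M a)) :
    ∑ a, μ.real (M a) =
      ∑ t ∈ Finset.range (Fintype.card A + 1), μ.real {x | t < cnt M x} := by
  classical
  have h1 : ∑ a, μ.real (M a) = ∫ x, ∑ a, (M a).indicator (fun _ => (1 : ℝ)) x ∂μ := by
    rw [integral_finsetSum]
    · refine Finset.sum_congr rfl fun a _ => ?_
      rw [integral_indicator_const _ (hM a)]; simp
    · intro a _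
      exact (integrable_const _).indicator (hM a)
  have h2 : ∑ t ∈ Finset.range (Fintype.card A + 1), μ.real {x | t < cnt M x} =
      ∫ x, ∑ t ∈ Finset.range (Fintype.card A + 1),
        ({x | t < cnt M x} : Set V).indicator (fun _ => (1 : ℝ)) x ∂μ := by
    rw [integral_finsetSum]
    · refine Finset.sum_congr rfl fun t _ => ?_
      rw [integral_indicator_const _ (meas_cnt hM t)]; simp
    · intro t _
      exact (integrable_const _).indicator (meas_cnt hM t)
  rw [h1, h2]
  congr 1
  ext x
  have e1 : ∑ a, (M a).indicator (fun _ => (1 : ℝ)) x = (cnt M x : ℝ) := by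
    simp [cnt, Set.indicator_apply]
  have hle : cnt M x ≤ Fintype.card A := Finset.card_le_univ _
  have e2 : ∑ t ∈ Finset.range (Fintype.card A + 1),
        ({x | t < cnt M x} : Set V).indicator (fun _ => (1 : ℝ)) x = (cnt M x : ℝ) := by
    simp only [Set.indicator_apply, Set.mem_ofPred_eq, Finset.sum_boole]
    congr 1
    have : (Finset.range (Fintype.card A + 1)).filter (fun t => t < cnt M x)
        = Finset.range (cnt M x) := by
      ext t; simp; omega
    rw [this]; simp
  rw [e1, e2]

theorem cnt_le [Fintype A] {E : Set (V × V × A)}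
    (hout : ∀ (a : A) (x y y' : V), (x, y, a) ∈ E → (x, y', a) ∈ E → y = y')
    (hS : IsSemiCommutative E) {X Z : Set V} {x y : V} {a : A} (hx : x ∈ X)
    (he : (x, y, a) ∈ E) :
    cnt (fun b => (ImPos E X ∩ ImPos (dualEdges E) Z) ∩ ImaNeg E b Z) y ≤
      cnt (fun b => X ∩ ImaNeg E b (ImPos E X ∩ ImPos (dualEdges E) Z)) x := by
  classical
  obtain ⟨φ, hφ, hφ2⟩ := hS x y a he
  have key : ∀ b, ∃ c, ∀ z ∈ Z, ∀ hb : (y, z, b) ∈ E,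
      (φ ⟨(y, z, b), hb, rfl⟩ : V × V × A).2.2 = c := by
    intro b
    by_cases hz : ∃ z, (y, z, b) ∈ E
    · obtain ⟨z, hz⟩ := hz
      refine ⟨(φ ⟨(y, z, b), hz, rfl⟩ : V × V × A).2.2, ?_⟩
      intro z' _ hb
      have := hout b y z z' hz hb
      subst this
      rfl
    · exact ⟨a, fun z _ hb => absurd ⟨z, hb⟩ hz⟩
  choose f hf using key
  unfold cnt
  refine Finset.card_le_card_of_injOn f ?_ ?_
  · intro b hb
    simp only [Finset.coe_filter, Finset.mem_univ, true_and, Set.mem_ofPred_eq] at hb ⊢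
    obtain ⟨-, z, hz, hyz⟩ := hb
    have h1 := hf b z hz hyz
    have h2 := hφ2 ⟨(y, z, b), hyz, rfl⟩
    obtain ⟨h3, h4⟩ := (φ ⟨(y, z, b), hyz, rfl⟩).2
    generalize (φ ⟨(y, z, b), hyz, rfl⟩ : V × V × A) = e at h1 h2 h3 h4
    obtain ⟨e1, e2, e3⟩ := e
    simp only at h1 h2 h4
    subst h4
    subst h1
    refine ⟨hx, e2, ⟨mem_ImPos.2 ⟨_, _, hx, h3⟩, mem_ImPos_dual.2 ⟨_, _, hz, h2⟩⟩, h3⟩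
  · intro b hb b' hb' hbb
    simp only [Finset.coe_filter, Finset.mem_univ, true_and, Set.mem_ofPred_eq] at hb hb'
    obtain ⟨-, z, hz, hyz⟩ := hb
    obtain ⟨-, z', hz', hyz'⟩ := hb'
    have h1 := hf b z hz hyz
    have h1' := hf b' z' hz' hyz'
    obtain ⟨h3, h4⟩ := (φ ⟨(y, z, b), hyz, rfl⟩).2
    obtain ⟨h3', h4'⟩ := (φ ⟨(y, z', b'), hyz', rfl⟩).2
    have hEq : φ ⟨(y, z, b), hyz, rfl⟩ = φ ⟨(y, z', b'), hyz', rfl⟩ := by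
      apply Subtype.ext
      generalize (φ ⟨(y, z, b), hyz, rfl⟩ : V × V × A) = e at h1 h3 h4
      generalize (φ ⟨(y, z', b'), hyz', rfl⟩ : V × V × A) = e' at h1' h3' h4'
      obtain ⟨e1, e2, e3⟩ := e
      obtain ⟨e1', e2', e3'⟩ := e'
      simp only at h1 h4 h1' h4'
      subst h4
      have : e3 = e3' := by rw [h1, h1', hbb]
      subst this
      subst h4'
      have := hout _ _ _ _ h3 h3'
      rw [this]
    have h6 := congrArg (fun e : EdgesFrom E y => (e : V × V × A).2.2) (hφ hEq)
    exact h6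

theorem half [MeasurableSpace V] {μ : Measure V} [IsFiniteMeasure μ] [Fintype A]
    {E : Set (V × V × A)} (hG : IsMeasureGraph μ E) (hS : IsSemiCommutative E)
    {X Z Y : Set V} (hX : MeasurableSet X) (hZ : MeasurableSet Z)
    (hY : Y = ImPos E X ∩ ImPos (dualEdges E) Z) {p q ε : ℝ} (hp : 0 ≤ p) (hq : 0 ≤ q)
    (hall : ∀ U ⊆ Y, MeasurableSet U →
      p * μ.real U ≤ q * μ.real (ImPos (dualEdges E) U ∩ X) + ε) :
    q * μ.real (ImPos (dualEdges E) Y ∩ X) + p * ∑ a, μ.real (Y ∩ ImaNeg E a Z) ≤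
      p * μ.real Y + q * ∑ a, μ.real (X ∩ ImaNeg E a Y) + Fintype.card A * ε := by
  have hYm : MeasurableSet Y := by
    rw [hY]; exact (meas_ImPos hG hX).inter (meas_ImPos hG.dual hZ)
  have hMY : ∀ a, MeasurableSet (Y ∩ ImaNeg E a Z) :=
    fun a => hYm.inter (meas_ImaNeg hG a hZ)
  have hMX : ∀ a, MeasurableSet (X ∩ ImaNeg E a Y) :=
    fun a => hX.inter (meas_ImaNeg hG a hYm)
  rw [layer_cake hMY, layer_cake hMX, Finset.sum_range_succ', Finset.sum_range_succ']
  have hsubY : ∀ t, {y | t < cnt (fun a => Y ∩ ImaNeg E a Z) y} ⊆ Y := by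
    intro t y hy
    have hpos : 0 < cnt (fun a => Y ∩ ImaNeg E a Z) y := lt_of_le_of_lt (Nat.zero_le t) hy
    obtain ⟨a, ha⟩ := Finset.card_pos.1 hpos
    simp only [Finset.mem_filter] at ha
    exact ha.2.1
  have hsub : ∀ t, ImPos (dualEdges E) {y | t < cnt (fun a => Y ∩ ImaNeg E a Z) y} ∩ X ⊆
      {x | t < cnt (fun a => X ∩ ImaNeg E a Y) x} := by
    rintro t x ⟨hx1, hx⟩
    obtain ⟨a, y, hy, he⟩ := mem_ImPos_dual.1 hx1
    subst hY
    exact lt_of_lt_of_le hy (cnt_le hG.uniqueOut hS hx he)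
  have hterm : ∀ t, p * μ.real {y | t < cnt (fun a => Y ∩ ImaNeg E a Z) y} ≤
      q * μ.real {x | t < cnt (fun a => X ∩ ImaNeg E a Y) x} + ε := by
    intro t
    refine (hall _ (hsubY t) (meas_cnt hMY t)).trans ?_
    gcongr
    · exact measure_ne_top _ _
    · exact hsub t
  have hsum : p * ∑ t ∈ Finset.range (Fintype.card A),
        μ.real {y | t + 1 < cnt (fun a => Y ∩ ImaNeg E a Z) y} ≤
      q * ∑ t ∈ Finset.range (Fintype.card A),
        μ.real {x | t + 1 < cnt (fun a => X ∩ ImaNeg E a Y) x} + Fintype.card A * ε := by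
    rw [Finset.mul_sum, Finset.mul_sum]
    calc _ ≤ ∑ t ∈ Finset.range (Fintype.card A),
        (q * μ.real {x | t + 1 < cnt (fun a => X ∩ ImaNeg E a Y) x} + ε) :=
          Finset.sum_le_sum fun t _ => hterm (t + 1)
      _ = _ := by rw [Finset.sum_add_distrib]; simp
  have h0 : p * μ.real {y | 0 < cnt (fun a => Y ∩ ImaNeg E a Z) y} ≤ p * μ.real Y := by
    gcongr
    · exact measure_ne_top _ _
    · exact hsubY 0
  have h0' : q * μ.real (ImPos (dualEdges E) Y ∩ X) ≤
      q * μ.real {x | 0 < cnt (fun a => X ∩ ImaNeg E a Y) x} := by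
    gcongr
    · exact measure_ne_top _ _
    · refine subset_trans ?_ (hsub 0)
      rintro x ⟨hx1, hx⟩
      refine ⟨?_, hx⟩
      obtain ⟨a, y, hy, he⟩ := mem_ImPos_dual.1 hx1
      refine mem_ImPos_dual.2 ⟨a, y, ?_, he⟩
      have hy2 := hy
      rw [hY] at hy2
      obtain ⟨b, z, hz, hyz⟩ := mem_ImPos_dual.1 hy2.2
      show 0 < cnt _ y
      refine Finset.card_pos.2 ⟨b, ?_⟩
      simp only [Finset.mem_filter, Finset.mem_univ, true_and]
      exact ⟨hy, z, hz, hyz⟩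
  linarith [mul_add p (∑ t ∈ Finset.range (Fintype.card A),
        μ.real {y | t + 1 < cnt (fun a => Y ∩ ImaNeg E a Z) y})
        (μ.real {y | 0 < cnt (fun a => Y ∩ ImaNeg E a Z) y}),
    mul_add q (∑ t ∈ Finset.range (Fintype.card A),
        μ.real {x | t + 1 < cnt (fun a => X ∩ ImaNeg E a Y) x})
        (μ.real {x | 0 < cnt (fun a => X ∩ ImaNeg E a Y) x})]

/-- local pushing inequality -/
theorem push_ineq [MeasurableSpace V] {μ : Measure V} [IsFiniteMeasure μ] [Fintype A]
    {E : Set (V × V × A)} (hG : IsMeasureGraph μ E) (hS : IsCommutativeGraph E)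
    {X Z Y : Set V} (hX : MeasurableSet X) (hZ : MeasurableSet Z)
    (hY : Y = ImPos E X ∩ ImPos (dualEdges E) Z) {c r ε : ℝ} (hc : 0 ≤ c) (hr : 0 ≤ r)
    (hall1 : ∀ U ⊆ Y, MeasurableSet U →
      (c * r) * μ.real U ≤ (c * (c * r)) * μ.real (ImPos (dualEdges E) U ∩ X) + ε)
    (hall2 : ∀ U ⊆ Y, MeasurableSet U →
      (c * r) * μ.real U ≤ r * μ.real (ImPos E U ∩ Z) + ε) :
    (c * (c * r)) * μ.real (ImPos (dualEdges E) Y ∩ X) ≤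
      (c * r) * μ.real Y + (Fintype.card A + c * (Fintype.card A + 1)) * ε := by
  have hYm : MeasurableSet Y := by
    rw [hY]; exact (meas_ImPos hG hX).inter (meas_ImPos hG.dual hZ)
  have h1 := half hG hS.1 hX hZ hY (by positivity) (by positivity) hall1
  have hY' : Y = ImPos (dualEdges E) Z ∩ ImPos (dualEdges (dualEdges E)) X := by
    rw [hY, Set.inter_comm]; rfl
  have h2 := half hG.dual hS.2 hZ hX hY' (by positivity) hr hall2
  have h3 := hall2 Y subset_rfl hYm
  have e1 : ∑ a, μ.real (Y ∩ ImaNeg (dualEdges E) a X) = ∑ a, μ.real (X ∩ ImaNeg E a Y) :=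
    Finset.sum_congr rfl fun a _ => edge_count hG a hX hYm
  have e2 : ∑ a, μ.real (Z ∩ ImaNeg (dualEdges E) a Y) = ∑ a, μ.real (Y ∩ ImaNeg E a Z) :=
    Finset.sum_congr rfl fun a _ => edge_count hG a hYm hZ
  rw [e1, e2, dual_dual] at h2
  have h4 : (c * r) * ∑ a, μ.real (X ∩ ImaNeg E a Y) ≤
      r * ∑ a, μ.real (Y ∩ ImaNeg E a Z) + (Fintype.card A + 1) * ε := by linarith
  have h5 := mul_le_mul_of_nonneg_left h4 hc
  linarith

/-! ### weights -/

/-- real-valued weight, `d` is the inverse of `C` -/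
noncomputable def realWeight [MeasurableSpace V] (μ : Measure V) (L : ℕ → Set V)
    (h : ℕ) (d : ℝ) (S : Set V) : ℝ :=
  ∑ j ∈ Finset.range (h + 1), d ^ j * μ.real (S ∩ L j)

section W
variable [MeasurableSpace V] {μ : Measure V} [IsFiniteMeasure μ] {L : ℕ → Set V}
  {h : ℕ} {d : ℝ}

theorem realWeight_nonneg (hd : 0 ≤ d) (S : Set V) : 0 ≤ realWeight μ L h d S :=
  Finset.sum_nonneg fun _ _ => by positivity

theorem realWeight_mono (hd : 0 ≤ d) {S T : Set V} (hST : S ⊆ T) :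
    realWeight μ L h d S ≤ realWeight μ L h d T := by
  refine Finset.sum_le_sum fun j _ => ?_
  refine mul_le_mul_of_nonneg_left ?_ (by positivity)
  exact measureReal_mono (Set.inter_subset_inter_left _ hST)

theorem realWeight_union_le (hd : 0 ≤ d) (S T : Set V) :
    realWeight μ L h d (S ∪ T) ≤ realWeight μ L h d S + realWeight μ L h d T := by
  unfold realWeight
  rw [← Finset.sum_add_distrib]
  refine Finset.sum_le_sum fun j _ => ?_
  rw [← mul_add, Set.union_inter_distrib_right]
  exact mul_le_mul_of_nonneg_left (measureReal_union_le _ _) (by positivity)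

theorem realWeight_union (hL : ∀ j, MeasurableSet (L j)) {S T : Set V} (hT : MeasurableSet T)
    (hST : Disjoint S T) :
    realWeight μ L h d (S ∪ T) = realWeight μ L h d S + realWeight μ L h d T := by
  unfold realWeight
  rw [← Finset.sum_add_distrib]
  refine Finset.sum_congr rfl fun j _ => ?_
  rw [← mul_add, Set.union_inter_distrib_right, measureReal_union _ (hT.inter (hL j))]
  exact hST.mono Set.inter_subset_left Set.inter_subset_left

theorem realWeight_layer (hdis : ∀ i j, i ≠ j → Disjoint (L i) (L j)) {k : ℕ} (hk : k ≤ h)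
    {S : Set V} (hS : S ⊆ L k) : realWeight μ L h d S = d ^ k * μ.real S := by
  unfold realWeight
  rw [Finset.sum_eq_single k]
  · rw [Set.inter_eq_left.2 hS]
  · intro j _ hj
    have : S ∩ L j = ∅ := Set.disjoint_iff_inter_eq_empty.1 ((hdis k j (Ne.symm hj)).mono_left hS)
    simp [this]
  · intro hk'
    simp at hk'
    omega

end W

/-! ### paths -/

/-- vertices reachable from `B` in exactly `n` steps avoiding `S` -/
def reach (E : Set (V × V × A)) (B S : Set V) : ℕ → Set V
  | 0 => B \ S
  | n + 1 => ImPos E (reach E B S n) \ S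

theorem meas_reach [MeasurableSpace V] {μ : Measure V} [Fintype A]
    {E : Set (V × V × A)} (hG : IsMeasureGraph μ E) {B S : Set V} (hB : MeasurableSet B)
    (hS : MeasurableSet S) (n : ℕ) : MeasurableSet (reach E B S n) := by
  induction n with
  | zero => exact hB.diff hS
  | succ n ih => exact (meas_ImPos hG ih).diff hS

theorem reach_path {E : Set (V × V × A)} {B S : Set V} {n : ℕ} {x : V}
    (hx : x ∈ reach E B S n) : ∃ p : ℕ → V, p 0 ∈ B ∧ p n = x ∧
      (∀ i < n, ∃ a, (p i, p (i + 1), a) ∈ E) ∧ ∀ i ≤ n, p i ∉ S := by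
  induction n generalizing x with
  | zero => exact ⟨fun _ => x, hx.1, rfl, by simp, fun _ _ => hx.2⟩
  | succ n ih =>
    obtain ⟨h1, h2⟩ := hx
    obtain ⟨a, w, hw, he⟩ := mem_ImPos.1 h1
    obtain ⟨p, p0, pn, pe, pS⟩ := ih hw
    refine ⟨fun i => if i ≤ n then p i else x, by simpa using p0, by simp, ?_, ?_⟩
    · intro i hi
      rcases Nat.lt_succ_iff_lt_or_eq.1 hi with hi | rfl
      · have h3 : i ≤ n := by omega
        have h4 : i + 1 ≤ n := by omega
        simpa [h3, h4] using pe i hi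
      · refine ⟨a, ?_⟩
        simpa [pn] using he
    · intro i hi
      by_cases h3 : i ≤ n
      · simpa [h3] using pS i h3
      · simpa [h3] using h2

theorem path_reach {E : Set (V × V × A)} {B S : Set V} {n : ℕ} {p : ℕ → V} (p0 : p 0 ∈ B)
    (pe : ∀ i < n, ∃ a, (p i, p (i + 1), a) ∈ E) (pS : ∀ i ≤ n, p i ∉ S) :
    p n ∈ reach E B S n := by
  induction n with
  | zero => exact ⟨p0, pS 0 le_rfl⟩
  | succ n ih =>
    refine ⟨?_, pS _ le_rfl⟩
    obtain ⟨a, ha⟩ := pe n (by omega)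
    exact mem_ImPos.2 ⟨a, _, ih (fun i hi => pe i (by omega)) (fun i hi => pS i (by omega)), ha⟩

section Lay
variable [MeasurableSpace V] {E : Set (V × V × A)} {h : ℕ} {L : ℕ → Set V}

theorem edge_up (hLay : IsLayering E h L) {x y : V} {a : A} {i : ℕ} (hx : x ∈ L i)
    (he : (x, y, a) ∈ E) : y ∈ L (i + 1) := by
  obtain ⟨j, _, h1, h2⟩ := hLay.2.2.2 x y a he
  by_cases hij : i = j
  · rwa [hij]
  · exact absurd h1 (Set.disjoint_left.1 (hLay.2.2.1 i j hij) hx)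

theorem edge_down (hLay : IsLayering E h L) {x y : V} {a : A} {i : ℕ} (hy : y ∈ L (i + 1))
    (he : (x, y, a) ∈ E) : x ∈ L i := by
  obtain ⟨j, _, h1, h2⟩ := hLay.2.2.2 x y a he
  by_cases hij : i = j
  · rwa [hij]
  · exact absurd h2 (Set.disjoint_left.1 (hLay.2.2.1 (i + 1) (j + 1) (by omega)) hy)

theorem path_layer (hLay : IsLayering E h L) {p : ℕ → V} {n : ℕ} (p0 : p 0 ∈ L 0)
    (pe : ∀ i < n, ∃ a, (p i, p (i + 1), a) ∈ E) : ∀ i ≤ n, p i ∈ L i := by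
  intro i
  induction i with
  | zero => intro _; exact p0
  | succ i ih =>
    intro hi
    obtain ⟨a, ha⟩ := pe i (by omega)
    exact edge_up hLay (ih (by omega)) ha

theorem reach_layer (hLay : IsLayering E h L) {S : Set V} (n : ℕ) :
    reach E (L 0) S n ⊆ L n := by
  intro x hx
  obtain ⟨p, p0, pn, pe, -⟩ := reach_path hx
  rw [← pn]
  exact path_layer hLay p0 pe n le_rfl

theorem reach_dual_layer (hLay : IsLayering E h L) {S : Set V} (n k : ℕ) (hk : k + n = h) :
    reach (dualEdges E) (L h) S n ⊆ L k := by
  induction n generalizing k with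
  | zero => intro x hx; simp at hk; subst hk; exact hx.1
  | succ n ih =>
    intro x hx
    obtain ⟨a, w, hw, he⟩ := mem_ImPos_dual.1 hx.1
    exact edge_down hLay (ih (k + 1) (by omega) hw) he

/-- the separating middle layer is inside the cutset -/
theorem mid_subset (hLay : IsLayering E h L) {S : Set V} (hcut : IsCutset E h L S) {k n : ℕ}
    (hk : k + 2 + n = h) :
    ImPos E (reach E (L 0) S k) ∩ ImPos (dualEdges E) (reach (dualEdges E) (L h) S n) ⊆ S := by
  rintro y ⟨h1, h2⟩
  obtain ⟨a, x, hx, hxy⟩ := mem_ImPos.1 h1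
  obtain ⟨b, z, hz, hyz⟩ := mem_ImPos_dual.1 h2
  obtain ⟨p, p0, pk, pe, pS⟩ := reach_path hx
  obtain ⟨q, q0, qn, qe, qS⟩ := reach_path hz
  obtain ⟨i, hi, hiS⟩ := hcut
    (fun i => if i ≤ k then p i else if i = k + 1 then y else q (h - i))
    (by simpa using p0) (by
      have e1 : ¬ h ≤ k := by omega
      have e2 : ¬ h = k + 1 := by omega
      simpa [e1, e2] using q0) (by
      intro i hi
      rcases lt_trichotomy i k with hik | hik | hik
      · have e1 : i ≤ k := by omega
        have e2 : i + 1 ≤ k := by omega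
        simpa [e1, e2] using pe i hik
      · subst hik
        refine ⟨a, ?_⟩
        simpa [pk] using hxy
      · by_cases hik2 : i = k + 1
        · subst hik2
          refine ⟨b, ?_⟩
          have e : h - (k + 1 + 1) = n := by omega
          simpa [e, qn] using hyz
        · have e1 : ¬ i ≤ k := by omega
          have e2 : ¬ i + 1 ≤ k := by omega
          have e3 : ¬ i = k := by omega
          obtain ⟨c, hc⟩ := qe (h - (i + 1)) (by omega)
          refine ⟨c, ?_⟩
          have e : h - (i + 1) + 1 = h - i := by omega
          rw [e] at hc
          have hc' : (q (h - i), q (h - (i + 1)), c) ∈ E := hc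
          simpa [e1, e2, e3, hik2] using hc')
  by_cases e1 : i ≤ k
  · simp only [e1, if_true] at hiS
    exact absurd hiS (pS i e1)
  · by_cases e2 : i = k + 1
    · simpa [e1, e2] using hiS
    · simp only [e1, e2, if_false] at hiS
      exact absurd hiS (qS _ (by omega))

theorem replace_cut (hLay : IsLayering E h L) {S S' : Set V} {k n : ℕ}
    (hk : k + 2 + n = h) (hsub : S \ L (k + 1) ⊆ S')
    (hmid : ∀ x ∈ reach E (L 0) S k, ∀ z ∈ reach (dualEdges E) (L h) S n, ∀ y,
      ∀ a b, (x, y, a) ∈ E → (y, z, b) ∈ E → x ∈ S' ∨ y ∈ S' ∨ z ∈ S') :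
    IsCutset E h L S' := by
  intro p p0 ph pe
  by_contra hno
  push Not at hno
  have hl := path_layer hLay p0 pe
  have hS : ∀ i ≤ h, i ≠ k + 1 → p i ∉ S := by
    intro i hi hik hiS
    exact hno i hi (hsub ⟨hiS, Set.disjoint_left.1 (hLay.2.2.1 i (k + 1) hik) (hl i hi)⟩)
  have hX : p k ∈ reach E (L 0) S k :=
    path_reach p0 (fun i hi => pe i (by omega)) (fun i hi => hS i (by omega) (by omega))
  have hZ : (fun j => p (h - j)) n ∈ reach (dualEdges E) (L h) S n := by
    refine path_reach (p := fun j => p (h - j)) (by simpa using ph) ?_ ?_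
    · intro i hi
      obtain ⟨a, ha⟩ := pe (h - (i + 1)) (by omega)
      have e : h - (i + 1) + 1 = h - i := by omega
      rw [e] at ha
      exact ⟨a, ha⟩
    · intro i hi
      exact hS _ (by omega) (by omega)
  have e : h - n = k + 1 + 1 := by omega
  simp only [e] at hZ
  obtain ⟨a, ha⟩ := pe k (by omega)
  obtain ⟨b, hb⟩ := pe (k + 1) (by omega)
  rcases hmid _ hX _ hZ _ a b ha hb with h1 | h1 | h1
  · exact hno _ (by omega) h1
  · exact hno _ (by omega) h1
  · exact hno _ (by omega) h1

end Lay

theorem push_step [MeasurableSpace V] {μ : Measure V} [IsFiniteMeasure μ] [Fintype A]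
    {E : Set (V × V × A)} (hG : IsMeasureGraph μ E) (hS : IsCommutativeGraph E)
    {h : ℕ} {L : ℕ → Set V} (hLay : IsLayering E h L) {c d m ε : ℝ} (hc : 0 ≤ c) (hd : 0 ≤ d)
    (hcd : c * d = 1)
    (hm : ∀ S, MeasurableSet S → IsCutset E h L S → m ≤ realWeight μ L h d S)
    {S : Set V} (hSm : MeasurableSet S) (hcut : IsCutset E h L S)
    (hSε : realWeight μ L h d S ≤ m + ε) {k n : ℕ} (hk : k + 2 + n = h) :
    ∃ S' : Set V, MeasurableSet S' ∧ IsCutset E h L S' ∧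
      realWeight μ L h d S' ≤ m + (1 + Fintype.card A + c * (Fintype.card A + 1)) * ε ∧
      S' ⊆ (S \ L (k + 1)) ∪ L k := by
  set X := reach E (L 0) S k with hXdef
  set Z := reach (dualEdges E) (L h) S n with hZdef
  set Y := ImPos E X ∩ ImPos (dualEdges E) Z with hYdef
  have hX : MeasurableSet X := meas_reach hG (hLay.1 0) hSm k
  have hZ : MeasurableSet Z := meas_reach hG.dual (hLay.1 h) hSm n
  have hYm : MeasurableSet Y := (meas_ImPos hG hX).inter (meas_ImPos hG.dual hZ)
  have hYS : Y ⊆ S := mid_subset hLay hcut hk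
  have hXL : X ⊆ L k := reach_layer hLay k
  have hZL : Z ⊆ L (k + 2) := reach_dual_layer hLay n (k + 2) hk
  have hYL : Y ⊆ L (k + 1) := by
    rintro y ⟨hy, -⟩
    obtain ⟨a, x, hx, he⟩ := mem_ImPos.1 hy
    exact edge_up hLay (hXL hx) he
  have hmemY : ∀ x ∈ X, ∀ z ∈ Z, ∀ y, ∀ a b, (x, y, a) ∈ E → (y, z, b) ∈ E → y ∈ Y :=
    fun x hx z hz y a b h1 h2 => ⟨mem_ImPos.2 ⟨a, x, hx, h1⟩, mem_ImPos_dual.2 ⟨b, z, hz, h2⟩⟩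
  have hdisj := hLay.2.2.1
  have hbase : realWeight μ L h d (S \ L (k + 1)) + d ^ (k + 1) * μ.real Y ≤ m + ε := by
    rw [← realWeight_layer hdisj (h := h) (by omega) hYL, ← realWeight_union hLay.1 hYm]
    · exact (realWeight_mono hd (Set.union_subset Set.sdiff_subset hYS)).trans hSε
    · exact Set.disjoint_left.2 fun x hx hy => hx.2 (hYL hy)
  have hYU : ∀ U ⊆ Y, MeasurableSet U → μ.real (Y \ U) = μ.real Y - μ.real U :=
    fun U hU hUm => measureReal_sdiff hU hUm
  -- general Hall-type inequality
  have hgen : ∀ U ⊆ Y, MeasurableSet U → ∀ P : Set V, MeasurableSet P → ∀ i ≤ h, P ⊆ L i →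
      (∀ x ∈ X, ∀ z ∈ Z, ∀ y ∈ U, ∀ a b, (x, y, a) ∈ E → (y, z, b) ∈ E → x ∈ P ∨ z ∈ P) →
      IsCutset E h L (S \ L (k + 1) ∪ (Y \ U ∪ P)) := by
    intro U hU hUm P hP i hi hPL hprop
    refine replace_cut hLay hk Set.subset_union_left ?_
    intro x hx z hz y a b h1 h2
    by_cases hyU : y ∈ U
    · rcases hprop x hx z hz y hyU a b h1 h2 with h3 | h3
      · exact Or.inl (Or.inr (Or.inr h3))
      · exact Or.inr (Or.inr (Or.inr (Or.inr h3)))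
    · exact Or.inr (Or.inl (Or.inr (Or.inl ⟨hmemY x hx z hz y a b h1 h2, hyU⟩)))
  have hgen2 : ∀ U ⊆ Y, MeasurableSet U → ∀ P : Set V, MeasurableSet P → ∀ i ≤ h, P ⊆ L i →
      (∀ x ∈ X, ∀ z ∈ Z, ∀ y ∈ U, ∀ a b, (x, y, a) ∈ E → (y, z, b) ∈ E → x ∈ P ∨ z ∈ P) →
      d ^ (k + 1) * μ.real U ≤ d ^ i * μ.real P + ε := by
    intro U hU hUm P hP i hi hPL hprop
    have h1 := hm _ ((hSm.diff (hLay.1 _)).union ((hYm.diff hUm).union hP))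
      (hgen U hU hUm P hP i hi hPL hprop)
    have h2 := realWeight_union_le (μ := μ) (L := L) (h := h) hd (S \ L (k + 1)) (Y \ U ∪ P)
    have h3 := realWeight_union_le (μ := μ) (L := L) (h := h) hd (Y \ U) P
    rw [realWeight_layer hdisj (by omega) (Set.sdiff_subset.trans hYL), realWeight_layer hdisj hi hPL,
      hYU U hU hUm, mul_sub] at h3
    linarith
  have e1 : c * d ^ (k + 2) = d ^ (k + 1) := by
    rw [pow_succ' d (k + 1), ← mul_assoc, hcd, one_mul]
  have e0 : c * d ^ (k + 1) = d ^ k := by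
    rw [pow_succ' d k, ← mul_assoc, hcd, one_mul]
  have hpush := push_ineq hG hS hX hZ hYdef hc (r := d ^ (k + 2)) (ε := ε) (by positivity)
    (by
      intro U hU hUm
      rw [e1, e0]
      refine hgen2 U hU hUm _ ((meas_ImPos hG.dual hUm).inter hX) k (by omega)
        (Set.inter_subset_right.trans hXL) ?_
      intro x hx z hz y hy a b h1 h2
      exact Or.inl ⟨mem_ImPos_dual.2 ⟨a, y, hy, h1⟩, hx⟩)
    (by
      intro U hU hUm
      rw [e1]
      refine hgen2 U hU hUm _ ((meas_ImPos hG hUm).inter hZ) (k + 2) (by omega)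
        (Set.inter_subset_right.trans hZL) ?_
      intro x hx z hz y hy a b h1 h2
      exact Or.inr ⟨mem_ImPos.2 ⟨b, y, hy, h2⟩, hz⟩)
  rw [e1, e0] at hpush
  have hPm : MeasurableSet (ImPos (dualEdges E) Y ∩ X) := (meas_ImPos hG.dual hYm).inter hX
  have hPL : ImPos (dualEdges E) Y ∩ X ⊆ L k := Set.inter_subset_right.trans hXL
  refine ⟨S \ L (k + 1) ∪ (Y \ Y ∪ (ImPos (dualEdges E) Y ∩ X)),
    (hSm.diff (hLay.1 _)).union ((hYm.diff hYm).union hPm),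
    hgen Y subset_rfl hYm _ hPm k (by omega) hPL ?_, ?_, ?_⟩
  · intro x hx z hz y hy a b h1 h2
    exact Or.inl ⟨mem_ImPos_dual.2 ⟨a, y, hy, h1⟩, hx⟩
  · rw [Set.sdiff_self, Set.empty_union]
    have h2 := realWeight_union_le (μ := μ) (L := L) (h := h) hd (S \ L (k + 1))
      (ImPos (dualEdges E) Y ∩ X)
    rw [realWeight_layer hdisj (k := k) (by omega) hPL] at h2
    linarith
  · rw [Set.sdiff_self, Set.empty_union]
    exact Set.union_subset_union_right _ hPL

theorem push_all [MeasurableSpace V] {μ : Measure V} [IsFiniteMeasure μ] [Fintype A]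
    {E : Set (V × V × A)} (hG : IsMeasureGraph μ E) (hS : IsCommutativeGraph E)
    {h : ℕ} {L : ℕ → Set V} (hLay : IsLayering E h L) {c d m : ℝ} (hc : 0 ≤ c) (hd : 0 ≤ d)
    (hcd : c * d = 1)
    (hm : ∀ S, MeasurableSet S → IsCutset E h L S → m ≤ realWeight μ L h d S)
    (hm2 : ∀ ε > 0, ∃ S, MeasurableSet S ∧ IsCutset E h L S ∧ realWeight μ L h d S ≤ m + ε)
    (n : ℕ) (hn : n + 1 ≤ h) : ∀ ε > 0, ∃ S, MeasurableSet S ∧ IsCutset E h L S ∧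
      realWeight μ L h d S ≤ m + ε ∧ ∀ i, h ≤ i + n → i < h → Disjoint S (L i) := by
  induction n with
  | zero =>
    intro ε hε
    obtain ⟨S, h1, h2, h3⟩ := hm2 ε hε
    exact ⟨S, h1, h2, h3, fun i hi hi2 => by omega⟩
  | succ n ih =>
    intro ε hε
    set K : ℝ := 1 + Fintype.card A + c * (Fintype.card A + 1) with hK
    have hKpos : 0 < K := by positivity
    obtain ⟨S, h1, h2, h3, h4⟩ := ih (by omega) (ε / K) (by positivity)
    obtain ⟨k, hk⟩ : ∃ k, k + 2 + n = h := ⟨h - (n + 2), by omega⟩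
    obtain ⟨S', g1, g2, g3, g4⟩ := push_step hG hS hLay hc hd hcd hm h1 h2 h3 hk
    refine ⟨S', g1, g2, ?_, ?_⟩
    · rw [← hK, mul_div_cancel₀ _ hKpos.ne'] at g3
      exact g3
    · intro i hi hi2
      refine Disjoint.mono_left g4 ?_
      rw [Set.disjoint_union_left]
      refine ⟨?_, hLay.2.2.1 k i (by omega)⟩
      by_cases hik : i = k + 1
      · subst hik
        exact Set.disjoint_sdiff_left
      · exact (h4 i (by omega) hi2).mono_left Set.sdiff_subset

theorem ImIter_succ (E : Set (V × V × A)) (n : ℕ) (W : Set V) :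
    ImIter E (n + 1) W = ImPos E (ImIter E n W) := by
  simp [ImIter, Function.iterate_succ_apply']

theorem ImIter_reach {E : Set (V × V × A)} {W : Set V} (n : ℕ) :
    reach E W ∅ n = ImIter E n W := by
  induction n with
  | zero => simp [reach, ImIter]
  | succ n ih => rw [ImIter_succ, ← ih]; simp [reach]

theorem real_bound [MeasurableSpace V] {μ : Measure V} [IsFiniteMeasure μ] [Fintype A]
    {E : Set (V × V × A)} (hG : IsMeasureGraph μ E) (hS : IsCommutativeGraph E)
    {h : ℕ} (hh : 0 < h) {L : ℕ → Set V} (hLay : IsLayering E h L) {c d : ℝ}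
    (hc : 0 ≤ c) (hd : 0 ≤ d) (hcd : c * d = 1)
    (hD : ∀ Y ⊆ L 0, MeasurableSet Y → μ.real Y ≤ d ^ h * μ.real (ImIter E h Y))
    {S : Set V} (hSm : MeasurableSet S) (hcut : IsCutset E h L S) :
    μ.real (L 0) ≤ realWeight μ L h d S := by
  set T : Set ℝ := {r | ∃ S, MeasurableSet S ∧ IsCutset E h L S ∧ realWeight μ L h d S = r} with hT
  have hbdd : BddBelow T := ⟨0, by rintro r ⟨S, -, -, rfl⟩; exact realWeight_nonneg hd S⟩
  have hne : T.Nonempty := ⟨_, S, hSm, hcut, rfl⟩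
  have hm : ∀ S, MeasurableSet S → IsCutset E h L S → sInf T ≤ realWeight μ L h d S :=
    fun S h1 h2 => csInf_le hbdd ⟨S, h1, h2, rfl⟩
  have hm2 : ∀ ε > 0, ∃ S, MeasurableSet S ∧ IsCutset E h L S ∧
      realWeight μ L h d S ≤ sInf T + ε := by
    intro ε hε
    obtain ⟨r, ⟨S, h1, h2, rfl⟩, h3⟩ := exists_lt_of_csInf_lt hne (lt_add_of_pos_right (sInf T) hε)
    exact ⟨S, h1, h2, h3.le⟩
  refine le_trans ?_ (hm S hSm hcut)
  refine le_of_forall_pos_le_add fun ε hε => ?_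
  obtain ⟨S', g1, g2, g3, g4⟩ := push_all hG hS hLay hc hd hcd hm hm2 (h - 1) (by omega) ε hε
  refine le_trans ?_ g3
  have hIm : ImIter E h (L 0 \ S') ⊆ S' ∩ L h := by
    intro v hv
    rw [← ImIter_reach] at hv
    obtain ⟨p, p0, pn, pe, -⟩ := reach_path hv
    have hl := path_layer hLay p0.1 pe
    have hvh : v ∈ L h := by rw [← pn]; exact hl h le_rfl
    refine ⟨?_, hvh⟩
    obtain ⟨i, hi, hiS⟩ := g2 p p0.1 (hl h le_rfl) pe
    rcases Nat.eq_zero_or_pos i with rfl | hi0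
    · exact absurd hiS p0.2
    · rcases hi.lt_or_eq with hlt | rfl
      · exact absurd (hl i hi) (Set.disjoint_left.1 (g4 i (by omega) hlt) hiS)
      · rwa [pn] at hiS
  have h1 := hD (L 0 \ S') Set.sdiff_subset ((hLay.1 0).diff g1)
  have h2 : μ.real (ImIter E h (L 0 \ S')) ≤ μ.real (S' ∩ L h) := measureReal_mono hIm
  have h2' := mul_le_mul_of_nonneg_left h2 (pow_nonneg hd h)
  have h3 : μ.real (L 0) ≤ μ.real (S' ∩ L 0) + μ.real (L 0 \ S') := by
    refine (measureReal_mono ?_).trans (measureReal_union_le _ _)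
    intro x hx
    by_cases hxS : x ∈ S'
    · exact Or.inl ⟨hxS, hx⟩
    · exact Or.inr ⟨hx, hxS⟩
  have h4 : realWeight μ L h d ((S' ∩ L 0) ∪ (S' ∩ L h)) ≤ realWeight μ L h d S' :=
    realWeight_mono hd (Set.union_subset Set.inter_subset_left Set.inter_subset_left)
  rw [realWeight_union hLay.1 (g1.inter (hLay.1 h)) ((hLay.2.2.1 0 h (by omega)).mono
    Set.inter_subset_right Set.inter_subset_right),
    realWeight_layer hLay.2.2.1 (k := 0) (by omega) Set.inter_subset_right,
    realWeight_layer hLay.2.2.1 (k := h) le_rfl Set.inter_subset_right] at h4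
  simp only [pow_zero, one_mul] at h4
  linarith

theorem graphWeight_eq [MeasurableSpace V] {μ : Measure V} [IsFiniteMeasure μ]
    {L : ℕ → Set V} {h : ℕ} {c : ℝ} (hc : 0 < c) (S : Set V) :
    graphWeight μ L h (ENNReal.ofReal c) S = ENNReal.ofReal (realWeight μ L h c⁻¹ S) := by
  unfold graphWeight realWeight
  rw [ENNReal.ofReal_sum_of_nonneg (fun _ _ => by positivity)]
  refine Finset.sum_congr rfl fun j _ => ?_
  rw [ENNReal.ofReal_mul (by positivity), ENNReal.ofReal_pow (by positivity),
    ENNReal.ofReal_inv_of_pos hc, ofReal_measureReal]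

end Helpers

/-- If `Γ` is an `h`-layered commutative measure graph with `D_h^{1/h} > 0` and `w` is the
weight corresponding to `C = D_h^{1/h}`, then the bottom layer `V_0` is a cutset of minimal
weight: `w(V_0) ≤ w(S)` for every measurable cutset `S`. -/
theorem bottom_layer_minimal_cutset [MeasurableSpace V] [Fintype A]
    (μ : Measure V) (E : Set (V × V × A)) (hGraph : IsMeasureGraph μ E)
    (h : ℕ) (hh : 0 < h) (L : ℕ → Set V) (hLay : IsLayering E h L)
    (hComm : IsCommutativeGraph E)
    (hC : 0 < magD μ E L h ^ (1 / (h : ℝ))) :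
    IsCutset E h L (L 0) ∧
      ∀ S : Set V, MeasurableSet S → IsCutset E h L S →
        graphWeight μ L h (magD μ E L h ^ (1 / (h : ℝ))) (L 0) ≤
          graphWeight μ L h (magD μ E L h ^ (1 / (h : ℝ))) S := by
  have : IsFiniteMeasure μ := ⟨lt_top_iff_ne_top.2 hGraph.finiteMeasure⟩
  refine ⟨fun p p0 _ _ => ⟨0, Nat.zero_le _, p0⟩, ?_⟩
  intro S hS hcut
  have hdisj := hLay.2.2.1
  by_cases h0 : μ (L 0) = 0
  · have hz : ∀ C : ℝ≥0∞, graphWeight μ L h C (L 0) = 0 := by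
      intro C
      refine Finset.sum_eq_zero fun j _ => ?_
      rw [measure_mono_null Set.inter_subset_left h0, mul_zero]
    rw [hz]
    exact bot_le
  set D := magD μ E L h with hDdef
  have hDle : ∀ Y ⊆ L 0, MeasurableSet Y → D * μ Y ≤ μ (ImIter E h Y) := by
    intro Y hY hYm
    by_cases hY0 : μ Y = 0
    · simp [hY0]
    · have : D ≤ μ (ImIter E h Y) / μ Y :=
        sInf_le ⟨Y, hY, hYm, pos_iff_ne_zero.2 hY0, rfl⟩
      rwa [ENNReal.le_div_iff_mul_le (Or.inl hY0) (Or.inl (measure_ne_top _ _))] at this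
  have hDtop : D ≠ ⊤ := by
    intro hD
    have := hDle (L 0) subset_rfl (hLay.1 0)
    rw [hD, ENNReal.top_mul h0] at this
    exact measure_ne_top _ _ (top_le_iff.1 this)
  have hh' : (0 : ℝ) < 1 / (h : ℝ) := by positivity
  have hCtop : D ^ (1 / (h : ℝ)) ≠ ⊤ := ENNReal.rpow_ne_top_of_nonneg hh'.le hDtop
  have hCpow : (D ^ (1 / (h : ℝ))) ^ h = D := by
    rw [← ENNReal.rpow_natCast, ← ENNReal.rpow_mul, one_div,
      inv_mul_cancel₀ (by positivity), ENNReal.rpow_one]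
  generalize D ^ (1 / (h : ℝ)) = C at hC hCtop hCpow
  obtain ⟨c, hc, rfl⟩ : ∃ c : ℝ, 0 < c ∧ C = ENNReal.ofReal c :=
    ⟨C.toReal, ENNReal.toReal_pos hC.ne' hCtop, (ENNReal.ofReal_toReal hCtop).symm⟩
  rw [graphWeight_eq hc, graphWeight_eq hc]
  refine ENNReal.ofReal_le_ofReal ?_
  rw [realWeight_layer hdisj (k := 0) (Nat.zero_le _) subset_rfl, pow_zero, one_mul]
  refine real_bound hGraph hComm hh hLay hc.le (inv_pos.2 hc).le (mul_inv_cancel₀ hc.ne')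
    ?_ hS hcut
  intro Y hY hYm
  have h1 := hDle Y hY hYm
  rw [← hCpow] at h1
  have h2 := ENNReal.toReal_mono (measure_ne_top _ _) h1
  rw [ENNReal.toReal_mul, ENNReal.toReal_pow, ENNReal.toReal_ofReal hc.le] at h2
  change c ^ h * μ.real Y ≤ μ.real (ImIter E h Y) at h2
  rw [inv_pow, ← div_eq_inv_mul, le_div_iff₀ (by positivity)]
  linarith
end
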